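/- arXiv:0811.1570 — 5 statements merged into one kernel-verified Lean document; each statement's English description precedes it below -/
import Mathlib

section
/- Cyclic subsystem codes, Hermitian case: Let D be a k-dimensional cyclic code of length n over F_{q^2} with gcd(n,q) = 1 and D ⊆ D^⊥h, and let T_D and T_{D^⊥h} be the defining sets of D and D^⊥h. Let T be a subset of T_D \ T_{D^⊥h} that is a union of cyclotomic cosets, and let C be the cyclic code of length n over F_{q^2} with defining set T_C = T_D \ (T ∪ T^{−q}). If n − k = |T_D| and r = |T ∪ T^{−q}| satisfies 0 ≤ r < n − 2k, then C ∩ C^⊥h = D, dim_{F_{q^2}} C = k + r, and there exists an [[n, n−2k−r, r, d]]_q Clifford subsystem code with d = wt(D^⊥h \ C), the minimum Hamming weight of a vector in D^⊥h not in C. -/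
open Finset

/-- Symplectic weight of a vector `(a|b) ∈ F_q^n × F_q^n`. -/
noncomputable def swt {F : Type} [Field F] {n : ℕ} (v : (Fin n → F) × (Fin n → F)) : ℕ :=
  {i : Fin n | ¬(v.1 i = 0 ∧ v.2 i = 0)}.ncard

/-- Minimum symplectic weight of a nonzero element of a set. -/
noncomputable def minSwt {F : Type} [Field F] {n : ℕ} (S : Set ((Fin n → F) × (Fin n → F))) : ℕ :=
  sInf (swt '' (S \ {0}))

/-- The trace-symplectic form on `F_q^{2n}`. -/
noncomputable def trSympForm (p : ℕ) {F : Type} [Field F] [Fintype F] [CharP F p] {n : ℕ}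
    (u v : (Fin n → F) × (Fin n → F)) : ZMod p :=
  letI := ZMod.algebra F p
  Algebra.trace (ZMod p) F (∑ i, (v.1 i * u.2 i - u.1 i * v.2 i))

/-- The trace-symplectic dual of a set of vectors in `F_q^{2n}`. -/
def sympDual (p : ℕ) {F : Type} [Field F] [Fintype F] [CharP F p] {n : ℕ}
    (C : Set ((Fin n → F) × (Fin n → F))) : Set ((Fin n → F) × (Fin n → F)) :=
  {v | ∀ w ∈ C, trSympForm p v w = 0}

/-- `C` (an additive code in `F_q^{2n}`) defines an `((n,K,R,d))_q` Clifford subsystem code. -/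
def IsSubsysCode (p : ℕ) {F : Type} [Field F] [Fintype F] [CharP F p] {n : ℕ}
    (C : AddSubgroup ((Fin n → F) × (Fin n → F))) (K R d : ℕ) : Prop :=
  let Ds : Set ((Fin n → F) × (Fin n → F)) := ↑C ∩ sympDual p ↑C
  Nat.card Ds * (K * R) = Fintype.card F ^ n ∧
  Nat.card C * K = Fintype.card F ^ n * R ∧
  (sympDual p Ds = ↑C → d = minSwt (sympDual p Ds)) ∧
  (sympDual p Ds ≠ ↑C → d = minSwt (sympDual p Ds \ ↑C))

/-- The subsystem code defined by `C` is pure to `d'`. -/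
def PureTo {F : Type} [Field F] {n : ℕ}
    (C : AddSubgroup ((Fin n → F) × (Fin n → F))) (d' : ℕ) : Prop :=
  ∀ v ∈ C, v ≠ 0 → d' ≤ swt v

/-- The subsystem code defined by `C` is `F_q`-linear. -/
def FqLinear {F : Type} [Field F] {n : ℕ}
    (C : AddSubgroup ((Fin n → F) × (Fin n → F))) : Prop :=
  ∀ (a : F), ∀ v ∈ C, a • v ∈ C

/-- Hamming weight.-/
noncomputable def hwt {F : Type} [Field F] {n : ℕ} (v : Fin n → F) : ℕ := {i | v i ≠ 0}.ncard

/-- Minimum Hamming weight of a nonzero element of a set. -/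
noncomputable def minHwt {F : Type} [Field F] {n : ℕ} (S : Set (Fin n → F)) : ℕ :=
  sInf (hwt '' (S \ {0}))

/-- Euclidean dual. -/
def euclDual {F : Type} [Field F] {n : ℕ} (C : Set (Fin n → F)) : Set (Fin n → F) :=
  {x | ∀ y ∈ C, ∑ i, x i * y i = 0}

/-- Hermitian dual (with respect to `x ↦ x^q`). -/
def hermDual (q : ℕ) {K : Type} [Field K] {n : ℕ} (C : Set (Fin n → K)) : Set (Fin n → K) :=
  {x | ∀ y ∈ C, ∑ i, x i ^ q * y i = 0}

/-- Cyclotomic coset of `a` modulo `n` (w.r.t. multiplier `q`). -/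
def cycCoset (q n : ℕ) (a : ZMod n) : Set (ZMod n) := {x | ∃ i : ℕ, x = a * (q : ZMod n) ^ i}

section fourier
open Polynomial

/-- Fourier transform of a word. -/
noncomputable def ft {K E : Type} [Field K] [Field E] [Algebra K E] {n : ℕ} (α : E)
    (c : Fin n → K) (t : ZMod n) : E :=
  ∑ i : Fin n, algebraMap K E (c i) * α ^ (t * ((i : ℕ) : ZMod n)).val

lemma pow_val_mul_nat {E : Type} [Field E] {n : ℕ} [NeZero n] {α : E} (hα : IsPrimitiveRoot α n)
    (t : ZMod n) (i : ℕ) : α ^ (t * (i : ZMod n)).val = (α ^ t.val) ^ i := by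
  have h := AddChar.map_nsmul_eq_pow (AddChar.zmodChar n hα.pow_eq_one) i t
  rw [AddChar.zmodChar_apply, AddChar.zmodChar_apply, nsmul_eq_mul, mul_comm] at h
  exact h

lemma pow_val_inj {E : Type} [Field E] {n : ℕ} [NeZero n] {α : E} (hα : IsPrimitiveRoot α n) :
    Function.Injective (fun t : ZMod n => α ^ t.val) := by
  intro a b h
  exact ZMod.val_injective n (hα.pow_inj (ZMod.val_lt a) (ZMod.val_lt b) h)

/-- The polynomial of a word. -/
noncomputable def wpoly {K : Type} [Field K] {n : ℕ} (c : Fin n → K) : K[X] :=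
  ∑ i : Fin n, monomial (i : ℕ) (c i)

lemma wpoly_degree {K : Type} [Field K] {n : ℕ} (c : Fin n → K) : (wpoly c).degree < n :=
  mem_degreeLT.1 ((degreeLTEquiv K n).symm c).2

lemma wpoly_coeff {K : Type} [Field K] {n : ℕ} (c : Fin n → K) (i : Fin n) :
    (wpoly c).coeff i = c i :=
  congrFun ((degreeLTEquiv K n).apply_symm_apply c) i

lemma wpoly_of_coeff {K : Type} [Field K] {n : ℕ} (f : K[X]) (hf : f.degree < n) :
    wpoly (fun i : Fin n => f.coeff i) = f :=
  congrArg Subtype.val ((degreeLTEquiv K n).symm_apply_apply ⟨f, mem_degreeLT.2 hf⟩)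

lemma ft_eq {K E : Type} [Field K] [Field E] [Algebra K E] {n : ℕ} [NeZero n] {α : E}
    (hα : IsPrimitiveRoot α n) (c : Fin n → K) (t : ZMod n) :
    ft α c t = aeval (α ^ t.val) (wpoly c) := by
  unfold ft wpoly
  rw [map_sum]
  refine Finset.sum_congr rfl fun i _ => ?_
  rw [pow_val_mul_nat hα, aeval_monomial]

lemma fixed_mem_range {K E : Type} [Field K] [Fintype K] [Field E] [Algebra K E] (x : E)
    (hx : x ^ Fintype.card K = x) : x ∈ (algebraMap K E).range := by
  classical
  have hs := FiniteField.roots_X_pow_card_sub_X K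
  have h1 : 1 < Fintype.card K := Fintype.one_lt_card
  have hsp : (X ^ Fintype.card K - X : K[X]) = ∏ a : K, (X - C a) := by
    have hm : (X ^ Fintype.card K - X : K[X]).Monic :=
      monic_X_pow_sub (by rw [degree_X]; exact_mod_cast h1)
    have h2 := Polynomial.prod_multiset_X_sub_C_of_monic_of_roots_card_eq hm (by
      rw [hs, FiniteField.X_pow_card_sub_X_natDegree_eq K h1]; simp [Finset.card_univ])
    rw [hs] at h2
    exact h2.symm
  have h3 := congrArg (aeval x) hsp
  rw [map_sub, map_pow, aeval_X, hx, sub_self, map_prod] at h3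
  obtain ⟨a, -, ha⟩ := Finset.prod_eq_zero_iff.1 h3.symm
  rw [map_sub, aeval_X, aeval_C, sub_eq_zero] at ha
  exact ⟨a, ha.symm⟩

lemma closed_image {n : ℕ} [NeZero n] (u : ZMod n) (hu : IsUnit u) (S : Finset (ZMod n))
    (hS : ∀ t ∈ S, u * t ∈ S) : S.image (fun t => u * t) = S := by
  apply Finset.eq_of_subset_of_card_le
  · intro x hx
    obtain ⟨t, ht, rfl⟩ := Finset.mem_image.1 hx
    exact hS t ht
  · rw [Finset.card_image_of_injective _ hu.mul_right_injective]

lemma closed_mem_iff {n : ℕ} [NeZero n] (u : ZMod n) (hu : IsUnit u) (S : Finset (ZMod n))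
    (hS : ∀ t ∈ S, u * t ∈ S) (t : ZMod n) : u * t ∈ S ↔ t ∈ S := by
  refine ⟨fun h => ?_, hS t⟩
  rw [← closed_image u hu S hS] at h
  obtain ⟨s, hs, h2⟩ := Finset.mem_image.1 h
  exact hu.mul_right_injective h2 ▸ hs

/-- generator polynomial -/
lemma exists_gen {K E : Type} [Field K] [Fintype K] [Field E] [Algebra K E] {n : ℕ} [NeZero n]
    {α : E} (hα : IsPrimitiveRoot α n) (S : Finset (ZMod n))
    (hu : IsUnit (Fintype.card K : ZMod n))
    (hS : ∀ t ∈ S, (Fintype.card K : ZMod n) * t ∈ S) :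
    ∃ g : K[X], g.map (algebraMap K E) = ∏ t ∈ S, (X - C (α ^ t.val)) := by
  set G : E[X] := ∏ t ∈ S, (X - C (α ^ t.val)) with hG
  have hfix : G.map (FiniteField.frobeniusAlgHom K E : E →+* E) = G := by
    rw [hG, Polynomial.map_prod]
    conv_rhs => rw [← closed_image _ hu S hS]
    rw [Finset.prod_image (fun a _ b _ h => hu.mul_right_injective h)]
    refine Finset.prod_congr rfl fun t _ => ?_
    rw [mul_comm, pow_val_mul_nat hα]
    simp [pow_right_comm]
  have hl : G ∈ Polynomial.lifts (algebraMap K E) := by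
    rw [Polynomial.lifts_iff_coeff_lifts]
    intro i
    have h := congrArg (fun P => P.coeff i) hfix
    simp only [coeff_map] at h
    exact fixed_mem_range _ h
  exact (Polynomial.mem_lifts G).1 hl

lemma gen_spec {K E : Type} [Field K] [Field E] [Algebra K E] {n : ℕ} [NeZero n]
    {α : E} (hα : IsPrimitiveRoot α n) (S : Finset (ZMod n)) (g : K[X])
    (hg : g.map (algebraMap K E) = ∏ t ∈ S, (X - C (α ^ t.val))) (f : K[X]) :
    g ∣ f ↔ ∀ t ∈ S, aeval (α ^ t.val) f = 0 := by
  rw [← Polynomial.map_dvd_map' (algebraMap K E), hg]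
  constructor
  · intro h t ht
    have := (Finset.dvd_prod_of_mem (fun t : ZMod n => X - C (α ^ t.val)) ht).trans h
    rw [dvd_iff_isRoot, IsRoot, eval_map_algebraMap] at this
    exact this
  · intro h
    refine Finset.prod_dvd_of_coprime (fun a _ b _ hab => ?_) fun t ht => ?_
    · exact pairwise_coprime_X_sub_C (pow_val_inj hα) hab
    · rw [dvd_iff_isRoot, IsRoot, eval_map_algebraMap]
      exact h t ht

lemma gen_natDegree {K E : Type} [Field K] [Field E] [Algebra K E] {n : ℕ} [NeZero n]
    {α : E} (S : Finset (ZMod n)) (g : K[X])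
    (hg : g.map (algebraMap K E) = ∏ t ∈ S, (X - C (α ^ t.val))) :
    g.Monic ∧ g.natDegree = S.card := by
  constructor
  · rw [← monic_map_iff (f := algebraMap K E), hg]
    exact monic_prod_of_monic _ _ fun t _ => monic_X_sub_C _
  · rw [← natDegree_map (algebraMap K E), hg, natDegree_prod_of_monic _ _ fun t _ => monic_X_sub_C _]
    simp only [natDegree_X_sub_C, Finset.sum_const, smul_eq_mul, mul_one]

lemma exists_sep {K E : Type} [Field K] [Fintype K] [Field E] [Algebra K E] {n : ℕ} [NeZero n]
    {α : E} (hα : IsPrimitiveRoot α n) (S : Finset (ZMod n))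
    (hu : IsUnit (Fintype.card K : ZMod n))
    (hS : ∀ t ∈ S, (Fintype.card K : ZMod n) * t ∈ S) :
    ∃ y : Fin n → K, ∀ t, ft α y t = 0 ↔ t ∈ S := by
  by_cases hU : S = Finset.univ
  · exact ⟨0, fun t => by simp [ft, hU]⟩
  obtain ⟨g, hg⟩ := exists_gen hα S hu hS
  obtain ⟨hm, hd⟩ := gen_natDegree S g hg
  have hlt : S.card < n := by
    have := Finset.card_lt_card (Finset.ssubset_univ_iff.2 hU)
    rwa [Finset.card_univ, ZMod.card] at this
  refine ⟨fun i => g.coeff i, fun t => ?_⟩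
  rw [ft_eq hα, wpoly_of_coeff g (by rw [degree_eq_natDegree hm.ne_zero, hd]; exact_mod_cast hlt),
    ← eval_map_algebraMap, hg, eval_prod, Finset.prod_eq_zero_iff]
  constructor
  · rintro ⟨s, hs, h⟩
    rw [eval_sub, eval_X, eval_C, sub_eq_zero] at h
    exact pow_val_inj hα h ▸ hs
  · intro h
    exact ⟨t, h, by simp⟩

lemma code_finrank {K E : Type} [Field K] [Fintype K] [Field E] [Algebra K E] {n : ℕ} [NeZero n]
    {α : E} (hα : IsPrimitiveRoot α n) (S : Finset (ZMod n))
    (hu : IsUnit (Fintype.card K : ZMod n))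
    (hS : ∀ t ∈ S, (Fintype.card K : ZMod n) * t ∈ S) (W : Submodule K (Fin n → K))
    (hW : ∀ c, c ∈ W ↔ ∀ t ∈ S, ft α c t = 0) : Module.finrank K W = n - S.card := by
  obtain ⟨g, hg⟩ := exists_gen hα S hu hS
  obtain ⟨hm, hd⟩ := gen_natDegree S g hg
  have hle : S.card ≤ n := by
    have := Finset.card_le_univ S
    rwa [ZMod.card] at this
  have hdeg : ∀ f : K[X], f.degree < (n - S.card : ℕ) ↔ (g * f).degree < n := by
    intro f
    by_cases hf : f = 0
    · simp [hf]
    rw [degree_eq_natDegree hf, degree_eq_natDegree (mul_ne_zero hm.ne_zero hf),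
      natDegree_mul hm.ne_zero hf, hd, Nat.cast_lt, Nat.cast_lt]
    omega
  let L : degreeLT K (n - S.card) →ₗ[K] (Fin n → K) :=
    { toFun := fun f i => (g * (f : K[X])).coeff i
      map_add' := fun f h => by ext i; simp [mul_add]
      map_smul' := fun a f => by ext i; simp }
  have hLp : ∀ f, wpoly (L f) = g * (f : K[X]) := fun f =>
    wpoly_of_coeff _ ((hdeg _).1 (mem_degreeLT.1 f.2))
  have hinj : Function.Injective L := by
    intro f h hfh
    have := congrArg wpoly hfh
    rw [hLp, hLp] at this
    exact Subtype.ext (mul_left_cancel₀ hm.ne_zero this)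
  have hrange : LinearMap.range L = W := by
    ext c
    rw [hW]
    simp only [ft_eq hα]
    rw [← gen_spec hα S g hg]
    constructor
    · rintro ⟨f, rfl⟩
      rw [hLp]; exact dvd_mul_right _ _
    · rintro ⟨f, hf⟩
      refine ⟨⟨f, mem_degreeLT.2 ((hdeg f).2 (hf ▸ wpoly_degree c))⟩, ?_⟩
      ext i
      change (g * f).coeff i = c i
      rw [← hf, wpoly_coeff]
  rw [← hrange, LinearMap.finrank_range_of_inj hinj, (degreeLTEquiv K _).finrank_eq]
  simp

end fourier
section conv
open Polynomial

lemma ft_injective {K E : Type} [Field K] [Field E] [Algebra K E] {n : ℕ} [NeZero n] {α : E}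
    (hα : IsPrimitiveRoot α n) (c : Fin n → K) (h : ∀ t, ft α c t = 0) : c = 0 := by
  have h0 : (wpoly c).map (algebraMap K E) = 0 := by
    refine eq_zero_of_natDegree_lt_card_of_eval_eq_zero _ (pow_val_inj hα) (fun t => ?_) ?_
    · rw [eval_map_algebraMap, ← ft_eq hα, h]
    · rw [natDegree_map, ZMod.card]
      by_cases hc : wpoly c = 0
      · rw [hc, natDegree_zero]; exact Nat.pos_of_ne_zero (NeZero.ne n)
      · exact (natDegree_lt_iff_degree_lt hc).2 (wpoly_degree c)
  rw [Polynomial.map_eq_zero] at h0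
  ext i
  rw [← wpoly_coeff c i, h0]; simp

lemma fin_cast_add {n : ℕ} [NeZero n] (i j : Fin n) :
    (((i + j : Fin n) : ℕ) : ZMod n) = ((i : ℕ) : ZMod n) + ((j : ℕ) : ZMod n) := by
  rw [Fin.val_add, ZMod.natCast_mod, Nat.cast_add]

lemma pow_val_add {E : Type} [Field E] {n : ℕ} [NeZero n] {α : E} (hα : IsPrimitiveRoot α n)
    (a b : ZMod n) : α ^ (a + b).val = α ^ a.val * α ^ b.val := by
  have h := AddChar.map_add_eq_mul (AddChar.zmodChar n hα.pow_eq_one) a b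
  simpa only [AddChar.zmodChar_apply] using h

lemma ft_shift {K E : Type} [Field K] [Field E] [Algebra K E] {n : ℕ} [NeZero n] {α : E}
    (hα : IsPrimitiveRoot α n) (y : Fin n → K) (j : Fin n) (t : ZMod n) :
    α ^ (t * ((j : ℕ) : ZMod n)).val * ft α (fun i => y (i + j)) t = ft α y t := by
  unfold ft
  rw [Finset.mul_sum, ← Equiv.sum_comp (Equiv.addRight j)
    (fun i => algebraMap K E (y i) * α ^ (t * ((i : ℕ) : ZMod n)).val)]
  refine Finset.sum_congr rfl fun i _ => ?_
  simp only [Equiv.coe_addRight]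
  rw [fin_cast_add, mul_add, pow_val_add hα]
  ring

lemma ft_pow {K E : Type} [Field K] [Field E] [Algebra K E] (p m : ℕ) [Fact p.Prime] [CharP K p]
    {n : ℕ} [NeZero n] {α : E}
    (hα : IsPrimitiveRoot α n) (x : Fin n → K) (s : ZMod n) :
    ft α x s ^ p ^ m = ft α (fun i => x i ^ p ^ m) (((p ^ m : ℕ) : ZMod n) * s) := by
  have : CharP E p := charP_of_injective_algebraMap (algebraMap K E).injective p
  unfold ft
  rw [sum_pow_char_pow]
  refine Finset.sum_congr rfl fun i _ => ?_
  rw [mul_pow, map_pow, ← pow_val_mul_nat hα]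
  congr 3
  ring

lemma ft_conv {K E : Type} [Field K] [Field E] [Algebra K E] {n : ℕ} [NeZero n] {α : E}
    (hα : IsPrimitiveRoot α n) (x y : Fin n → K) (s : ZMod n) :
    ft α x (-s) * ft α y s = ft α (fun j => ∑ i, x i * y (i + j)) s := by
  have h1 : ∀ i : Fin n, α ^ (-s * ((i : ℕ) : ZMod n)).val * ft α y s
      = ft α (fun j => y (i + j)) s := by
    intro i
    rw [← ft_shift hα y i s, ← mul_assoc, ← pow_val_add hα, ← add_mul]
    simp [add_comm]
  conv_lhs => rw [ft, Finset.sum_mul]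
  simp only [mul_assoc, h1]
  simp only [ft, Finset.mul_sum, map_sum, map_mul, Finset.sum_mul]
  rw [Finset.sum_comm]
  simp only [mul_assoc]

lemma mem_hermDual_iff {K E : Type} [Field K] [Fintype K] [Field E] [Algebra K E] (p m : ℕ)
    [Fact p.Prime] [CharP K p] {n : ℕ} [NeZero n] {α : E}
    (hα : IsPrimitiveRoot α n) (S : Finset (ZMod n))
    (hu : IsUnit (Fintype.card K : ZMod n)) (hq : IsUnit ((p ^ m : ℕ) : ZMod n))
    (hS : ∀ t ∈ S, (Fintype.card K : ZMod n) * t ∈ S) (W : Submodule K (Fin n → K))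
    (hW : ∀ c, c ∈ W ↔ ∀ t ∈ S, ft α c t = 0) (x : Fin n → K) :
    x ∈ hermDual (p ^ m) (W : Set (Fin n → K)) ↔
      ∀ s, -((p ^ m : ℕ) : ZMod n) * s ∉ S → ft α x s = 0 := by
  have key : ∀ (y : Fin n → K) (s : ZMod n), ft α x s ^ p ^ m * ft α y (-((p ^ m : ℕ) : ZMod n) * s)
      = ft α (fun j => ∑ i, x i ^ p ^ m * y (i + j)) (-((p ^ m : ℕ) : ZMod n) * s) := by
    intro y s
    rw [ft_pow p m hα, ← ft_conv hα, neg_mul, neg_neg]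
  constructor
  · intro hx s hs
    obtain ⟨y, hy⟩ := exists_sep hα S hu hS
    have hyW : y ∈ W := (hW y).2 fun t ht => (hy t).2 ht
    have hsh : ∀ j, (fun i => y (i + j)) ∈ W := by
      intro j
      rw [hW]
      intro t ht
      have h := ft_shift hα y j t
      rw [(hy t).2 ht] at h
      exact (mul_eq_zero.1 h).resolve_left (pow_ne_zero _ (hα.ne_zero (NeZero.ne n)))
    have h0 : (fun j => ∑ i, x i ^ p ^ m * y (i + j)) = 0 := by
      ext j
      exact hx _ (hsh j)
    have h := key y s
    rw [h0] at h
    have hz : ft α (0 : Fin n → K) (-((p ^ m : ℕ) : ZMod n) * s) = 0 := by simp [ft]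
    rw [hz] at h
    rcases mul_eq_zero.1 h with h | h
    · exact pow_eq_zero_iff (pow_ne_zero _ (Fact.out : p.Prime).ne_zero) |>.1 h
    · exact absurd ((hy _).1 h) hs
  · intro hx y hy
    have h0 : (fun j => ∑ i, x i ^ p ^ m * y (i + j)) = 0 := by
      apply ft_injective hα
      intro t
      obtain ⟨u, hu⟩ := hq
      obtain ⟨s, rfl⟩ : ∃ s, t = -((p ^ m : ℕ) : ZMod n) * s :=
        ⟨-(↑u⁻¹ * t), by rw [← hu]; simp⟩
      rw [← key]
      by_cases hs : -((p ^ m : ℕ) : ZMod n) * s ∈ S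
      · rw [(hW y).1 hy _ hs, mul_zero]
      · rw [hx s hs, zero_pow (pow_ne_zero _ (Fact.out : p.Prime).ne_zero), zero_mul]
    have := congrFun h0 0
    simpa using this

end conv
section symp

lemma exists_embedding (p : ℕ) [Fact p.Prime] (F : Type) [Field F] [Fintype F] [CharP F p]
    (K : Type) [Field K] [Fintype K] [CharP K p]
    (hK : Fintype.card K = Fintype.card F ^ 2) : Nonempty (F →+* K) := by
  let := ZMod.algebra F p
  let := ZMod.algebra K p
  have h1 := FiniteField.pow_finrank_eq_card p F
  have h2 := FiniteField.pow_finrank_eq_card p K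
  have h3 : Module.finrank (ZMod p) K = Module.finrank (ZMod p) F * 2 := by
    rw [hK, ← h1, ← pow_mul] at h2
    exact Nat.pow_right_injective (Fact.out : p.Prime).two_le h2
  obtain ⟨f⟩ := FiniteField.nonempty_algHom_of_finrank_dvd (F := ZMod p) (K := F) (L := K)
    (h3 ▸ dvd_mul_right _ _)
  exact ⟨f.toRingHom⟩

lemma symp_equiv (p m : ℕ) [Fact p.Prime] (F : Type) [Field F] [Fintype F] [CharP F p]
    (K : Type) [Field K] [Fintype K] [CharP K p] (hm : Fintype.card F = p ^ m)
    (hK : Fintype.card K = Fintype.card F ^ 2) (n : ℕ) :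
    ∃ e : ((Fin n → F) × (Fin n → F)) ≃+ (Fin n → K),
      (∀ v, swt v = hwt (e v)) ∧
      ∀ (W : Submodule K (Fin n → K)) (v : (Fin n → F) × (Fin n → F)),
        v ∈ sympDual p (e ⁻¹' (W : Set (Fin n → K))) ↔
          e v ∈ hermDual (Fintype.card F) (W : Set (Fin n → K)) := by
  classical
  obtain ⟨σ⟩ := exists_embedding p F K hK
  have h1F : 1 < Fintype.card F := Fintype.one_lt_card
  have hσq : ∀ a, σ a ^ p ^ m = σ a := by
    intro a
    rw [← hm, ← map_pow, FiniteField.pow_card]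
  obtain ⟨β, hβ⟩ : ∃ β : K, ∀ a, σ a ≠ β := by
    by_contra! h
    have := Fintype.card_le_of_surjective σ h
    rw [hK] at this
    nlinarith
  have hβq : β - β ^ p ^ m ≠ 0 := by
    intro h
    let := σ.toAlgebra
    obtain ⟨a, ha⟩ := fixed_mem_range (K := F) β (by rw [hm]; exact (sub_eq_zero.1 h).symm)
    exact hβ a ha
  have hzero : ∀ a b : F, σ a + β * σ b = 0 → a = 0 ∧ b = 0 := by
    intro a b h
    have hb : b = 0 := by
      by_contra hb
      apply hβ (-a / b)
      have : σ b ≠ 0 := (map_ne_zero σ).2 hb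
      rw [map_div₀, map_neg, div_eq_iff this]
      linear_combination -h
    subst hb
    simpa using h
  let φ : ((Fin n → F) × (Fin n → F)) →+ (Fin n → K) :=
    { toFun := fun v i => σ (v.1 i) + β * σ (v.2 i)
      map_zero' := by ext i; simp
      map_add' := fun u v => by ext i; simp; ring }
  have hφ : ∀ v i, φ v i = σ (v.1 i) + β * σ (v.2 i) := fun v i => rfl
  have hinj : Function.Injective φ := by
    rw [injective_iff_map_eq_zero]
    intro v hv
    have := fun i => hzero (v.1 i) (v.2 i) (congrFun hv i)
    ext i
    · exact (this i).1
    · exact (this i).2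
  have hbij : Function.Bijective φ := by
    rw [Fintype.bijective_iff_injective_and_card]
    refine ⟨hinj, ?_⟩
    simp [hK]
    ring
  have hKp : ∀ x : K, (x ^ p ^ m) ^ p ^ m = x := by
    intro x
    rw [← hm, ← pow_mul, ← sq, ← hK, FiniteField.pow_card]
  have hform : ∀ u v : (Fin n → F) × (Fin n → F),
      σ (∑ i, (v.1 i * u.2 i - u.1 i * v.2 i)) * (β - β ^ p ^ m) =
        (∑ i, φ u i ^ p ^ m * φ v i) ^ p ^ m - ∑ i, φ u i ^ p ^ m * φ v i := by
    intro u v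
    rw [sum_pow_char_pow, ← Finset.sum_sub_distrib, map_sum, Finset.sum_mul]
    refine Finset.sum_congr rfl fun i _ => ?_
    rw [mul_pow, hKp, hφ, hφ, add_pow_char_pow, add_pow_char_pow, mul_pow, mul_pow]
    simp only [hσq, map_sub, map_mul]
    ring
  refine ⟨AddEquiv.ofBijective φ hbij, fun v => ?_, fun W v => ?_⟩
  · unfold swt hwt
    congr 1
    ext i
    simp only [Set.mem_ofPred_eq, AddEquiv.ofBijective_apply, ne_eq, not_iff_not]
    constructor
    · rintro ⟨h1, h2⟩
      simp [hφ, h1, h2]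
    · exact hzero _ _
  · have hpm : p ^ m ≠ 0 := pow_ne_zero _ (Fact.out : p.Prime).ne_zero
    constructor
    · intro hv y hy
      rw [hm]
      change ∑ i, φ v i ^ p ^ m * y i = 0
      by_contra hH
      set H := ∑ i, φ v i ^ p ^ m * y i with hHdef
      let := ZMod.algebra F p
      obtain ⟨c, hc⟩ := Algebra.trace_surjective (ZMod p) F 1
      obtain ⟨w, hw⟩ := hbij.2 ((-(β * σ c) / H) • y)
      have hmem : w ∈ (AddEquiv.ofBijective φ hbij) ⁻¹' (W : Set (Fin n → K)) := by
        change φ w ∈ W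
        rw [hw]
        exact W.smul_mem _ hy
      have h1 := hv w hmem
      have h2 := hform v w
      have h3 : ∑ i, φ v i ^ p ^ m * φ w i = -(β * σ c) := by
        rw [hw]
        simp only [Pi.smul_apply, smul_eq_mul]
        calc _ = (-(β * σ c) / H) * H := by
              rw [hHdef, Finset.mul_sum]
              exact Finset.sum_congr rfl fun i _ => by ring
          _ = _ := div_mul_cancel₀ _ hH
      have hneg : (-(β * σ c)) ^ p ^ m = -(β ^ p ^ m * σ c) := by
        have := sub_pow_char_pow (n := m) (p := p) (0 : K) (β * σ c)
        rw [zero_sub, zero_pow hpm, zero_sub, mul_pow, hσq] at this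
        exact this
      rw [h3, hneg] at h2
      have h4 : σ (∑ i, (w.1 i * v.2 i - v.1 i * w.2 i)) = σ c := by
        apply mul_right_cancel₀ hβq
        rw [h2]; ring
      have h5 := σ.injective h4
      unfold trSympForm at h1
      rw [h5] at h1
      have h6 : (1 : ZMod p) = 0 := hc.symm.trans h1
      exact one_ne_zero h6
    · intro hv w hw
      have h1 := hv _ hw
      rw [hm] at h1
      have h2 := hform v w
      change ∑ i, φ v i ^ p ^ m * φ w i = 0 at h1
      rw [h1, zero_pow hpm, sub_zero] at h2
      have h3 := (map_eq_zero σ).1 ((mul_eq_zero.1 h2).resolve_right hβq)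
      unfold trSympForm
      rw [h3, map_zero]

end symp
/-- Cyclic subsystem codes, Hermitian case.
Let `D` be a `k`-dimensional cyclic code of length `n` over `F_{q^2}` with
`gcd(n,q) = 1` and `D ⊆ D^⊥h`, with defining sets `T_D` and `T_{D^⊥h}`.
If `T ⊆ T_D \ T_{D^⊥h}` is a union of cyclotomic cosets and `C` is the cyclic
code with defining set `T_C = T_D \ (T ∪ T^{−q})`, `n − k = |T_D|`, and
`r = |T ∪ T^{−q}|` satisfies `0 ≤ r < n − 2k`, then `C ∩ C^⊥h = D`,
`dim C = k + r`, and there exists an `[[n, n−2k−r, r, wt(D^⊥h \ C)]]_q`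
Clifford subsystem code. -/
theorem cyclic_subsystem_codes_hermitian
    (p : ℕ) (hp : p.Prime) (F : Type) [Field F] [Fintype F] [CharP F p]
    (K : Type) [Field K] [Fintype K] [CharP K p]
    (hK : Fintype.card K = Fintype.card F ^ 2)
    (n k r : ℕ) (hn : 0 < n) (hgcd : Nat.gcd n (Fintype.card F) = 1)
    (E : Type) [Field E] [Algebra K E] (α : E) (hα : IsPrimitiveRoot α n)
    (D C : Submodule K (Fin n → K)) (TD TDperp T : Finset (ZMod n))
    -- `T_D` and `T` are unions of cyclotomic cosets (multiplier `q^2`)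
    (hTDcl : ∀ t ∈ TD, (Fintype.card F : ZMod n) ^ 2 * t ∈ TD)
    (hTcl : ∀ t ∈ T, (Fintype.card F : ZMod n) ^ 2 * t ∈ T)
    -- `T_D` is the defining set of `D`
    (hDdef : ∀ c : Fin n → K, c ∈ D ↔
      ∀ t ∈ TD, ∑ i : Fin n, algebraMap K E (c i) * α ^ (t * ((i : ℕ) : ZMod n)).val = 0)
    -- `T_{D^⊥h}` is the defining set of `D^⊥h`
    (hDperpdef : ∀ c : Fin n → K, c ∈ hermDual (Fintype.card F) (↑D : Set (Fin n → K)) ↔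
      ∀ t ∈ TDperp, ∑ i : Fin n, algebraMap K E (c i) * α ^ (t * ((i : ℕ) : ZMod n)).val = 0)
    -- `D` is Hermitian self-orthogonal and `k`-dimensional
    (hso : (↑D : Set (Fin n → K)) ⊆ hermDual (Fintype.card F) ↑D)
    (hk : Module.finrank K D = k) (hTD : n - k = TD.card)
    (hT : T ⊆ TD \ TDperp)
    -- `C` is the cyclic code with defining set `T_C = T_D \ (T ∪ T^{−q})`
    (hCdef : ∀ c : Fin n → K, c ∈ C ↔
      ∀ t ∈ TD \ (T ∪ T.image (fun s => -(Fintype.card F : ZMod n) * s)),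
        ∑ i : Fin n, algebraMap K E (c i) * α ^ (t * ((i : ℕ) : ZMod n)).val = 0)
    (hr : r = (T ∪ T.image (fun s => -(Fintype.card F : ZMod n) * s)).card)
    (hrlt : r < n - 2 * k) :
    (↑C ∩ hermDual (Fintype.card F) ↑C : Set (Fin n → K)) = ↑D ∧
    Module.finrank K C = k + r ∧
    ∃ Q : AddSubgroup ((Fin n → F) × (Fin n → F)),
      IsSubsysCode p Q (Fintype.card F ^ (n - 2 * k - r)) (Fintype.card F ^ r)
        (minHwt (hermDual (Fintype.card F) (↑D : Set (Fin n → K)) \ ↑C)) := by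
  classical
  have : NeZero n := ⟨hn.ne'⟩
  have : Fact p.Prime := ⟨hp⟩
  obtain ⟨m, -, hm⟩ := FiniteField.card F p
  set q := Fintype.card F with hqdef
  have hqu : IsUnit (q : ZMod n) := (ZMod.isUnit_iff_coprime q n).2 (Nat.coprime_comm.1 hgcd)
  have hqu' : IsUnit (-(q : ZMod n)) := hqu.neg
  have hKc : (Fintype.card K : ZMod n) = (q : ZMod n) ^ 2 := by rw [hK]; push_cast; rfl
  have hKu : IsUnit (Fintype.card K : ZMod n) := hKc ▸ hqu.pow 2
  have hTDcl' : ∀ t ∈ TD, (Fintype.card K : ZMod n) * t ∈ TD := by rw [hKc]; exact hTDcl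
  have hTcl' : ∀ t ∈ T, (Fintype.card K : ZMod n) * t ∈ T := by rw [hKc]; exact hTcl
  have hDdef' : ∀ c, c ∈ D ↔ ∀ t ∈ TD, ft α c t = 0 := hDdef
  have hDperp' : ∀ c, c ∈ hermDual q (D : Set (Fin n → K)) ↔ ∀ t ∈ TDperp, ft α c t = 0 := hDperpdef
  set U := T ∪ T.image (fun s => -(q : ZMod n) * s) with hU
  have hCdef' : ∀ c, c ∈ C ↔ ∀ t ∈ TD \ U, ft α c t = 0 := hCdef
  have hherm : ∀ (S : Finset (ZMod n)), (∀ t ∈ S, (Fintype.card K : ZMod n) * t ∈ S) →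
      ∀ W : Submodule K (Fin n → K), (∀ c, c ∈ W ↔ ∀ t ∈ S, ft α c t = 0) → ∀ x,
      (x ∈ hermDual q (W : Set (Fin n → K)) ↔ ∀ s, -(q : ZMod n) * s ∉ S → ft α x s = 0) := by
    intro S hS W hW x
    rw [hm]
    exact mem_hermDual_iff p m hα S hKu (hm ▸ hqu) hS W hW x
  -- the full defining set of the Hermitian dual
  set Tp : Finset (ZMod n) := Finset.univ.filter (fun s => -(q : ZMod n) * s ∉ TD) with hTp
  have hTpm : ∀ s, s ∈ Tp ↔ -(q : ZMod n) * s ∉ TD := by intro s; simp [hTp]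
  have hDp : ∀ x, x ∈ hermDual q (D : Set (Fin n → K)) ↔ ∀ s ∈ Tp, ft α x s = 0 := by
    intro x
    rw [hherm TD hTDcl' D hDdef' x]
    simp only [hTpm]
  have hTpcl : ∀ t ∈ Tp, (Fintype.card K : ZMod n) * t ∈ Tp := by
    intro t ht
    rw [hTpm] at ht ⊢
    rwa [mul_left_comm, closed_mem_iff _ hKu TD hTDcl']
  have hsub1 : TDperp ⊆ Tp := by
    obtain ⟨y, hy⟩ := exists_sep hα Tp hKu hTpcl
    have hy2 := (hDp y).2 fun t ht => (hy t).2 ht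
    intro t ht
    exact (hy t).1 ((hDperp' y).1 hy2 t ht)
  have hdisj : ∀ t ∈ T, t ∉ Tp := by
    have hcl : ∀ t ∈ Tp \ T, (Fintype.card K : ZMod n) * t ∈ Tp \ T := by
      intro t ht
      rw [Finset.mem_sdiff] at ht ⊢
      rw [closed_mem_iff _ hKu T hTcl']
      exact ⟨hTpcl t ht.1, ht.2⟩
    obtain ⟨y, hy⟩ := exists_sep hα (Tp \ T) hKu hcl
    have hy2 : y ∈ hermDual q (D : Set (Fin n → K)) := by
      rw [hDperp']
      intro t ht
      rw [hy, Finset.mem_sdiff]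
      exact ⟨hsub1 ht, fun h => (Finset.mem_sdiff.1 (hT h)).2 ht⟩
    intro t ht htp
    exact (Finset.mem_sdiff.1 ((hy t).1 ((hDp y).1 hy2 t htp))).2 ht
  have hTpTD : Tp ⊆ TD := by
    obtain ⟨y, hy⟩ := exists_sep hα TD hKu hTDcl'
    have hy2 := hso ((hDdef' y).2 fun t ht => (hy t).2 ht)
    intro t ht
    exact (hy t).1 ((hDp y).1 hy2 t ht)
  have hUTD : U ⊆ TD := by
    intro t ht
    rcases Finset.mem_union.1 ht with h | h
    · exact (Finset.mem_sdiff.1 (hT h)).1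
    · obtain ⟨s, hs, rfl⟩ := Finset.mem_image.1 h
      have := hdisj s hs
      rw [hTpm, not_not] at this
      exact this
  have hUcl : ∀ t ∈ U, -(q : ZMod n) * t ∈ U := by
    intro t ht
    rcases Finset.mem_union.1 ht with h | h
    · exact Finset.mem_union_right _ (Finset.mem_image_of_mem _ h)
    · obtain ⟨s, hs, rfl⟩ := Finset.mem_image.1 h
      refine Finset.mem_union_left _ ?_
      have := hTcl s hs
      convert this using 1
      ring
  have hUcl2 : ∀ t ∈ U, (Fintype.card K : ZMod n) * t ∈ U := by
    intro t ht
    have := hUcl _ (hUcl t ht)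
    rw [hKc]
    convert this using 1
    ring
  have hTCcl : ∀ t ∈ TD \ U, (Fintype.card K : ZMod n) * t ∈ TD \ U := by
    intro t ht
    rw [Finset.mem_sdiff] at ht ⊢
    rw [closed_mem_iff _ hKu U hUcl2]
    exact ⟨hTDcl' t ht.1, ht.2⟩
  have hCD : (↑C ∩ hermDual q ↑C : Set (Fin n → K)) = ↑D := by
    ext x
    rw [Set.mem_inter_iff, hherm (TD \ U) hTCcl C hCdef' x, SetLike.mem_coe, SetLike.mem_coe,
      hCdef', hDdef']
    constructor
    · rintro ⟨h1, h2⟩ t ht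
      by_cases htU : t ∈ U
      · exact h2 t fun h => (Finset.mem_sdiff.1 h).2 (hUcl t htU)
      · exact h1 t (Finset.mem_sdiff.2 ⟨ht, htU⟩)
    · intro h
      refine ⟨fun t ht => h t (Finset.mem_sdiff.1 ht).1, fun s hs => h s ?_⟩
      by_cases hs1 : -(q : ZMod n) * s ∈ TD
      · have : -(q : ZMod n) * s ∈ U := by
          by_contra hc
          exact hs (Finset.mem_sdiff.2 ⟨hs1, hc⟩)
        exact hUTD ((closed_mem_iff _ hqu' U hUcl s).1 this)
      · exact hTpTD ((hTpm s).2 hs1)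
  have hkn : k ≤ n := by
    have := Submodule.finrank_le D
    rw [hk] at this
    simpa using this
  have hrTD : r ≤ TD.card := hr ▸ Finset.card_le_card hUTD
  have hCdim : Module.finrank K C = k + r := by
    rw [code_finrank hα (TD \ U) hKu hTCcl C hCdef', Finset.card_sdiff_of_subset hUTD, ← hr, ← hTD]
    omega
  refine ⟨hCD, hCdim, ?_⟩
  have hne : hermDual q (D : Set (Fin n → K)) ≠ C := by
    intro h
    have h1 := code_finrank hα Tp hKu hTpcl C (fun c => by rw [← hDp, h]; rfl)
    have h2 : Tp.card ≤ TDᶜ.card := by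
      refine Finset.card_le_card_of_injOn (fun s => -(q : ZMod n) * s) (fun s hs => ?_)
        (fun a _ b _ hab => hqu'.mul_right_injective hab)
      have := (hTpm s).1 hs
      simpa using this
    rw [Finset.card_compl, ZMod.card] at h2
    omega
  obtain ⟨e, hew, hed⟩ := symp_equiv p m F K hm hK n
  have hDs : ∀ W : Submodule K (Fin n → K), sympDual p (e ⁻¹' (W : Set (Fin n → K))) =
      e ⁻¹' (hermDual q (W : Set (Fin n → K))) := fun W => Set.ext fun v => hed W v
  have hcard : ∀ W : Submodule K (Fin n → K),
      Nat.card (e ⁻¹' (W : Set (Fin n → K))) = q ^ (2 * Module.finrank K W) := by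
    intro W
    have h1 : Nat.card (e ⁻¹' (W : Set (Fin n → K))) = Nat.card W :=
      Nat.card_congr (e.toEquiv.subtypeEquiv fun v => Iff.rfl)
    rw [h1, Module.natCard_eq_pow_finrank (K := K), Nat.card_eq_fintype_card, hK, pow_mul]
  have hmin : ∀ S : Set (Fin n → K), minSwt (e ⁻¹' S) = minHwt S := by
    intro S
    unfold minSwt minHwt
    congr 1
    ext d
    constructor
    · rintro ⟨v, ⟨hv, hv0⟩, rfl⟩
      exact ⟨e v, ⟨hv, fun h => hv0 ((map_eq_zero_iff e e.injective).1 h)⟩, (hew v).symm⟩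
    · rintro ⟨x, ⟨hx, hx0⟩, rfl⟩
      refine ⟨e.symm x, ⟨?_, fun h => hx0 ?_⟩, ?_⟩
      · simpa using hx
      · exact (map_eq_zero_iff e.symm e.symm.injective).1 h
      · rw [hew, e.apply_symm_apply]
  refine ⟨C.toAddSubgroup.comap (e : ((Fin n → F) × (Fin n → F)) →+ (Fin n → K)), ?_⟩
  have hQ : ((C.toAddSubgroup.comap (e : ((Fin n → F) × (Fin n → F)) →+ (Fin n → K)) : AddSubgroup ((Fin n → F) × (Fin n → F))) :
      Set ((Fin n → F) × (Fin n → F))) = e ⁻¹' (C : Set (Fin n → K)) := rfl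
  have hQc : Nat.card (C.toAddSubgroup.comap (e : ((Fin n → F) × (Fin n → F)) →+ (Fin n → K)))
      = q ^ (2 * (k + r)) := by rw [← hCdim]; exact hcard C
  have hDsQ : (e ⁻¹' (C : Set (Fin n → K)) ∩ sympDual p (e ⁻¹' (C : Set (Fin n → K))))
      = e ⁻¹' (D : Set (Fin n → K)) := by
    rw [hDs, ← Set.preimage_inter, hCD]
  unfold IsSubsysCode
  simp only [hQ, hDsQ, hQc]
  rw [hDs, hcard, hk, ← Set.preimage_sdiff, ← hqdef]
  refine ⟨?_, ?_, ?_, fun _ => (hmin _).symm⟩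
  · rw [← pow_add, ← pow_add]
    congr 1
    omega
  · rw [← pow_add, ← pow_add]
    congr 1
    omega
  · intro h
    exact absurd (e.surjective.preimage_injective h) hne
end

section
/- Subsystem codes from primitive narrow-sense BCH codes (Euclidean): Let q be a prime power, m ≥ 2, n = q^m − 1, and let δ be an integer with 2 ≤ δ ≤ q^{⌈m/2⌉} − 1 − (q−2)·[m odd]. Set k = m⌈(δ−1)(1−1/q)⌉ and N = {0,...,n−1}. If T is a subset of N \ (∪_{a=1}^{δ−1}(C_a ∪ C_{−a})) that is a union of cyclotomic cosets and r = |T ∪ T^{−1}| satisfies 0 ≤ r < n − 2k, then there exists an [[q^m − 1, q^m − 1 − 2m⌈(δ−1)(1−1/q)⌉ − r, r, d]]_q Clifford subsystem code with d ≥ δ. -/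
open Finset

section BCHAlgebra

open Polynomial

theorem bch_mem_range_of_pow {F E : Type*} [Field F] [Fintype F] [Field E] [Algebra F E] (x : E)
    (hx : x ^ Fintype.card F = x) : x ∈ Set.range (algebraMap F E) := by
  classical
  have hq := Fintype.one_lt_card (α := F)
  have h1 : (X ^ Fintype.card F - X : F[X]) = ∏ a : F, (X - C a) := by
    have hr := FiniteField.roots_X_pow_card_sub_X F
    have hdg : (X ^ Fintype.card F - X : F[X]).natDegree = Fintype.card F :=
      FiniteField.X_pow_card_sub_X_natDegree_eq F hq
    have hm : (X ^ Fintype.card F - X : F[X]).Monic := by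
      apply monic_X_pow_sub
      rw [degree_X]
      exact_mod_cast hq
    have := prod_multiset_X_sub_C_of_monic_of_roots_card_eq hm (by rw [hr, hdg]; rfl)
    rw [hr] at this
    exact this.symm
  have h2 := congrArg (fun P : F[X] => aeval x P) h1
  simp only [map_sub, map_pow, aeval_X, map_prod, aeval_C, hx, sub_self] at h2
  obtain ⟨a, -, ha⟩ := Finset.prod_eq_zero_iff.mp h2.symm
  exact ⟨a, (sub_eq_zero.mp ha).symm⟩

variable {F E : Type} [Field F] [Fintype F] [Field E] [Algebra F E] {n : ℕ} [NeZero n]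

/-- Cyclic code whose spectrum is supported in `S`. -/
def bchCode (F : Type) {E : Type} [Field F] [Field E] [Algebra F E] {n : ℕ}
    (ψ : AddChar (ZMod n) E) (S : Finset (ZMod n)) : Submodule F (Fin n → F) where
  carrier := {c | ∀ s, s ∉ S → ∑ i : Fin n, algebraMap F E (c i) * ψ (s * ((i : ℕ) : ZMod n)) = 0}
  add_mem' := by
    intro a b ha hb s hs
    simp only [Pi.add_apply, map_add, add_mul, Finset.sum_add_distrib, ha s hs, hb s hs, add_zero]
  zero_mem' := by intro s _; simp
  smul_mem' := by
    intro a c hc s hs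
    simp only [Pi.smul_apply, smul_eq_mul, map_mul, mul_assoc, ← Finset.mul_sum, hc s hs, mul_zero]

theorem bch_char_mul (ψ : AddChar (ZMod n) E) (s : ZMod n) (i : ℕ) :
    ψ (s * (i : ZMod n)) = ψ s ^ i := by
  rw [mul_comm, ← nsmul_eq_mul, AddChar.map_nsmul_eq_pow]

theorem bch_gen (ψ : AddChar (ZMod n) E) (S : Finset (ZMod n))
    (hq : IsUnit (Fintype.card F : ZMod n))
    (hS : ∀ s, (Fintype.card F : ZMod n) * s ∈ S ↔ s ∈ S) :
    ∃ g : F[X], g.Monic ∧ g.map (algebraMap F E) = ∏ s ∈ Sᶜ, (X - C (ψ s)) := by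
  classical
  have hmon : (∏ s ∈ Sᶜ, (X - C (ψ s))).Monic := monic_prod_of_monic _ _ fun s _ => monic_X_sub_C _
  have hl : (∏ s ∈ Sᶜ, (X - C (ψ s))) ∈ lifts (algebraMap F E) := by
    rw [lifts_iff_coeff_lifts]
    intro j
    apply bch_mem_range_of_pow
    have hfr : (∏ s ∈ Sᶜ, (X - C (ψ s))).map
        (FiniteField.frobeniusAlgHom F E : E →+* E) = ∏ s ∈ Sᶜ, (X - C (ψ s)) := by
      rw [Polynomial.map_prod]
      refine Finset.prod_equiv (hq.unit.mulLeft) ?_ ?_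
      · intro s
        simp [hS]
      · intro s _
        simp [mul_comm _ s, bch_char_mul]
    conv_rhs => rw [← hfr]
    rw [coeff_map]
    simp
  obtain ⟨g, h1, -, h3⟩ := lifts_and_degree_eq_and_monic hl hmon
  exact ⟨g, h3, h1⟩

theorem bch_finrank (ψ : AddChar (ZMod n) E) (hψ : Function.Injective ψ) (S : Finset (ZMod n))
    (hq : IsUnit (Fintype.card F : ZMod n))
    (hS : ∀ s, (Fintype.card F : ZMod n) * s ∈ S ↔ s ∈ S) :
    Module.finrank F (bchCode F ψ S) = S.card := by
  classical
  obtain ⟨g, hg, hgm⟩ := bch_gen (F := F) ψ S hq hS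
  have hdeg : g.natDegree + S.card = n := by
    have : g.natDegree = (∏ s ∈ Sᶜ, (X - C (ψ s))).natDegree := by
      rw [← hgm, natDegree_map]
    rw [this, natDegree_prod_of_monic _ _ fun s _ => monic_X_sub_C _]
    simp only [natDegree_X_sub_C, Finset.sum_const, smul_eq_mul, mul_one]
    rw [Finset.card_compl, ZMod.card]
    have := Finset.card_le_univ S
    rw [ZMod.card] at this
    omega
  have hmem : ∀ f ∈ degreeLT F S.card, f * g ∈ degreeLT F n := by
    intro f hf
    by_cases h0 : f = 0
    · subst h0; simp
    rw [mem_degreeLT] at hf ⊢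
    rw [degree_mul, degree_eq_natDegree h0, degree_eq_natDegree hg.ne_zero] at *
    norm_cast at *
    omega
  let L : degreeLT F S.card →ₗ[F] (Fin n → F) :=
    { toFun := fun f i => ((f : F[X]) * g).coeff i
      map_add' := by intro a b; ext i; simp [add_mul]
      map_smul' := by intro a b; ext i; simp }
  have hev : ∀ P ∈ degreeLT F n, ∀ s, ∑ i : Fin n, algebraMap F E (P.coeff i) * ψ (s * ((i : ℕ) : ZMod n))
      = aeval (ψ s) P := by
    intro P hP s
    rw [mem_degreeLT] at hP
    simp only [bch_char_mul]
    by_cases h0 : P = 0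
    · simp [h0]
    rw [aeval_eq_sum_range' ((natDegree_lt_iff_degree_lt h0).2 hP), Finset.sum_range]
    simp [Algebra.smul_def]
  have hroot : ∀ P : F[X], (∀ s, s ∉ S → aeval (ψ s) P = 0) ↔ g ∣ P := by
    intro P
    constructor
    · intro h
      have : g.map (algebraMap F E) ∣ P.map (algebraMap F E) := by
        rw [hgm]
        apply Finset.prod_dvd_of_coprime
        · intro a _ b _ hab
          exact pairwise_coprime_X_sub_C hψ hab
        · intro s hs
          rw [dvd_iff_isRoot, IsRoot, eval_map_algebraMap]
          exact h s (by simpa using hs)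
      exact (map_dvd_map' _).1 this
    · rintro ⟨f, rfl⟩ s hs
      have : aeval (ψ s) g = 0 := by
        rw [← eval_map_algebraMap, hgm, eval_prod]
        exact Finset.prod_eq_zero (i := s) (by simpa using hs) (by simp)
      simp [this]
  have hinj : Function.Injective L := by
    rw [injective_iff_map_eq_zero]
    intro f hf
    have : (f : F[X]) * g = 0 := by
      ext i
      by_cases hi : i < n
      · exact congrFun hf ⟨i, hi⟩
      · rw [coeff_zero]
        apply coeff_eq_zero_of_degree_lt
        refine lt_of_lt_of_le (mem_degreeLT.1 (hmem f f.2)) ?_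
        exact_mod_cast not_lt.1 hi
    rcases mul_eq_zero.1 this with h | h
    · exact Subtype.ext h
    · exact absurd h hg.ne_zero
  have hrange : LinearMap.range L = bchCode F ψ S := by
    ext c
    constructor
    · rintro ⟨f, rfl⟩ s hs
      change ∑ i : Fin n, algebraMap F E (((f : F[X]) * g).coeff i) * ψ (s * ((i : ℕ) : ZMod n)) = 0
      rw [hev _ (hmem f f.2)]
      exact (hroot _).2 (Dvd.intro_left _ rfl) s hs
    · intro hc
      obtain ⟨P, rfl⟩ := (degreeLTEquiv F n).surjective c
      have hd : g ∣ (P : F[X]) := by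
        rw [← hroot]
        intro s hs
        rw [← hev _ P.2]
        exact hc s hs
      obtain ⟨f, hf⟩ := hd
      have hfd : f ∈ degreeLT F S.card := by
        by_cases h0 : f = 0
        · subst h0; simp
        have := mem_degreeLT.1 P.2
        rw [hf, degree_mul, degree_eq_natDegree h0, degree_eq_natDegree hg.ne_zero] at this
        rw [mem_degreeLT, degree_eq_natDegree h0]
        norm_cast at *
        omega
      refine ⟨⟨f, hfd⟩, ?_⟩
      ext i
      change (f * g).coeff i = (P : F[X]).coeff i
      rw [hf, mul_comm]
  rw [← hrange, LinearMap.finrank_range_of_inj hinj, (degreeLTEquiv F S.card).finrank_eq]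
  simp

theorem bch_ortho (ψ : AddChar (ZMod n) E) (hψ : ψ.IsPrimitive) (hn : (n : E) ≠ 0)
    (S U : Finset (ZMod n)) (h : ∀ s ∈ S, -s ∉ U)
    (x y : Fin n → F) (hx : x ∈ bchCode F ψ S) (hy : y ∈ bchCode F ψ U) :
    x ⬝ᵥ y = 0 := by
  classical
  have key : (n : E) * algebraMap F E (x ⬝ᵥ y) = 0 := by
    calc (n : E) * algebraMap F E (x ⬝ᵥ y)
        = ∑ i : Fin n, ∑ j : Fin n, algebraMap F E (x i) * algebraMap F E (y j) *
            ∑ s : ZMod n, ψ (s * (((i : ℕ) : ZMod n) - ((j : ℕ) : ZMod n))) := by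
          have : ∀ i j : Fin n, (((i : ℕ) : ZMod n) - ((j : ℕ) : ZMod n) = 0) ↔ i = j := by
            intro i j
            rw [sub_eq_zero, ZMod.natCast_eq_natCast_iff, Nat.ModEq, Nat.mod_eq_of_lt i.2,
              Nat.mod_eq_of_lt j.2, Fin.ext_iff]
          simp only [AddChar.sum_mulShift _ hψ, this, dotProduct, map_sum, Finset.mul_sum, map_mul,
            ZMod.card]
          simp [mul_comm]
      _ = ∑ s : ZMod n, (∑ i : Fin n, algebraMap F E (x i) * ψ (s * ((i : ℕ) : ZMod n))) *
            (∑ j : Fin n, algebraMap F E (y j) * ψ (-s * ((j : ℕ) : ZMod n))) := by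
          simp only [Finset.mul_sum, Finset.sum_mul]
          rw [Finset.sum_comm]
          conv_lhs => enter [2, j]; rw [Finset.sum_comm]
          rw [Finset.sum_comm]
          refine Finset.sum_congr rfl fun s _ => ?_
          refine Finset.sum_congr rfl fun j _ => ?_
          refine Finset.sum_congr rfl fun i _ => ?_
          rw [mul_sub, sub_eq_add_neg, AddChar.map_add_eq_mul, neg_mul]
          ring
      _ = 0 := by
          refine Finset.sum_eq_zero fun s _ => ?_
          by_cases hs : s ∈ S
          · rw [hy (-s) (h s hs), mul_zero]
          · rw [hx s hs, zero_mul]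
  rcases mul_eq_zero.1 key with h | h
  · exact absurd h hn
  · exact (map_eq_zero _).1 h

theorem bch_dual (ψ : AddChar (ZMod n) E) (hψ : ψ.IsPrimitive) (hinj : Function.Injective ψ)
    (hn : (n : E) ≠ 0) (S : Finset (ZMod n))
    (hq : IsUnit (Fintype.card F : ZMod n))
    (hS : ∀ s, (Fintype.card F : ZMod n) * s ∈ S ↔ s ∈ S) (x : Fin n → F) :
    (∀ y ∈ bchCode F ψ S, x ⬝ᵥ y = 0) ↔ x ∈ bchCode F ψ ((S.image (fun s => -s))ᶜ) := by
  classical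
  let B : LinearMap.BilinForm F (Fin n → F) := dotProductBilin F F
  have hsep : B.SeparatingLeft := fun v hv => dotProduct_eq_zero v hv
  have hrefl : B.IsRefl := fun v w h => by
    change w ⬝ᵥ v = 0
    rw [dotProduct_comm]; exact h
  have hnd : B.Nondegenerate := hrefl.nondegenerate_iff_separatingLeft.2 hsep
  have hle : bchCode F ψ ((S.image (fun s => -s))ᶜ) ≤ B.orthogonal (bchCode F ψ S) := by
    intro x hx y hy
    refine bch_ortho ψ hψ hn S _ ?_ y x hy hx
    intro s hs
    simp [hs]
  have heq : bchCode F ψ ((S.image (fun s => -s))ᶜ) = B.orthogonal (bchCode F ψ S) := by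
    apply Submodule.eq_of_le_of_finrank_eq hle
    rw [LinearMap.BilinForm.finrank_orthogonal hnd, bch_finrank ψ hinj S hq hS,
      bch_finrank ψ hinj _ hq, Finset.card_compl, Finset.card_image_of_injective _ neg_injective]
    · simp
    · intro s
      simp only [Finset.mem_compl, not_iff_not, Finset.mem_image]
      constructor
      · rintro ⟨a, ha, h⟩
        refine ⟨-s, ?_, by simp⟩
        rw [← hS, mul_neg, ← h, neg_neg]; exact ha
      · rintro ⟨a, ha, rfl⟩
        exact ⟨_, (hS a).2 ha, by ring⟩
  rw [heq, LinearMap.BilinForm.mem_orthogonal_iff]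
  refine forall₂_congr fun y _ => ?_
  change _ ↔ y ⬝ᵥ x = 0
  rw [dotProduct_comm]

/-- The BCH bound. -/
theorem bch_bound (ψ : AddChar (ZMod n) E) (hinj : Function.Injective ψ) (δ : ℕ) (hδ : 1 ≤ δ)
    (c : Fin n → F) (hc : c ≠ 0)
    (h : ∀ a : ℕ, 1 ≤ a → a ≤ δ - 1 →
      ∑ i : Fin n, algebraMap F E (c i) * ψ ((a : ZMod n) * ((i : ℕ) : ZMod n)) = 0) :
    δ ≤ {i | c i ≠ 0}.ncard := by
  classical
  by_contra hlt
  have hw : {i | c i ≠ 0}.ncard = (Finset.univ.filter fun i => c i ≠ 0).card := by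
    rw [← Set.ncard_coe_finset]; simp
  rw [hw] at hlt
  obtain ⟨j, hj⟩ := Function.ne_iff.1 hc
  have hj' : c j ≠ 0 := hj
  set W := Finset.univ.filter fun i => c i ≠ 0 with hW
  have hjW : j ∈ W := by simp [hW, hj']
  let P : E[X] := X * ∏ i ∈ W.erase j, (X - C (ψ ((i : ℕ) : ZMod n)))
  have hPd : P.natDegree ≤ δ - 1 := by
    have : P.natDegree ≤ 1 + (W.erase j).card := by
      refine natDegree_mul_le.trans ?_
      refine add_le_add natDegree_X_le ?_
      refine (natDegree_prod_le _ _).trans ?_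
      simp
    rw [Finset.card_erase_of_mem hjW] at this
    have := Finset.card_pos.2 ⟨j, hjW⟩
    omega
  have hzero : ∑ i : Fin n, algebraMap F E (c i) * P.eval (ψ ((i : ℕ) : ZMod n)) = 0 := by
    simp only [eval_eq_sum_range, Finset.mul_sum]
    rw [Finset.sum_comm]
    refine Finset.sum_eq_zero fun a ha => ?_
    rcases Nat.eq_zero_or_pos a with rfl | ha0
    · simp [P]
    · have := h a ha0 ((Nat.lt_succ_iff.1 (Finset.mem_range.1 ha)).trans hPd)
      calc _ = P.coeff a * ∑ i : Fin n, algebraMap F E (c i) * ψ ((a : ZMod n) * ((i : ℕ) : ZMod n)) := by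
            rw [Finset.mul_sum]
            refine Finset.sum_congr rfl fun i _ => ?_
            rw [mul_comm (a : ZMod n), bch_char_mul]
            ring
        _ = 0 := by rw [this, mul_zero]
  rw [Finset.sum_eq_single j] at hzero
  · rcases mul_eq_zero.1 hzero with h1 | h1
    · exact hj' ((map_eq_zero _).1 h1)
    · simp only [P, eval_mul, eval_X, eval_prod, eval_sub, eval_C] at h1
      rcases mul_eq_zero.1 h1 with h2 | h2
      · have hh := AddChar.map_add_eq_mul ψ ((j : ℕ) : ZMod n) (-((j : ℕ) : ZMod n))
        rw [h2, zero_mul, add_neg_cancel, AddChar.map_zero_eq_one] at hh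
        exact one_ne_zero hh
      · obtain ⟨i, hi, h3⟩ := Finset.prod_eq_zero_iff.1 h2
        have h4 := hinj (sub_eq_zero.1 h3)
        rw [ZMod.natCast_eq_natCast_iff, Nat.ModEq, Nat.mod_eq_of_lt i.2,
              Nat.mod_eq_of_lt j.2] at h4
        exact (Finset.ne_of_mem_erase hi) (Fin.ext h4.symm)
  · intro i _ hij
    by_cases hci : c i = 0
    · simp [hci]
    · have : P.eval (ψ ((i : ℕ) : ZMod n)) = 0 := by
        simp only [P, eval_mul, eval_X, eval_prod, eval_sub, eval_C]
        rw [Finset.prod_eq_zero (i := i) (by simp [hW, hij, hci]) (by simp), mul_zero]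
      rw [this, mul_zero]
  · simp

end BCHAlgebra

section BCHCombinatorics

theorem bch_h_facts {q m n : ℕ} (hq : 2 ≤ q) (hm : 2 ≤ m) (hn : n = q ^ m - 1) :
    q ^ ((m + 1) / 2) ≤ n ∧ n + 1 = q ^ m := by
  have h1 : q ^ ((m + 1) / 2) ≤ q ^ (m - 1) := Nat.pow_le_pow_right (by omega) (by omega)
  have h2 : q ^ m = q ^ (m - 1) * q := by
    rw [← pow_succ]; congr 1; omega
  have h3 : 1 ≤ q ^ (m - 1) := Nat.one_le_pow _ _ (by omega)
  have h4 : q ^ (m - 1) * 2 ≤ q ^ (m - 1) * q := Nat.mul_le_mul_left _ hq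
  constructor <;> omega

theorem bch_q_pow {q m n : ℕ} (hq : 2 ≤ q) (hm : 2 ≤ m) (hn : n = q ^ m - 1) :
    (q : ZMod n) ^ m = 1 := by
  have h := (bch_h_facts hq hm hn).2
  have := congrArg (Nat.cast : ℕ → ZMod n) h
  push_cast at this
  rw [← this]; simp

theorem bch_pow_mod {q m n : ℕ} (hq : 2 ≤ q) (hm : 2 ≤ m) (hn : n = q ^ m - 1) (i : ℕ) :
    (q : ZMod n) ^ i = (q : ZMod n) ^ (i % m) := by
  conv_lhs => rw [← Nat.div_add_mod i m, pow_add, pow_mul, bch_q_pow hq hm hn, one_pow, one_mul]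

theorem bch_coset_aux {q m n a b i : ℕ} (hq : 2 ≤ q) (hm : 2 ≤ m) (hn : n = q ^ m - 1)
    (ha : 1 ≤ a) (ha' : a < q ^ ((m + 1) / 2)) (hb : 1 ≤ b) (hb' : b < q ^ ((m + 1) / 2))
    (hqa : ¬ q ∣ a) (hi : i ≤ m - (m + 1) / 2)
    (h : (a : ZMod n) = (b : ZMod n) * (q : ZMod n) ^ i) : i = 0 ∧ a = b := by
  obtain ⟨h1, h2⟩ := bch_h_facts hq hm hn
  have h3 : b * q ^ i < q ^ m := by
    calc b * q ^ i < q ^ ((m + 1) / 2) * q ^ i :=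
          Nat.mul_lt_mul_of_pos_right hb' (pow_pos (by omega) _)
      _ ≤ q ^ ((m + 1) / 2) * q ^ (m - (m + 1) / 2) :=
          Nat.mul_le_mul_left _ (Nat.pow_le_pow_right (by omega) hi)
      _ = q ^ m := by rw [← pow_add]; congr 1; omega
  have h4 : 1 ≤ b * q ^ i := Nat.mul_pos hb (pow_pos (by omega) _)
  have h5 : a ≡ b * q ^ i [MOD n] := by
    rw [← ZMod.natCast_eq_natCast_iff]; push_cast; exact h
  rw [Nat.ModEq, Nat.mod_eq_of_lt (by omega)] at h5
  have h6 : b * q ^ i ≠ n := by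
    intro h6; rw [h6, Nat.mod_self] at h5; omega
  rw [Nat.mod_eq_of_lt (by omega)] at h5
  rcases Nat.eq_zero_or_pos i with rfl | hi0
  · simp at h5; exact ⟨rfl, h5⟩
  · exfalso; apply hqa; rw [h5]
    exact Dvd.dvd.mul_left (dvd_pow_self q (by omega)) b

theorem bch_coset_inj {q m n a b i : ℕ} (hq : 2 ≤ q) (hm : 2 ≤ m) (hn : n = q ^ m - 1)
    (ha : 1 ≤ a) (ha' : a < q ^ ((m + 1) / 2)) (hb : 1 ≤ b) (hb' : b < q ^ ((m + 1) / 2))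
    (hqa : ¬ q ∣ a) (hqb : ¬ q ∣ b) (hi : i < m)
    (h : (a : ZMod n) = (b : ZMod n) * (q : ZMod n) ^ i) : i = 0 ∧ a = b := by
  by_cases hi' : i ≤ m - (m + 1) / 2
  · exact bch_coset_aux hq hm hn ha ha' hb hb' hqa hi' h
  · have h' : (b : ZMod n) = (a : ZMod n) * (q : ZMod n) ^ (m - i) := by
      rw [h, mul_assoc, ← pow_add, show i + (m - i) = m by omega, bch_q_pow hq hm hn, mul_one]
    have := bch_coset_aux hq hm hn hb hb' ha ha' hqb (by omega) h'
    omega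

/-- The union of the cosets of `1, ..., e`. -/
def bchZ (q m n e : ℕ) : Finset (ZMod n) :=
  (Finset.Icc 1 e ×ˢ Finset.range m).image fun x => (x.1 : ZMod n) * (q : ZMod n) ^ x.2

theorem bch_mem_Z {q m n e : ℕ} (hq : 2 ≤ q) (hm : 2 ≤ m) (hn : n = q ^ m - 1) (z : ZMod n) :
    z ∈ bchZ q m n e ↔ ∃ a : ℕ, 1 ≤ a ∧ a ≤ e ∧ z ∈ cycCoset q n (a : ZMod n) := by
  simp only [bchZ, Finset.mem_image, Finset.mem_product, Finset.mem_Icc, Finset.mem_range,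
    Prod.exists, cycCoset, Set.mem_setOf_eq]
  constructor
  · rintro ⟨a, i, ⟨⟨h1, h2⟩, h3⟩, rfl⟩
    exact ⟨a, h1, h2, i, rfl⟩
  · rintro ⟨a, h1, h2, i, rfl⟩
    exact ⟨a, i % m, ⟨⟨h1, h2⟩, Nat.mod_lt _ (by omega)⟩, by rw [← bch_pow_mod hq hm hn]⟩

theorem bch_closed {q m n : ℕ} (hq : 2 ≤ q) (hm : 2 ≤ m) (hn : n = q ^ m - 1)
    (S : Finset (ZMod n)) (hS : ∀ s ∈ S, (q : ZMod n) * s ∈ S) (s : ZMod n) :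
    (q : ZMod n) * s ∈ S ↔ s ∈ S := by
  refine ⟨fun h => ?_, hS s⟩
  have : ∀ (i : ℕ) (t : ZMod n), t ∈ S → (q : ZMod n) ^ i * t ∈ S := by
    intro i
    induction i with
    | zero => intro t ht; simpa using ht
    | succ i ih =>
      intro t ht
      rw [pow_succ, mul_assoc]
      exact ih _ (hS t ht)
  have h2 := this (m - 1) _ h
  rwa [← mul_assoc, ← pow_succ, show m - 1 + 1 = m by omega, bch_q_pow hq hm hn, one_mul] at h2

theorem bch_Z_closed {q m n e : ℕ} (hq : 2 ≤ q) (hm : 2 ≤ m) (hn : n = q ^ m - 1) (s : ZMod n)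
    (hs : s ∈ bchZ q m n e) : (q : ZMod n) * s ∈ bchZ q m n e := by
  rw [bch_mem_Z hq hm hn] at *
  obtain ⟨a, h1, h2, i, rfl⟩ := hs
  exact ⟨a, h1, h2, i + 1, by ring⟩

theorem bch_Z_card {q m n e : ℕ} (hq : 2 ≤ q) (hm : 2 ≤ m) (hn : n = q ^ m - 1)
    (he : e < q ^ ((m + 1) / 2)) :
    (bchZ q m n e).card = m * (e - e / q) := by
  have h1 : bchZ q m n e = (((Finset.Icc 1 e).filter fun a => ¬ q ∣ a) ×ˢ Finset.range m).image
      fun x => (x.1 : ZMod n) * (q : ZMod n) ^ x.2 := by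
    ext z
    constructor
    · intro hz
      rw [bch_mem_Z hq hm hn] at hz
      obtain ⟨a, ha1, ha2, i, rfl⟩ := hz
      obtain ⟨v, b, hb, hab⟩ := Nat.exists_eq_pow_mul_and_not_dvd (n := a) (by omega) q (by omega)
      have hb0 : 1 ≤ b := by
        rcases Nat.eq_zero_or_pos b with rfl | h
        · simp at hb
        · exact h
      have hba : b ≤ a := by
        rw [hab]; exact Nat.le_mul_of_pos_left _ (pow_pos (by omega) _)
      simp only [Finset.mem_image, Finset.mem_product, Finset.mem_filter, Finset.mem_Icc,
        Finset.mem_range, Prod.exists]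
      refine ⟨b, (v + i) % m, ⟨⟨⟨hb0, by omega⟩, hb⟩, Nat.mod_lt _ (by omega)⟩, ?_⟩
      rw [← bch_pow_mod hq hm hn, hab]
      push_cast
      ring
    · intro hz
      refine Finset.image_subset_image ?_ hz
      exact Finset.product_subset_product_left (Finset.filter_subset _ _)
  rw [h1, Finset.card_image_of_injOn, Finset.card_product, Finset.card_range, mul_comm]
  · congr 1
    have h2 := Finset.card_filter_add_card_filter_not (s := Finset.Icc 1 e) (fun a => q ∣ a)
    have h3 : ((Finset.Icc 1 e).filter fun a => q ∣ a).card = e / q := by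
      have := Nat.Ioc_filter_dvd_card_eq_div e q
      rwa [show Finset.Ioc 0 e = Finset.Icc 1 e from rfl] at this
    rw [h3, Nat.card_Icc] at h2
    omega
  · rintro ⟨a, i⟩ hx ⟨b, j⟩ hy hxy
    simp only [Finset.coe_product, Set.mem_prod, Finset.mem_coe, Finset.mem_filter, Finset.mem_Icc,
      Finset.mem_range] at hx hy hxy
    obtain ⟨⟨⟨ha1, ha2⟩, ha3⟩, hi⟩ := hx
    obtain ⟨⟨⟨hb1, hb2⟩, hb3⟩, hj⟩ := hy
    have key : (a : ZMod n) = (b : ZMod n) * (q : ZMod n) ^ ((j + (m - i)) % m) := by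
      rw [← bch_pow_mod hq hm hn, pow_add, ← mul_assoc, ← hxy, mul_assoc, ← pow_add,
        show i + (m - i) = m by omega, bch_q_pow hq hm hn, mul_one]
    obtain ⟨h1, h2⟩ := bch_coset_inj hq hm hn ha1 (by omega) hb1 (by omega) ha3 hb3
      (Nat.mod_lt _ (by omega)) key
    have : i = j := by
      obtain ⟨c, hc⟩ := Nat.dvd_of_mod_eq_zero h1
      have hc1 : c = 1 := by
        have : c < 2 := by
          by_contra hcc
          have := Nat.mul_le_mul_left m (not_lt.1 hcc)
          omega
        have : c ≠ 0 := by rintro rfl; omega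
        omega
      subst hc1
      omega
    rw [h2, this]

theorem bch_bound_e {q m n δ : ℕ} (hq : 2 ≤ q) (hm : 2 ≤ m) (hn : n = q ^ m - 1) (hδ1 : 2 ≤ δ)
    (hδ2 : δ ≤ q ^ ((m + 1) / 2) - 1 - (q - 2) * (if Odd m then 1 else 0)) :
    (δ - 1) * q ^ (m - (m + 1) / 2) + (δ - 1) < n := by
  obtain ⟨e, rfl⟩ : ∃ e, δ = e + 1 := ⟨δ - 1, by omega⟩
  rw [Nat.add_sub_cancel]
  have hnn := (bch_h_facts hq hm hn).2
  rcases Nat.even_or_odd m with hev | hodd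
  · rw [if_neg (Nat.not_odd_iff_even.2 hev)] at hδ2
    obtain ⟨h, rfl⟩ := hev
    rw [show (h + h + 1) / 2 = h by omega] at *
    rw [show h + h - h = h by omega]
    rw [pow_add] at hnn
    generalize q ^ h = Q at *
    obtain ⟨t, rfl⟩ : ∃ t, Q = e + 2 + t := ⟨Q - (e + 2), by omega⟩
    nlinarith
  · rw [if_pos hodd] at hδ2
    obtain ⟨h, rfl⟩ := hodd
    rw [show (2 * h + 1 + 1) / 2 = h + 1 by omega] at *
    rw [show 2 * h + 1 - (h + 1) = h by omega]
    rw [show 2 * h + 1 = h + h + 1 by ring, pow_succ, pow_add] at hnn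
    rw [pow_succ] at hδ2
    have hP : 1 ≤ q ^ h := Nat.one_le_pow _ _ (by omega)
    generalize q ^ h = P at *
    obtain ⟨s, rfl⟩ : ∃ s, P = 1 + s := ⟨P - 1, by omega⟩
    have h3 : e ≤ s * q := by
      have : (1 + s) * q = q + s * q := by ring
      omega
    nlinarith [Nat.mul_le_mul_right (1 + s + 1) h3]

theorem bch_Z_disj {q m n δ : ℕ} (hq : 2 ≤ q) (hm : 2 ≤ m) (hn : n = q ^ m - 1) (hδ1 : 2 ≤ δ)
    (hδ2 : δ ≤ q ^ ((m + 1) / 2) - 1 - (q - 2) * (if Odd m then 1 else 0))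
    (z : ZMod n) (hz : z ∈ bchZ q m n (δ - 1)) : -z ∉ bchZ q m n (δ - 1) := by
  intro hz'
  have hbd := bch_bound_e hq hm hn hδ1 hδ2
  have aux : ∀ a b l : ℕ, 1 ≤ b → a ≤ δ - 1 → b ≤ δ - 1 → l ≤ m - (m + 1) / 2 →
      (a : ZMod n) * (q : ZMod n) ^ l + b ≠ 0 := by
    intro a b l hb ha' hb' hl h0
    have h1 : ((a * q ^ l + b : ℕ) : ZMod n) = 0 := by push_cast; exact h0
    rw [ZMod.natCast_eq_zero_iff] at h1
    have h2 := Nat.le_of_dvd (by omega) h1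
    have h3 : a * q ^ l ≤ (δ - 1) * q ^ (m - (m + 1) / 2) :=
      Nat.mul_le_mul ha' (Nat.pow_le_pow_right (by omega) hl)
    omega
  rw [bch_mem_Z hq hm hn] at hz hz'
  obtain ⟨a, ha1, ha2, i, rfl⟩ := hz
  obtain ⟨b, hb1, hb2, j, hj⟩ := hz'
  have h1 : (a : ZMod n) * (q : ZMod n) ^ ((i + (m - 1) * j) % m) + b = 0 := by
    rw [← bch_pow_mod hq hm hn, pow_add, ← mul_assoc, ← neg_neg ((a : ZMod n) * (q : ZMod n) ^ i), hj,
      neg_mul, mul_assoc, ← pow_add]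
    have : j + (m - 1) * j = m * j := by
      obtain ⟨t, rfl⟩ : ∃ t, m = t + 1 := ⟨m - 1, by omega⟩
      rw [Nat.add_sub_cancel]; ring
    rw [this, pow_mul, bch_q_pow hq hm hn, one_pow]
    ring
  have hl := Nat.mod_lt (i + (m - 1) * j) (show m > 0 by omega)
  generalize (i + (m - 1) * j) % m = l at *
  by_cases hl' : l ≤ m - (m + 1) / 2
  · exact aux a b l hb1 ha2 hb2 hl' h1
  · apply aux b a (m - l) ha1 hb2 ha2 (by omega)
    have h2 : ((a : ZMod n) * (q : ZMod n) ^ l + b) * (q : ZMod n) ^ (m - l) = 0 := by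
      rw [h1, zero_mul]
    rw [add_mul, mul_assoc, ← pow_add, show l + (m - l) = m by omega, bch_q_pow hq hm hn] at h2
    rw [add_comm]; simpa using h2

theorem bch_ceil {q δ : ℕ} (hq : 2 ≤ q) (hδ1 : 2 ≤ δ) :
    ⌈((δ : ℚ) - 1) * (1 - 1 / (q : ℚ))⌉₊ = (δ - 1) - (δ - 1) / q := by
  obtain ⟨e, rfl⟩ : ∃ e, δ = e + 1 := ⟨δ - 1, by omega⟩
  rw [Nat.add_sub_cancel]
  have hq0 : (0 : ℚ) < q := by exact_mod_cast (by omega : 0 < q)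
  have hlt : e / q < e := Nat.div_lt_self (by omega) (by omega)
  have hdm := Nat.div_add_mod e q
  have hmod := Nat.mod_lt e (show q > 0 by omega)
  have hdmQ : (q : ℚ) * ((e / q : ℕ) : ℚ) + ((e % q : ℕ) : ℚ) = e := by exact_mod_cast hdm
  have hmodQ : ((e % q : ℕ) : ℚ) < q := by exact_mod_cast hmod
  have hmod0 : (0 : ℚ) ≤ ((e % q : ℕ) : ℚ) := by positivity
  rw [Nat.ceil_eq_iff (by omega), Nat.cast_sub (by omega), Nat.cast_sub (by omega)]
  have hrew : (((e + 1 : ℕ) : ℚ) - 1) * (1 - 1 / (q : ℚ)) = (e : ℚ) - e / q := by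
    push_cast; field_simp; ring
  rw [hrew]
  have h1 : (e : ℚ) / q = ((e / q : ℕ) : ℚ) + ((e % q : ℕ) : ℚ) / q := by
    field_simp; linarith
  have h2 : ((e % q : ℕ) : ℚ) / q < 1 := by rw [div_lt_one hq0]; exact hmodQ
  have h3 : 0 ≤ ((e % q : ℕ) : ℚ) / q := by positivity
  rw [h1]
  constructor <;> push_cast at * <;> linarith

end BCHCombinatorics

section BCHSymplectic

theorem bch_trace_zero (p : ℕ) (hp : p.Prime) {F : Type} [Field F] [Fintype F] [CharP F p] (x : F)
    (h : letI := ZMod.algebra F p; ∀ b : F, Algebra.trace (ZMod p) F (b * x) = 0) : x = 0 := by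
  haveI : Fact p.Prime := ⟨hp⟩
  letI := ZMod.algebra F p
  exact (traceForm_nondegenerate (ZMod p) F).2 x fun b => h b

theorem bch_sympDual (p : ℕ) (hp : p.Prime) {F : Type} [Field F] [Fintype F] [CharP F p] {n : ℕ}
    (X : Submodule F (Fin n → F)) (v : (Fin n → F) × (Fin n → F)) :
    v ∈ sympDual p ((X.prod X : Submodule F _) : Set ((Fin n → F) × (Fin n → F))) ↔
      (∀ y ∈ X, v.1 ⬝ᵥ y = 0) ∧ (∀ y ∈ X, v.2 ⬝ᵥ y = 0) := by
  have hform : ∀ w : (Fin n → F) × (Fin n → F), trSympForm p v w =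
      letI := ZMod.algebra F p
      Algebra.trace (ZMod p) F (v.2 ⬝ᵥ w.1 - v.1 ⬝ᵥ w.2) := by
    intro w
    simp only [trSympForm, dotProduct, Finset.sum_sub_distrib]
    simp only [mul_comm]
  constructor
  · intro h
    constructor
    · intro y hy
      apply bch_trace_zero p hp
      intro b
      have := h (0, (-b) • y) ⟨X.zero_mem, X.smul_mem _ hy⟩
      rw [hform] at this
      simpa using this
    · intro y hy
      apply bch_trace_zero p hp
      intro b
      have := h (b • y, 0) ⟨X.smul_mem _ hy, X.zero_mem⟩
      rw [hform] at this
      simpa using this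
  · rintro ⟨h1, h2⟩ w ⟨hw1, hw2⟩
    rw [hform, h1 _ hw2, h2 _ hw1]
    simp

end BCHSymplectic

theorem bch_exists_char (p : ℕ) (hp : p.Prime) (F : Type) [Field F] [Fintype F] [CharP F p]
    (m n : ℕ) [NeZero n] (hm : 2 ≤ m) (hn : n = Fintype.card F ^ m - 1) :
    ∃ (E : Type) (_ : Field E) (_ : Algebra F E) (ψ : AddChar (ZMod n) E),
      ψ.IsPrimitive ∧ Function.Injective ψ ∧ (n : E) ≠ 0 := by
  classical
  have : Fact p.Prime := ⟨hp⟩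
  have : NeZero m := ⟨by omega⟩
  let E := FiniteField.Extension F p m
  let _ : Fintype E := Fintype.ofFinite E
  have hcard : Fintype.card E = Fintype.card F ^ m := by
    rw [← Nat.card_eq_fintype_card, ← Nat.card_eq_fintype_card]
    exact FiniteField.natCard_extension F p m
  obtain ⟨u, hu⟩ := IsCyclic.exists_generator (α := Eˣ)
  have hou : orderOf u = n := by
    rw [orderOf_eq_card_of_forall_mem_zpowers hu, Nat.card_eq_fintype_card, Fintype.card_units,
      hcard, hn]
  have hpr : IsPrimitiveRoot (u : E) n := by
    rw [IsPrimitiveRoot.coe_units_iff, ← hou]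
    exact IsPrimitiveRoot.orderOf u
  refine ⟨E, inferInstance, inferInstance, AddChar.zmodChar n hpr.pow_eq_one,
    AddChar.zmodChar_primitive_of_primitive_root n hpr, ?_, ?_⟩
  · intro a b hab
    rw [AddChar.zmodChar_apply, AddChar.zmodChar_apply] at hab
    exact ZMod.val_injective n (hpr.pow_inj (ZMod.val_lt a) (ZMod.val_lt b) hab)
  · have h1 : n + 1 = Fintype.card E := by
      rw [hcard, hn]
      have : 0 < Fintype.card F ^ m := pow_pos Fintype.card_pos _
      omega
    have h2 := congrArg (Nat.cast : ℕ → E) h1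
    rw [FiniteField.cast_card_eq_zero] at h2
    intro h0
    push_cast at h2
    rw [h0, zero_add] at h2
    exact one_ne_zero h2

/-- Subsystem codes from primitive narrow-sense BCH codes, Euclidean.
Let `n = q^m − 1`, `m ≥ 2`, `2 ≤ δ ≤ q^⌈m/2⌉ − 1 − (q−2)·[m odd]`, and
`k = m⌈(δ−1)(1−1/q)⌉`.  If `T ⊆ N \ (∪_{a=1}^{δ−1}(C_a ∪ C_{−a}))` is a union
of cyclotomic cosets and `r = |T ∪ T^{−1}|` satisfies `0 ≤ r < n − 2k`, then
there exists an `[[q^m − 1, q^m − 1 − 2k − r, r, d]]_q` Clifford subsystem code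
with `d ≥ δ`. -/
theorem bch_subsystem_codes_euclidean
    (p : ℕ) (hp : p.Prime) (F : Type) [Field F] [Fintype F] [CharP F p]
    (m n δ k r : ℕ) (hm : 2 ≤ m)
    (hn : n = Fintype.card F ^ m - 1)
    (hδ1 : 2 ≤ δ)
    (hδ2 : δ ≤ Fintype.card F ^ ((m + 1) / 2) - 1 -
      (Fintype.card F - 2) * (if Odd m then 1 else 0))
    (hk : k = m * ⌈((δ : ℚ) - 1) * (1 - 1 / (Fintype.card F : ℚ))⌉₊)
    (T : Finset (ZMod n))
    -- `T` is a union of cyclotomic cosets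
    (hTcl : ∀ t ∈ T, (Fintype.card F : ZMod n) * t ∈ T)
    -- `T ⊆ N \ (∪_{a=1}^{δ−1} (C_a ∪ C_{−a}))`
    (hTsub : ∀ t ∈ T, ∀ a : ℕ, 1 ≤ a → a ≤ δ - 1 →
      t ∉ cycCoset (Fintype.card F) n (a : ZMod n) ∧
      t ∉ cycCoset (Fintype.card F) n (-(a : ZMod n)))
    (hr : r = (T ∪ T.image (fun s => -s)).card) (hrlt : r < n - 2 * k) :
    ∃ d : ℕ, δ ≤ d ∧
      ∃ Q : AddSubgroup ((Fin n → F) × (Fin n → F)),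
        IsSubsysCode p Q (Fintype.card F ^ (n - 2 * k - r)) (Fintype.card F ^ r) d := by
  classical
  have hq : 2 ≤ Fintype.card F := Fintype.one_lt_card
  have : NeZero n := ⟨by
    have := (bch_h_facts hq hm hn).1
    have : 0 < Fintype.card F ^ ((m + 1) / 2) := pow_pos (by omega) _
    omega⟩
  obtain ⟨E, _, _, ψ, hψ, hinj, hn0⟩ := bch_exists_char p hp F m n hm hn
  have hunit : IsUnit (Fintype.card F : ZMod n) :=
    IsUnit.of_pow_eq_one (bch_q_pow hq hm hn) (by omega)
  have he : δ - 1 < Fintype.card F ^ ((m + 1) / 2) := by omega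
  set Z := bchZ (Fintype.card F) m n (δ - 1) with hZdef
  set W := T ∪ T.image (fun s => -s) with hWdef
  set Zn := Z.image (fun s => -s) with hZndef
  have hZcard : Z.card = k := by rw [hZdef, bch_Z_card hq hm hn he, hk, bch_ceil hq hδ1]
  have hZncard : Zn.card = k := by rw [hZndef, Finset.card_image_of_injective _ neg_injective, hZcard]
  have hZZ : ∀ z ∈ Z, -z ∉ Z := bch_Z_disj hq hm hn hδ1 hδ2
  have hZcl : ∀ z ∈ Z, (Fintype.card F : ZMod n) * z ∈ Z := bch_Z_closed hq hm hn
  have memZn : ∀ z, z ∈ Zn ↔ -z ∈ Z := by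
    intro z
    simp only [hZndef, Finset.mem_image]
    exact ⟨by rintro ⟨a, ha, rfl⟩; simpa using ha, fun h => ⟨-z, h, neg_neg z⟩⟩
  have memW : ∀ z, z ∈ W ↔ z ∈ T ∨ -z ∈ T := by
    intro z
    simp only [hWdef, Finset.mem_union, Finset.mem_image]
    refine or_congr_right ?_
    exact ⟨by rintro ⟨a, ha, rfl⟩; simpa using ha, fun h => ⟨-z, h, neg_neg z⟩⟩
  have hTZ : ∀ t ∈ T, t ∉ Z ∧ -t ∉ Z := by
    intro t ht
    constructor
    · intro h
      obtain ⟨a, h1, h2, h3⟩ := (bch_mem_Z hq hm hn t).1 h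
      exact (hTsub t ht a h1 h2).1 h3
    · intro h
      obtain ⟨a, h1, h2, i, h3⟩ := (bch_mem_Z hq hm hn (-t)).1 h
      exact (hTsub t ht a h1 h2).2 ⟨i, by rw [neg_mul, ← h3, neg_neg]⟩
  have hWZ : ∀ t ∈ W, t ∉ Z ∧ -t ∉ Z := by
    intro t ht
    rcases (memW t).1 ht with h | h
    · exact hTZ t h
    · have := hTZ _ h
      rw [neg_neg] at this
      exact this.symm
  have hZncl : ∀ z ∈ Zn, (Fintype.card F : ZMod n) * z ∈ Zn := by
    intro z hz
    rw [memZn] at *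
    rw [← mul_neg]; exact hZcl _ hz
  have hScl : ∀ z ∈ Zn ∪ W, (Fintype.card F : ZMod n) * z ∈ Zn ∪ W := by
    intro z hz
    rw [Finset.mem_union] at *
    rcases hz with hz | hz
    · exact Or.inl (hZncl z hz)
    · right
      rw [memW] at *
      rcases hz with hz | hz
      · exact Or.inl (hTcl _ hz)
      · right; rw [← mul_neg]; exact hTcl _ hz
  have hdisj : Disjoint Zn W := by
    rw [Finset.disjoint_left]
    intro z h1 h2
    exact (hWZ z h2).2 ((memZn z).1 h1)
  set X := bchCode F ψ (Zn ∪ W) with hX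
  set Y := bchCode F ψ Zn with hY
  have hXr : Module.finrank F X = k + r := by
    rw [hX, bch_finrank ψ hinj _ hunit (bch_closed hq hm hn _ hScl),
      Finset.card_union_of_disjoint hdisj, hZncard, hr]
  have hYr : Module.finrank F Y = k := by
    rw [hY, bch_finrank ψ hinj _ hunit (bch_closed hq hm hn _ hZncl), hZncard]
  have hXd : ∀ x, (∀ y ∈ X, x ⬝ᵥ y = 0) ↔ x ∈ bchCode F ψ (((Zn ∪ W).image fun s => -s)ᶜ) :=
    bch_dual ψ hψ hinj hn0 _ hunit (bch_closed hq hm hn _ hScl)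
  have hYd : ∀ x, (∀ y ∈ Y, x ⬝ᵥ y = 0) ↔ x ∈ bchCode F ψ ((Zn.image fun s => -s)ᶜ) :=
    bch_dual ψ hψ hinj hn0 _ hunit (bch_closed hq hm hn _ hZncl)
  have hZnn : (Zn.image fun s => -s) = Z := by
    rw [hZndef, Finset.image_image]; simp [Function.comp_def]
  rw [hZnn] at hYd
  have hXY : ∀ x, (x ∈ X ∧ x ∈ bchCode F ψ (((Zn ∪ W).image fun s => -s)ᶜ)) ↔ x ∈ Y := by
    intro x
    have hmem : ∀ s, s ∈ ((Zn ∪ W).image fun s => -s)ᶜ ↔ ¬ (s ∈ Z ∨ s ∈ W) := by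
      intro s
      rw [Finset.mem_compl, Finset.image_union, hZnn, Finset.mem_union, not_iff_not]
      refine or_congr_right ?_
      simp only [Finset.mem_image]
      constructor
      · rintro ⟨a, ha, rfl⟩
        rw [memW] at *
        rw [neg_neg]; exact ha.symm
      · intro h
        refine ⟨-s, ?_, neg_neg s⟩
        rw [memW] at *
        rw [neg_neg]; exact h.symm
    constructor
    · rintro ⟨h1, h2⟩ s hs
      by_cases hsW : s ∈ W
      · exact h2 s (by rw [hmem]; simp [hsW])
      · exact h1 s (by simp [hs, hsW])
    · intro h
      constructor
      · intro s hs
        apply h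
        intro h'
        exact hs (Finset.mem_union_left _ h')
      · intro s hs
        apply h
        intro h'
        rw [hmem, not_not] at hs
        rw [memZn] at h'
        rcases hs with hs | hs
        · exact hZZ s hs h'
        · exact (hWZ s hs).2 h'
  let Q : AddSubgroup ((Fin n → F) × (Fin n → F)) := (X.prod X).toAddSubgroup
  have hQ : (Q : Set ((Fin n → F) × (Fin n → F))) = ((X.prod X : Submodule F _) : Set _) := rfl
  have hDs : (Q : Set ((Fin n → F) × (Fin n → F))) ∩ sympDual p (Q : Set _) =
      ((Y.prod Y : Submodule F _) : Set _) := by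
    ext v
    rw [Set.mem_inter_iff, hQ, bch_sympDual p hp, hXd, hXd]
    simp only [SetLike.mem_coe, Submodule.mem_prod, ← hXY]
    tauto
  have hDd : ∀ v, v ∈ sympDual p ((Q : Set ((Fin n → F) × (Fin n → F))) ∩ sympDual p (Q : Set _)) ↔
      v.1 ∈ bchCode F ψ Zᶜ ∧ v.2 ∈ bchCode F ψ Zᶜ := by
    intro v
    rw [hDs, bch_sympDual p hp, hYd, hYd]
  have hZccl : ∀ z ∈ Zᶜ, (Fintype.card F : ZMod n) * z ∈ Zᶜ := by
    intro z hz
    rw [Finset.mem_compl] at *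
    rwa [bch_closed hq hm hn Z hZcl]
  have hBr : Module.finrank F (bchCode F ψ Zᶜ) = n - k := by
    rw [bch_finrank ψ hinj _ hunit (bch_closed hq hm hn _ hZccl), Finset.card_compl, hZcard,
      ZMod.card]
  obtain ⟨x, hxB, hxX⟩ : ∃ x ∈ bchCode F ψ Zᶜ, x ∉ X := by
    by_contra hcon
    push Not at hcon
    have hle : bchCode F ψ Zᶜ ≤ X := hcon
    have := Submodule.finrank_mono hle
    omega
  have hcard : ∀ V : Submodule F (Fin n → F),
      Nat.card ((V.prod V : Submodule F _) : Set ((Fin n → F) × (Fin n → F))) =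
        Fintype.card F ^ (2 * Module.finrank F V) := by
    intro V
    have h1 : Nat.card ((V.prod V : Submodule F _) : Set ((Fin n → F) × (Fin n → F))) =
        Nat.card (V × V) := Nat.card_congr (Equiv.Set.prod (V : Set (Fin n → F)) (V : Set (Fin n → F)))
    rw [h1, Nat.card_prod, Module.natCard_eq_pow_finrank (K := F) (V := V), Nat.card_eq_fintype_card]
    ring
  have hmemx : ((x, 0) : (Fin n → F) × (Fin n → F)) ∈
      sympDual p ((Q : Set ((Fin n → F) × (Fin n → F))) ∩ sympDual p (Q : Set _)) \ (Q : Set _) := by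
    refine ⟨(hDd _).2 ⟨hxB, Submodule.zero_mem _⟩, ?_⟩
    rw [hQ]
    exact fun h => hxX h.1
  refine ⟨minSwt (sympDual p ((Q : Set ((Fin n → F) × (Fin n → F))) ∩ sympDual p (Q : Set _)) \
    (Q : Set _)), ?_, Q, ?_, ?_, ?_, ?_⟩
  · have hhw : ∀ c ∈ bchCode F ψ Zᶜ, c ≠ 0 → δ ≤ {i | c i ≠ 0}.ncard := by
      intro c hc hc0
      refine bch_bound ψ hinj δ (by omega) c hc0 ?_
      intro a ha1 ha2
      apply hc
      rw [Finset.mem_compl, not_not]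
      exact (bch_mem_Z hq hm hn _).2 ⟨a, ha1, ha2, 0, by simp⟩
    refine le_csInf ⟨_, (x, 0), ⟨hmemx, ?_⟩, rfl⟩ ?_
    · intro h
      apply hxX
      have : x = 0 := congrArg Prod.fst h
      rw [this]; exact Submodule.zero_mem _
    · rintro _ ⟨v, ⟨⟨hv, -⟩, hv0⟩, rfl⟩
      rw [hDd] at hv
      by_cases h1 : v.1 = 0
      · have h2 : v.2 ≠ 0 := fun h2 => hv0 (Prod.ext h1 h2)
        refine (hhw _ hv.2 h2).trans (Set.ncard_le_ncard ?_ (Set.toFinite _))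
        intro i hi h
        exact hi h.2
      · refine (hhw _ hv.1 h1).trans (Set.ncard_le_ncard ?_ (Set.toFinite _))
        intro i hi h
        exact hi h.1
  · rw [hDs, hcard, hYr, ← pow_add, ← pow_add]
    congr 1; omega
  · change Nat.card ((X.prod X : Submodule F _) : Set ((Fin n → F) × (Fin n → F))) * _ = _
    rw [hcard, hXr, ← pow_add, ← pow_add]
    congr 1; omega
  · intro h
    rw [h] at hmemx
    exact absurd hmemx.1 hmemx.2
  · intro _
    rfl
end

section
/- Subsystem codes from primitive narrow-sense BCH codes (Hermitian): Let q be a prime power, m a positive integer with m ≠ 2, n = q^{2m} − 1, and let δ be an integer with 2 ≤ δ ≤ q^m − 1. Consider the primitive narrow-sense BCH code of length n over F_{q^2} with designed distance δ, set k = m⌈(δ−1)(1−1/q^2)⌉ and N = {0,...,n−1}. If T is a subset of N \ (∪_{a=1}^{δ−1}(C_a ∪ C_{−qa})) that is a union of cyclotomic cosets and r = |T ∪ T^{−q}| satisfies 0 ≤ r < n − 2k, then there exists an [[q^{2m} − 1, q^{2m} − 1 − 2m⌈(δ−1)(1−1/q^2)⌉ − r, r, d]]_q Clifford subsystem code with d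 ≥ δ. -/
open Finset

open Polynomial in
lemma mem_range_of_pow_card {K L : Type} [Field K] [Field L] [Fintype K] [Algebra K L]
    (x : L) (h : x ^ Fintype.card K = x) : ∃ a : K, algebraMap K L a = x := by
  classical
  by_contra hx
  push Not at hx
  have h0 : (X ^ Fintype.card K - X : L[X]) ≠ 0 :=
    FiniteField.X_pow_card_sub_X_ne_zero L Fintype.one_lt_card
  have hsub : insert x (univ.image (algebraMap K L)) ⊆
      (X ^ Fintype.card K - X : L[X]).roots.toFinset := by
    intro y hy
    rw [Multiset.mem_toFinset, mem_roots h0]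
    rcases Finset.mem_insert.1 hy with rfl | hy
    · simp [h]
    · obtain ⟨a, -, rfl⟩ := Finset.mem_image.1 hy
      simp [← map_pow, FiniteField.pow_card]
  have h1 := Finset.card_le_card hsub
  rw [Finset.card_insert_of_notMem (by simpa using hx),
    Finset.card_image_of_injective _ (algebraMap K L).injective, Finset.card_univ] at h1
  have h2 := Multiset.toFinset_card_le (X ^ Fintype.card K - X : L[X]).roots
  have h3 := card_roots' (X ^ Fintype.card K - X : L[X])
  rw [FiniteField.X_pow_card_sub_X_natDegree_eq L Fintype.one_lt_card] at h3
  omega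

open Polynomial in
lemma card_codeK {K L : Type} [Field K] [Field L] [Fintype K] [Algebra K L] (n : ℕ)
    (S : Finset L) (hS : ∀ s ∈ S, s ^ Fintype.card K ∈ S) (hSn : S.card ≤ n) :
    Nat.card {c : Fin n → K // ∀ s ∈ S, ∑ i : Fin n, algebraMap K L (c i) * s ^ (i : ℕ) = 0}
      = Fintype.card K ^ (n - S.card) := by
  classical
  let φ := FiniteField.frobeniusAlgHom K L
  have hφ : ∀ x, φ x = x ^ Fintype.card K := fun x => rfl
  have hφi : Function.Injective φ := φ.toRingHom.injective
  have himg : S.image φ = S := by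
    apply Finset.eq_of_subset_of_card_le
    · intro y hy
      obtain ⟨s, hs, rfl⟩ := Finset.mem_image.1 hy
      exact hS s hs
    · rw [Finset.card_image_of_injective _ hφi]
  let g : L[X] := ∏ s ∈ S, (X - C s)
  have hgm : g.Monic := monic_prod_of_monic _ _ fun s _ => monic_X_sub_C s
  have hgd : g.natDegree = S.card := by
    simp only [g]
    rw [natDegree_prod_of_monic _ _ fun s _ => monic_X_sub_C s]
    simp
  have hgφ : g.map φ.toRingHom = g := by
    simp only [g, Polynomial.map_prod]
    conv_rhs => rw [← himg, Finset.prod_image (hφi.injOn)]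
    simp
  have hlift : g ∈ lifts (algebraMap K L) := by
    rw [lifts_iff_coeff_lifts]
    intro i
    apply mem_range_of_pow_card
    have := congrArg (fun f => coeff f i) hgφ
    simpa [hφ] using this
  obtain ⟨g0, hg0, hg0d, hg0m⟩ := lifts_and_natDegree_eq_and_monic hlift hgm
  have hdvd : ∀ f : K[X], g0 ∣ f ↔ ∀ s ∈ S, eval₂ (algebraMap K L) s f = 0 := by
    intro f
    rw [← map_dvd_map' (algebraMap K L), hg0]
    constructor
    · intro h s hs
      have : (X - C s) ∣ f.map (algebraMap K L) := 
        (Finset.dvd_prod_of_mem (fun s : L => X - C s) hs).trans h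
      rwa [dvd_iff_isRoot, IsRoot, eval_map] at this
    · intro h
      refine Finset.prod_dvd_of_coprime ?_ ?_
      · intro a _ b _ hab
        exact pairwise_coprime_X_sub_C (s := (id : L → L)) Function.injective_id hab
      · intro s hs
        rw [dvd_iff_isRoot, IsRoot, eval_map]
        exact h s hs
  have e1 : {c : Fin n → K // ∀ s ∈ S, ∑ i : Fin n, algebraMap K L (c i) * s ^ (i : ℕ) = 0}
      ≃ {f : degreeLT K n // g0 ∣ (f : K[X])} := by
    refine ((degreeLTEquiv K n).toEquiv.subtypeEquiv ?_).symm
    rintro ⟨f, hf⟩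
    rw [hdvd]
    refine forall₂_congr fun s hs => ?_
    have h2 : f.map (algebraMap K L) ∈ degreeLT L n := by
      rw [mem_degreeLT] at hf ⊢
      exact lt_of_le_of_lt (degree_map_le) hf
    rw [← eval_map, eval_eq_sum_degreeLTEquiv h2]
    simp [degreeLTEquiv]
  rw [Nat.card_congr e1]
  have hmul : ∀ f : degreeLT K (n - S.card), g0 * (f : K[X]) ∈ degreeLT K n := by
    rintro ⟨f, hf⟩
    rw [mem_degreeLT] at hf ⊢
    by_cases h0 : f = 0
    · simp only [h0, mul_zero, degree_zero]; exact WithBot.bot_lt_coe _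
    rw [← natDegree_lt_iff_degree_lt (mul_ne_zero hg0m.ne_zero h0),
      natDegree_mul hg0m.ne_zero h0]
    rw [← natDegree_lt_iff_degree_lt h0] at hf
    omega
  let m : degreeLT K (n - S.card) → {f : degreeLT K n // g0 ∣ (f : K[X])} :=
    fun f => ⟨⟨g0 * f, hmul f⟩, dvd_mul_right _ _⟩
  have hm : Function.Bijective m := by
    constructor
    · intro f f' h
      have : g0 * (f : K[X]) = g0 * f' := congrArg (fun x => ((x.1 : degreeLT K n) : K[X])) h
      exact Subtype.ext (mul_left_cancel₀ hg0m.ne_zero this)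
    · rintro ⟨⟨f, hf⟩, ⟨h, rfl : f = g0 * h⟩⟩
      refine ⟨⟨h, ?_⟩, rfl⟩
      rw [mem_degreeLT] at hf ⊢
      by_cases h0 : h = 0
      · simp only [h0, degree_zero]; exact WithBot.bot_lt_coe _
      rw [← natDegree_lt_iff_degree_lt (mul_ne_zero hg0m.ne_zero h0),
        natDegree_mul hg0m.ne_zero h0] at hf
      rw [← natDegree_lt_iff_degree_lt h0]
      omega
  rw [← Nat.card_eq_of_bijective m hm, Nat.card_congr (degreeLTEquiv K _).toEquiv]
  simp

open Polynomial in
lemma bch_bound_s5 {ι L : Type} [Field L] [Fintype ι] (c x : ι → L) (hx : Function.Injective x)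
    (hx0 : ∀ i, x i ≠ 0) (δ : ℕ) (h : ∀ t, 1 ≤ t → t ≤ δ - 1 → ∑ i, c i * x i ^ t = 0)
    (hc : c ≠ 0) : δ ≤ {i | c i ≠ 0}.ncard := by
  classical
  by_contra hlt
  push Not at hlt
  obtain ⟨i0, hi0⟩ := Function.ne_iff.1 hc
  let S : Finset ι := univ.filter fun i => c i ≠ 0
  have hS : {i | c i ≠ 0}.ncard = S.card := by
    rw [← Set.ncard_coe_finset]; simp [S]
  have hi0S : i0 ∈ S := by simpa [S] using hi0
  let P : L[X] := X * ∏ i ∈ S.erase i0, (X - C (x i))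
  have hPm : (∏ i ∈ S.erase i0, (X - C (x i))).Monic :=
    monic_prod_of_monic _ _ fun s _ => monic_X_sub_C _
  have hPd : P.natDegree = S.card := by
    have := Finset.card_erase_add_one hi0S
    simp only [P]
    rw [natDegree_X_mul hPm.ne_zero, natDegree_prod_of_monic _ _ fun s _ => monic_X_sub_C _]
    simpa using this
  have hsum : ∑ i, c i * P.eval (x i) = 0 := by
    simp_rw [eval_eq_sum_range, Finset.mul_sum]
    rw [Finset.sum_comm]
    apply Finset.sum_eq_zero
    intro t ht
    rw [Finset.mem_range] at ht
    rcases Nat.eq_zero_or_pos t with rfl | htp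
    · simp [P]
    · have := h t htp (by omega)
      calc _ = P.coeff t * ∑ i, c i * x i ^ t := by
            rw [Finset.mul_sum]; exact Finset.sum_congr rfl fun i _ => by ring
        _ = 0 := by rw [this, mul_zero]
  rw [Finset.sum_eq_single i0] at hsum
  · rcases mul_eq_zero.1 hsum with h1 | h1
    · exact hi0 h1
    · simp only [P, eval_mul, eval_X, eval_prod, eval_sub, eval_C] at h1
      rcases mul_eq_zero.1 h1 with h1 | h1
      · exact hx0 _ h1
      · obtain ⟨j, hj, hj2⟩ := Finset.prod_eq_zero_iff.1 h1
        exact (Finset.mem_erase.1 hj).1 (hx (sub_eq_zero.1 hj2)).symm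
  · intro j _ hj
    by_cases hcj : c j = 0
    · simp [hcj]
    · have : j ∈ S.erase i0 := Finset.mem_erase.2 ⟨hj, by simpa [S] using hcj⟩
      simp only [P, eval_mul, eval_X, eval_prod, eval_sub, eval_C]
      rw [Finset.prod_eq_zero this (sub_self _)]; simp
  · simp
lemma zmod_small_congr {n a b : ℕ} (h : (a : ZMod n) = b) (ha : a < n) (hb : b < n) : a = b := by
  have := (ZMod.natCast_eq_natCast_iff' _ _ _).1 h
  rwa [Nat.mod_eq_of_lt ha, Nat.mod_eq_of_lt hb] at this

lemma q_pow_eq_one {q m n : ℕ} (hq : 2 ≤ q) (hn : n = q ^ (2 * m) - 1) :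
    (q : ZMod n) ^ (2 * m) = 1 := by
  have h1 : 1 ≤ q ^ (2 * m) := Nat.one_le_pow _ _ (by omega)
  have : ((q ^ (2 * m) : ℕ) : ZMod n) = ((n + 1 : ℕ) : ZMod n) := by congr 1; omega
  simpa using this

lemma bnd {q m s a : ℕ} (hq : 2 ≤ q) (ha : a < q ^ m - 1) (hs : s ≤ m) :
    a * q ^ s + q ^ m ≤ q ^ (2 * m) - 1 := by
  have h1 : q ^ s ≤ q ^ m := Nat.pow_le_pow_right (by omega) hs
  obtain ⟨c, hc⟩ : ∃ c, q ^ m = a + 2 + c := ⟨q ^ m - a - 2, by omega⟩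
  have h2 : q ^ (2 * m) = q ^ m * q ^ m := by rw [two_mul, pow_add]
  have h3 : a * q ^ s ≤ a * q ^ m := Nat.mul_le_mul_left _ h1
  have : a * q ^ m + q ^ m + q ^ m ≤ q ^ m * q ^ m := by rw [hc]; nlinarith
  omega

lemma neg_disj {q m n a b s : ℕ} (hq : 2 ≤ q) (hn : n = q ^ (2 * m) - 1)
    (ha : a < q ^ m - 1) (ha0 : 0 < a) (hb : b < q ^ m - 1) (hb0 : 0 < b) (hs : s ≤ 2 * m)
    (h : (a : ZMod n) * q ^ s + b = 0) : False := by
  have key : ∀ a b s : ℕ, a < q ^ m - 1 → 0 < b → b < q ^ m - 1 → s ≤ m →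
      (a : ZMod n) * q ^ s + b = 0 → False := by
    intro a b s ha hb0 hb hs h
    have h1 : ((a * q ^ s + b : ℕ) : ZMod n) = 0 := by push_cast; exact h
    rw [ZMod.natCast_eq_zero_iff] at h1
    have := Nat.le_of_dvd (by omega) h1
    have := bnd hq ha hs
    omega
  by_cases hsm : s ≤ m
  · exact key a b s ha hb0 hb hsm h
  · refine key b a (2 * m - s) hb ha0 ha (by omega) ?_
    have h2 : (q : ZMod n) ^ s * q ^ (2 * m - s) = 1 := by
      rw [← pow_add, ← q_pow_eq_one hq hn]; congr 1; omega
    linear_combination (q : ZMod n) ^ (2 * m - s) * h - (a : ZMod n) * h2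

lemma pos_inj {q m n a b s : ℕ} (hq : 2 ≤ q) (hn : n = q ^ (2 * m) - 1)
    (ha : a < q ^ m - 1) (hb : b < q ^ m - 1)
    (hda : ¬ q ^ 2 ∣ a) (hdb : ¬ q ^ 2 ∣ b) (hs : s < m)
    (h : (a : ZMod n) * (q ^ 2) ^ s = b) : s = 0 ∧ a = b := by
  have hqm : q ^ m ≥ 1 := Nat.one_le_pow _ _ (by omega)
  have key : ∀ a b s : ℕ, a < q ^ m - 1 → b < q ^ m - 1 → ¬ q ^ 2 ∣ b → 2 * s ≤ m →
      (a : ZMod n) * (q ^ 2) ^ s = b → s = 0 ∧ a = b := by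
    intro a b s ha hb hd hs h
    have h3 := bnd hq ha hs
    have h4 := bnd (s := 0) hq hb (by omega)
    rw [pow_zero, mul_one] at h4
    have h5 : a * (q ^ 2) ^ s = b := by
      apply zmod_small_congr (n := n)
      · push_cast; exact h
      · rw [← pow_mul]; omega
      · omega
    rcases Nat.eq_zero_or_pos s with rfl | hs0
    · simpa using h5
    · exact absurd (h5 ▸ Dvd.dvd.mul_left (dvd_pow_self _ (by omega)) _) hd
  by_cases hsm : 2 * s ≤ m
  · exact key a b s ha hb hdb hsm h
  · have := key b a (m - s) hb ha hda (by omega) (by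
      have h2 : ((q : ZMod n) ^ 2) ^ s * (q ^ 2) ^ (m - s) = 1 := by
        rw [← pow_add, ← pow_mul, ← q_pow_eq_one hq hn]; congr 1; congr 1; omega
      linear_combination (-((q : ZMod n) ^ 2) ^ (m - s)) * h + (a : ZMod n) * h2)
    omega

/-- The defining set of the BCH code. -/
def bchSet (q m n δ : ℕ) : Finset (ZMod n) :=
  ((Finset.Ioc 0 (δ - 1)) ×ˢ Finset.range m).image fun x => (x.1 : ZMod n) * ((q : ZMod n) ^ 2) ^ x.2

lemma mem_bchSet {q m n δ : ℕ} (hq : 2 ≤ q) (hm : 0 < m) (hn : n = q ^ (2 * m) - 1) (t : ZMod n) :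
    t ∈ bchSet q m n δ ↔ ∃ a : ℕ, 1 ≤ a ∧ a ≤ δ - 1 ∧ ∃ i : ℕ, t = (a : ZMod n) * ((q : ZMod n) ^ 2) ^ i := by
  have hone : ((q : ZMod n) ^ 2) ^ m = 1 := by rw [← pow_mul, q_pow_eq_one hq hn]
  simp only [bchSet, mem_image, mem_product, mem_Ioc, mem_range, Prod.exists]
  constructor
  · rintro ⟨a, i, ⟨⟨h1, h2⟩, h3⟩, rfl⟩
    exact ⟨a, h1, h2, i, rfl⟩
  · rintro ⟨a, h1, h2, i, rfl⟩
    exact ⟨a, i % m, ⟨⟨h1, h2⟩, Nat.mod_lt _ hm⟩, by rw [← pow_eq_pow_mod _ hone]⟩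

lemma bchSet_closed {q m n δ : ℕ} (hq : 2 ≤ q) (hm : 0 < m) (hn : n = q ^ (2 * m) - 1) :
    ∀ t ∈ bchSet q m n δ, (q : ZMod n) ^ 2 * t ∈ bchSet q m n δ := by
  intro t ht
  rw [mem_bchSet hq hm hn] at ht ⊢
  obtain ⟨a, h1, h2, i, rfl⟩ := ht
  exact ⟨a, h1, h2, i + 1, by ring⟩

lemma bchSet_disj {q m n δ : ℕ} (hq : 2 ≤ q) (hm : 0 < m) (hn : n = q ^ (2 * m) - 1)
    (hδ : δ ≤ q ^ m - 1) (t : ZMod n) (ht : t ∈ bchSet q m n δ)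
    (ht' : -(q : ZMod n) * t ∈ bchSet q m n δ) : False := by
  rw [mem_bchSet hq hm hn] at ht ht'
  obtain ⟨a, h1, h2, i, rfl⟩ := ht
  obtain ⟨b, h3, h4, j, h5⟩ := ht'
  have hone : (q : ZMod n) ^ (2 * m) = 1 := q_pow_eq_one hq hn
  have hinv : ((q : ZMod n) ^ 2) ^ j * ((q : ZMod n) ^ 2) ^ (j * (m - 1)) = 1 := by
    rw [← pow_add, ← pow_mul]
    have : 2 * (j + j * (m - 1)) = 2 * m * j := by
      obtain ⟨m', rfl⟩ : ∃ m', m = m' + 1 := ⟨m - 1, by omega⟩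
      simp; ring
    rw [this, pow_mul, hone, one_pow]
  refine neg_disj (a := a) (b := b) (s := (1 + 2 * i + 2 * (j * (m - 1))) % (2 * m)) hq hn
    (by omega) (by omega) (by omega) (by omega) (Nat.mod_lt _ (by omega)).le ?_
  rw [← pow_eq_pow_mod _ hone]
  linear_combination (-((q : ZMod n) ^ 2) ^ (j * (m - 1))) * h5 - (b : ZMod n) * hinv

lemma ceil_count (q D : ℕ) (hq : 2 ≤ q) :
    ⌈(D : ℚ) * (1 - 1 / ((q : ℚ) ^ 2))⌉₊ = D - D / q ^ 2 := by
  have hq2 : 0 < q ^ 2 := by positivity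
  have h1 := Nat.div_add_mod D (q ^ 2)
  have h2 := Nat.mod_lt D hq2
  have h3 : D / q ^ 2 ≤ D := Nat.div_le_self _ _
  have hQ : (0 : ℚ) < (q : ℚ) ^ 2 := by positivity
  have h1' : (q : ℚ) ^ 2 * ((D / q ^ 2 : ℕ) : ℚ) + ((D % q ^ 2 : ℕ) : ℚ) = D := by exact_mod_cast h1
  have h2' : ((D % q ^ 2 : ℕ) : ℚ) < (q : ℚ) ^ 2 := by exact_mod_cast h2
  have h4 : (0 : ℚ) ≤ ((D % q ^ 2 : ℕ) : ℚ) := by positivity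
  have h5 : (D : ℚ) * (1 - 1 / ((q : ℚ) ^ 2)) =
      D - ((D / q ^ 2 : ℕ) : ℚ) - ((D % q ^ 2 : ℕ) : ℚ) / (q : ℚ) ^ 2 := by
    field_simp
    linear_combination h1'
  have h6 : ((D % q ^ 2 : ℕ) : ℚ) / (q : ℚ) ^ 2 < 1 := by rw [div_lt_one hQ]; exact h2'
  have h7 : 0 ≤ ((D % q ^ 2 : ℕ) : ℚ) / (q : ℚ) ^ 2 := by positivity
  rcases Nat.eq_zero_or_pos (D - D / q ^ 2) with h0 | hpos
  · rw [h0, Nat.ceil_eq_zero, h5]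
    have : (D : ℚ) = ((D / q ^ 2 : ℕ) : ℚ) := by exact_mod_cast (by omega)
    linarith
  · rw [Nat.ceil_eq_iff (by omega), h5]
    push_cast [Nat.cast_sub h3, Nat.cast_sub (show 1 ≤ D - D / q ^ 2 from hpos)]
    constructor <;> linarith

lemma bchSet_card {q m n δ : ℕ} (hq : 2 ≤ q) (hm : 0 < m) (hn : n = q ^ (2 * m) - 1)
    (hδ1 : 2 ≤ δ) (hδ : δ ≤ q ^ m - 1) :
    (bchSet q m n δ).card = m * ⌈((δ : ℚ) - 1) * (1 - 1 / ((q : ℚ) ^ 2))⌉₊ := by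
  have hone : ((q : ZMod n) ^ 2) ^ m = 1 := by rw [← pow_mul, q_pow_eq_one hq hn]
  have e : bchSet q m n δ = (((Finset.Ioc 0 (δ - 1)).filter fun a => ¬ q ^ 2 ∣ a) ×ˢ Finset.range m).image
      fun x => (x.1 : ZMod n) * ((q : ZMod n) ^ 2) ^ x.2 := by
    ext t
    rw [mem_bchSet hq hm hn]
    simp only [mem_image, mem_product, mem_Ioc, mem_range, Prod.exists, mem_filter]
    constructor
    · rintro ⟨a, h1, h2, i, rfl⟩
      obtain ⟨e, a', hd, rfl⟩ := Nat.exists_eq_pow_mul_and_not_dvd (n := a) (by omega) (q ^ 2)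
        (by nlinarith)
      have : a' ≤ (q ^ 2) ^ e * a' := Nat.le_mul_of_pos_left _ (by positivity)
      have ha0 : 0 < a' := Nat.pos_of_ne_zero fun h => by simp [h] at hd
      refine ⟨a', (e + i) % m, ⟨⟨⟨ha0, by omega⟩, hd⟩, Nat.mod_lt _ hm⟩, ?_⟩
      rw [← pow_eq_pow_mod _ hone]
      push_cast
      ring
    · rintro ⟨a, i, ⟨⟨⟨h1, h2⟩, -⟩, h3⟩, rfl⟩
      exact ⟨a, h1, h2, i, rfl⟩
  have hwlog : ∀ a i b j : ℕ, a ≤ δ - 1 → ¬ q ^ 2 ∣ a → i < m → b ≤ δ - 1 → ¬ q ^ 2 ∣ b → j < m →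
      i ≤ j → (a : ZMod n) * ((q : ZMod n) ^ 2) ^ i = b * ((q : ZMod n) ^ 2) ^ j → a = b ∧ i = j := by
    intro a i b j ha hda hi hb hdb hj hij h
    have h2 : ((q : ZMod n) ^ 2) ^ i * (q ^ 2) ^ (m - i) = 1 := by
      rw [← pow_add, ← hone]; congr 1; omega
    have h3 : ((q : ZMod n) ^ 2) ^ j = ((q : ZMod n) ^ 2) ^ (j - i) * (q ^ 2) ^ i := by
      rw [← pow_add]; congr 1; omega
    have := pos_inj (a := b) (b := a) (s := j - i) hq hn (by omega) (by omega) hdb hda (by omega) (by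
      rw [h3] at h
      linear_combination (-((q : ZMod n) ^ 2) ^ (m - i)) * h +
        ((a : ZMod n) - b * ((q : ZMod n) ^ 2) ^ (j - i)) * h2)
    omega
  rw [e, Finset.card_image_of_injOn, Finset.card_product, Finset.card_range, mul_comm]
  · congr 1
    have h1 : ((δ : ℚ) - 1) = ((δ - 1 : ℕ) : ℚ) := by push_cast [Nat.cast_sub (show 1 ≤ δ by omega)]; ring
    rw [h1, ceil_count q (δ - 1) hq]
    have := Finset.card_filter_add_card_filter_not (s := Finset.Ioc 0 (δ - 1)) (fun a => q ^ 2 ∣ a)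
    rw [Nat.Ioc_filter_dvd_card_eq_div, Nat.card_Ioc] at this
    omega
  · rintro ⟨a, i⟩ hx ⟨b, j⟩ hy h
    simp only [coe_product, coe_filter, mem_Ioc, coe_range, Set.mem_prod, Set.mem_ofPred_eq, Set.mem_Iio] at hx hy
    rcases le_total i j with hij | hij
    · have := hwlog a i b j hx.1.1.2 hx.1.2 hx.2 hy.1.1.2 hy.1.2 hy.2 hij h
      simp [this]
    · have := hwlog b j a i hy.1.1.2 hy.1.2 hy.2 hx.1.1.2 hx.1.2 hx.2 hij h.symm
      simp [this]

lemma trace_zero_of_forall (p : ℕ) (hp : p.Prime) {F : Type} [Field F] [Fintype F] [CharP F p]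
    (x : F) (h : letI := ZMod.algebra F p; ∀ a : F, Algebra.trace (ZMod p) F (a * x) = 0) : x = 0 := by
  obtain rfl : p = ringChar F := (ringChar.eq F p).symm
  let := ZMod.algebra F (ringChar F)
  by_contra hx
  obtain ⟨b, hb⟩ := FiniteField.trace_to_zmod_nondegenerate F hx
  exact hb (by rw [mul_comm]; exact h b)

/-- The symplectic form over `F`. -/
noncomputable def sympB (F : Type) [Field F] (n : ℕ) :
    LinearMap.BilinForm F ((Fin n → F) × (Fin n → F)) :=
  LinearMap.mk₂ F (fun u v => ∑ i, (v.1 i * u.2 i - u.1 i * v.2 i))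
    (by intro a b c; rw [← Finset.sum_add_distrib]; exact Finset.sum_congr rfl fun i _ => by
          simp only [Prod.fst_add, Prod.snd_add, Pi.add_apply]; ring)
    (by intro r b c; rw [smul_eq_mul, Finset.mul_sum]; exact Finset.sum_congr rfl fun i _ => by
          simp only [Prod.smul_fst, Prod.smul_snd, Pi.smul_apply, smul_eq_mul]; ring)
    (by intro a b c; rw [← Finset.sum_add_distrib]; exact Finset.sum_congr rfl fun i _ => by
          simp only [Prod.fst_add, Prod.snd_add, Pi.add_apply]; ring)
    (by intro r b c; rw [smul_eq_mul, Finset.mul_sum]; exact Finset.sum_congr rfl fun i _ => by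
          simp only [Prod.smul_fst, Prod.smul_snd, Pi.smul_apply, smul_eq_mul]; ring)

lemma sympB_apply {F : Type} [Field F] {n : ℕ} (u v : (Fin n → F) × (Fin n → F)) :
    sympB F n u v = ∑ i, (v.1 i * u.2 i - u.1 i * v.2 i) := rfl

lemma sympB_neg {F : Type} [Field F] {n : ℕ} (u v : (Fin n → F) × (Fin n → F)) :
    sympB F n u v = - sympB F n v u := by
  rw [sympB_apply, sympB_apply, ← Finset.sum_neg_distrib]
  exact Finset.sum_congr rfl fun i _ => by ring

lemma sympB_refl (F : Type) [Field F] (n : ℕ) : (sympB F n).IsRefl := by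
  intro u v h
  rw [sympB_neg, h, neg_zero]

lemma sympB_nondeg (F : Type) [Field F] (n : ℕ) : (sympB F n).Nondegenerate := by
  classical
  rw [LinearMap.BilinForm.Nondegenerate, (sympB_refl F n).nondegenerate_iff_separatingLeft]
  intro u hu
  refine Prod.ext (funext fun i => ?_) (funext fun i => ?_)
  · have := hu (0, Pi.single i 1)
    rw [sympB_apply] at this
    simpa [Pi.single_apply] using this
  · have := hu (Pi.single i 1, 0)
    rw [sympB_apply] at this
    simpa [Pi.single_apply] using this

lemma sympDual_eq_orthogonal (p : ℕ) (hp : p.Prime) {F : Type} [Field F] [Fintype F] [CharP F p]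
    {n : ℕ} (W : Submodule F ((Fin n → F) × (Fin n → F))) :
    sympDual p (W : Set ((Fin n → F) × (Fin n → F))) = ((sympB F n).orthogonal W : Set _) := by
  ext v
  rw [SetLike.mem_coe, LinearMap.BilinForm.mem_orthogonal_iff]
  constructor
  · intro h w hw
    rw [sympB_neg, neg_eq_zero]
    apply trace_zero_of_forall p hp
    intro a
    have := h (a • w) (W.smul_mem a hw)
    rw [← smul_eq_mul, ← map_smul]
    exact this
  · intro h w hw
    have := h w hw
    rw [sympB_neg, neg_eq_zero, sympB_apply] at this
    simp only [trSympForm]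
    rw [this, map_zero]

section
variable {F K L : Type} [Field F] [Field K] [Field L] [Algebra F K] [Algebra K L] {n : ℕ}

/-- Identification of `F × F` with the quadratic extension `K`. -/
def emb2 (β : K) (v : (Fin n → F) × (Fin n → F)) (i : Fin n) : K :=
  algebraMap F K (v.1 i) + β * algebraMap F K (v.2 i)

/-- The cyclic code with zeros `χ t`, `t ∈ Z`, seen inside `F^{2n}`. -/
def codeA (β : K) (χ : ZMod n → L) (Z : Finset (ZMod n)) :
    Submodule F ((Fin n → F) × (Fin n → F)) where
  carrier := {v | ∀ t ∈ Z, ∑ i : Fin n, algebraMap K L (emb2 β v i) * χ t ^ (i : ℕ) = 0}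
  zero_mem' := by intro t _; simp [emb2]
  add_mem' := by
    intro a b ha hb t ht
    have h2 := congrArg₂ (· + ·) (ha t ht) (hb t ht)
    simp only [add_zero, ← Finset.sum_add_distrib] at h2
    rw [← h2]
    refine Finset.sum_congr rfl fun i _ => ?_
    simp only [emb2, Prod.fst_add, Prod.snd_add, Pi.add_apply, map_add, map_mul]; ring
  smul_mem' := by
    intro c a ha t ht
    have : ∑ i : Fin n, algebraMap K L (emb2 β (c • a) i) * χ t ^ (i : ℕ) =
      algebraMap K L (algebraMap F K c) *
        ∑ i : Fin n, algebraMap K L (emb2 β a i) * χ t ^ (i : ℕ) := by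
      rw [Finset.mul_sum]
      refine Finset.sum_congr rfl fun i _ => ?_
      simp only [emb2, Prod.smul_fst, Prod.smul_snd, Pi.smul_apply, smul_eq_mul, map_add, map_mul]
      ring
    rw [this, ha t ht, mul_zero]

lemma mem_codeA {β : K} {χ : ZMod n → L} {Z : Finset (ZMod n)} {v : (Fin n → F) × (Fin n → F)} :
    v ∈ codeA β χ Z ↔ ∀ t ∈ Z, ∑ i : Fin n, algebraMap K L (emb2 β v i) * χ t ^ (i : ℕ) = 0 :=
  Iff.rfl

lemma pair_inj [Fintype F] {β : K} (hβ : β ^ Fintype.card F ≠ β) (x y : F)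
    (h : algebraMap F K x + β * algebraMap F K y = 0) : x = 0 ∧ y = 0 := by
  have hy : y = 0 := by
    by_contra hy
    have hy' : algebraMap F K y ≠ 0 := by simpa using hy
    have : β = algebraMap F K (-x / y) := by
      rw [map_div₀, map_neg, eq_div_iff hy']; linear_combination h
    apply hβ
    rw [this, ← map_pow, FiniteField.pow_card]
  subst hy
  simpa using h

lemma pair_bij [Fintype F] [Fintype K] {β : K} (hβ : β ^ Fintype.card F ≠ β)
    (hK : Fintype.card K = Fintype.card F ^ 2) :
    Function.Bijective fun x : F × F => algebraMap F K x.1 + β * algebraMap F K x.2 := by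
  rw [Fintype.bijective_iff_injective_and_card]
  constructor
  · rintro ⟨a, b⟩ ⟨c, d⟩ h
    have := pair_inj hβ (a - c) (b - d) (by
      simp only [map_sub] at h ⊢; linear_combination h)
    simp only [Prod.mk.injEq]
    exact ⟨sub_eq_zero.1 this.1, sub_eq_zero.1 this.2⟩
  · rw [hK, Fintype.card_prod, sq]

lemma emb2_bij [Fintype F] [Fintype K] {β : K} (hβ : β ^ Fintype.card F ≠ β)
    (hK : Fintype.card K = Fintype.card F ^ 2) :
    Function.Bijective (emb2 β : (Fin n → F) × (Fin n → F) → Fin n → K) := by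
  have hb := pair_bij hβ hK
  constructor
  · intro u v h
    have : ∀ i, (u.1 i, u.2 i) = (v.1 i, v.2 i) := fun i => hb.1 (congrFun h i)
    exact Prod.ext (funext fun i => congrArg Prod.fst (this i))
      (funext fun i => congrArg Prod.snd (this i))
  · intro c
    choose f hf using fun i => hb.2 (c i)
    exact ⟨(fun i => (f i).1, fun i => (f i).2), funext hf⟩

lemma card_codeA [Fintype F] [Fintype K] {β : K} (hβ : β ^ Fintype.card F ≠ β)
    (hK : Fintype.card K = Fintype.card F ^ 2) [NeZero n] {χ : ZMod n → L}
    (hχ : Function.Injective χ) (Z : Finset (ZMod n))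
    (hZ : ∀ t ∈ Z, ∃ t' ∈ Z, χ t ^ (Fintype.card F ^ 2) = χ t') :
    Nat.card (codeA (F := F) β χ Z) = Fintype.card F ^ (2 * (n - Z.card)) := by
  classical
  have hc : (Z.image χ).card = Z.card := Finset.card_image_of_injective _ hχ
  have h1 := card_codeK (K := K) (L := L) n (Z.image χ) (by
    intro s hs
    obtain ⟨t, ht, rfl⟩ := Finset.mem_image.1 hs
    obtain ⟨t', ht', h⟩ := hZ t ht
    rw [hK, h]
    exact Finset.mem_image_of_mem _ ht') (by
    rw [hc]; simpa [ZMod.card] using Finset.card_le_univ Z)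
  rw [hc, hK, ← pow_mul] at h1
  rw [← h1]
  refine Nat.card_congr ((Equiv.ofBijective _ (emb2_bij hβ hK)).subtypeEquiv fun v => ?_)
  rw [mem_codeA]
  simp

lemma emb2_pow [Fintype F] (β : K) (v : (Fin n → F) × (Fin n → F)) (i : Fin n) :
    emb2 β v i ^ Fintype.card F = emb2 (β ^ Fintype.card F) v i := by
  have := map_add (FiniteField.frobeniusAlgHom F K) (algebraMap F K (v.1 i)) (β * algebraMap F K (v.2 i))
  simp only [FiniteField.coe_frobeniusAlgHom] at this
  simp only [emb2]
  rw [this, mul_pow, ← map_pow, ← map_pow, FiniteField.pow_card, FiniteField.pow_card]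

lemma herm_zero [Fintype F] [NeZero n] {β : K} (χ : AddChar (ZMod n) L) (hχ : χ.IsPrimitive)
    (hn : (n : L) ≠ 0) [Algebra F L] (Z Z' : Finset (ZMod n))
    (hZ : ∀ s, s ∈ Z' ∨ ∃ t ∈ Z, s = -(Fintype.card F : ZMod n) * t)
    (u v : (Fin n → F) × (Fin n → F)) (hu : u ∈ codeA β χ Z) (hv : v ∈ codeA β χ Z') :
    ∑ i, emb2 β u i ^ Fintype.card F * emb2 β v i = 0 := by
  classical
  set q := Fintype.card F
  have inv : ∀ j : Fin n, ∑ s, (∑ i : Fin n, algebraMap K L (emb2 β v i) * χ s ^ (i : ℕ)) *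
      χ (-s) ^ (j : ℕ) = n * algebraMap K L (emb2 β v j) := by
    intro j
    have h1 : ∀ (s : ZMod n) (i : Fin n), χ s ^ (i : ℕ) * χ (-s) ^ (j : ℕ) =
        χ (s * (((i : ℕ) : ZMod n) - ((j : ℕ) : ZMod n))) := by
      intro s i
      rw [← AddChar.map_nsmul_eq_pow, ← AddChar.map_nsmul_eq_pow, ← AddChar.map_add_eq_mul]
      congr 1
      simp only [nsmul_eq_mul]; ring
    simp_rw [Finset.sum_mul, mul_assoc, h1]
    rw [Finset.sum_comm]
    simp_rw [← Finset.mul_sum, AddChar.sum_mulShift _ hχ]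
    rw [Finset.sum_eq_single j]
    · simp [ZMod.card, mul_comm]
    · intro i _ hij
      rw [if_neg, Nat.cast_zero, mul_zero]
      intro h0
      apply hij
      have := (ZMod.natCast_eq_natCast_iff' _ _ _).1 (sub_eq_zero.1 h0)
      rw [Nat.mod_eq_of_lt i.2, Nat.mod_eq_of_lt j.2] at this
      exact Fin.ext this
    · simp
  apply (algebraMap K L).injective
  apply mul_left_cancel₀ hn
  rw [map_zero, mul_zero, map_sum, Finset.mul_sum]
  have : ∀ j : Fin n, (n : L) * algebraMap K L (emb2 β u j ^ q * emb2 β v j) =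
      ∑ s, (∑ i : Fin n, algebraMap K L (emb2 β v i) * χ s ^ (i : ℕ)) *
        (algebraMap K L (emb2 β u j) ^ q * χ (-s) ^ (j : ℕ)) := by
    intro j
    rw [map_mul, mul_left_comm, ← inv j, Finset.mul_sum, map_pow]
    exact Finset.sum_congr rfl fun s _ => by ring
  simp_rw [this]
  rw [Finset.sum_comm]
  refine Finset.sum_eq_zero fun s _ => ?_
  rw [← Finset.mul_sum]
  rcases hZ s with hs | ⟨t, ht, rfl⟩
  · rw [hv s hs, zero_mul]
  · convert mul_zero _
    have h2 : ∀ j : Fin n, algebraMap K L (emb2 β u j) ^ q * χ (-(-(q : ZMod n) * t)) ^ (j : ℕ) =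
        FiniteField.frobeniusAlgHom F L (algebraMap K L (emb2 β u j) * χ t ^ (j : ℕ)) := by
      intro j
      rw [FiniteField.coe_frobeniusAlgHom]
      have : -(-(q : ZMod n) * t) = q • t := by rw [nsmul_eq_mul]; ring
      simp only [mul_pow]
      rw [this, AddChar.map_nsmul_eq_pow, pow_right_comm]
    simp_rw [h2]
    rw [← map_sum, hu t ht, map_zero]

lemma symp_zero_of_herm [Fintype F] [Fintype K] {β : K} (hβ : β ^ Fintype.card F ≠ β)
    (hK : Fintype.card K = Fintype.card F ^ 2) (u v : (Fin n → F) × (Fin n → F))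
    (h : ∑ i, emb2 β u i ^ Fintype.card F * emb2 β v i = 0) : sympB F n u v = 0 := by
  have h2 : ∑ i, emb2 β u i * emb2 β v i ^ Fintype.card F = 0 := by
    have := congrArg (FiniteField.frobeniusAlgHom F K) h
    rw [map_sum, map_zero] at this
    rw [← this]
    refine Finset.sum_congr rfl fun i _ => ?_
    rw [FiniteField.coe_frobeniusAlgHom]
    simp only [mul_pow]
    rw [← pow_mul, ← sq, ← hK, FiniteField.pow_card]
  apply (algebraMap F K).injective
  apply mul_left_cancel₀ (sub_ne_zero.2 hβ)
  rw [map_zero, mul_zero, sympB_apply, map_sum, Finset.mul_sum, ← sub_zero (0 : K)]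
  nth_rewrite 1 [← h]
  rw [← h2, ← Finset.sum_sub_distrib]
  refine Finset.sum_congr rfl fun i _ => ?_
  rw [emb2_pow, emb2_pow]
  simp only [emb2, map_sub, map_mul]
  ring

end

lemma closed_pow {n Q j : ℕ} {W : Finset (ZMod n)} (h : ∀ t ∈ W, (Q : ZMod n) ^ 2 * t ∈ W) :
    ∀ t ∈ W, ((Q : ZMod n) ^ 2) ^ j * t ∈ W := by
  induction j with
  | zero => simp
  | succ j ih =>
    intro t ht
    have := h _ (ih t ht)
    rwa [← mul_assoc, ← pow_succ'] at this

lemma closed_compl {n q m : ℕ} [NeZero n] (hq : 2 ≤ q) (hm : 0 < m) (hn : n = q ^ (2 * m) - 1)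
    {W : Finset (ZMod n)} (h : ∀ t ∈ W, (q : ZMod n) ^ 2 * t ∈ W) :
    ∀ t ∈ Wᶜ, (q : ZMod n) ^ 2 * t ∈ Wᶜ := by
  intro t ht
  rw [Finset.mem_compl] at ht ⊢
  intro h2
  apply ht
  have := closed_pow (j := m - 1) h _ h2
  rwa [← mul_assoc, ← pow_succ, Nat.sub_add_cancel hm, ← pow_mul, q_pow_eq_one hq hn, one_mul] at this

lemma closed_image_s5 {n q : ℕ} {W : Finset (ZMod n)} (h : ∀ t ∈ W, (q : ZMod n) ^ 2 * t ∈ W) :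
    ∀ t ∈ W.image (fun s => -(q : ZMod n) * s),
      (q : ZMod n) ^ 2 * t ∈ W.image (fun s => -(q : ZMod n) * s) := by
  intro t ht
  obtain ⟨s, hs, rfl⟩ := Finset.mem_image.1 ht
  exact Finset.mem_image.2 ⟨_, h s hs, by ring⟩

lemma neg_q_inj {n q m : ℕ} (hq : 2 ≤ q) (hm : 0 < m) (hn : n = q ^ (2 * m) - 1) :
    Function.Injective (fun s : ZMod n => -(q : ZMod n) * s) := by
  intro a b h
  have h1 : (q : ZMod n) ^ (2 * m - 1) * q = 1 := by
    rw [← pow_succ, ← q_pow_eq_one hq hn]; congr 1; omega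
  simp only at h
  linear_combination (-(q : ZMod n) ^ (2 * m - 1)) * h + (b - a) * h1

lemma exists_codes (p : ℕ) (hp : p.Prime) (F : Type) [Field F] [Fintype F] [CharP F p]
    (m n : ℕ) [NeZero n] (hm : 0 < m) (hn : n = Fintype.card F ^ (2 * m) - 1) :
    ∃ A : Finset (ZMod n) → Submodule F ((Fin n → F) × (Fin n → F)),
      (∀ Z, (∀ t ∈ Z, (Fintype.card F : ZMod n) ^ 2 * t ∈ Z) →
        Nat.card (A Z) = Fintype.card F ^ (2 * (n - Z.card))) ∧
      (∀ Z, (∀ t ∈ Z, (Fintype.card F : ZMod n) ^ 2 * t ∈ Z) →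
        sympDual p (A Z : Set ((Fin n → F) × (Fin n → F))) =
          (A (Z.image (fun s => -(Fintype.card F : ZMod n) * s))ᶜ : Set _)) ∧
      (∀ Z Z', (A Z : Set ((Fin n → F) × (Fin n → F))) ∩ (A Z' : Set _) = (A (Z ∪ Z') : Set _)) ∧
      (∀ Z δ, (∀ a : ℕ, 1 ≤ a → a ≤ δ - 1 → (a : ZMod n) ∈ Z) → ∀ v ∈ A Z, v ≠ 0 → δ ≤ swt v) := by
  classical
  have hq : 2 ≤ Fintype.card F := Fintype.one_lt_card
  haveI : Fact p.Prime := ⟨hp⟩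
  haveI : NeZero m := ⟨hm.ne'⟩
  let K := FiniteField.Extension F p 2
  haveI : CharP K p := charP_of_injective_algebraMap (algebraMap F K).injective p
  let L := FiniteField.Extension K p m
  haveI : CharP L p := charP_of_injective_algebraMap (algebraMap K L).injective p
  letI : Fintype K := Fintype.ofFinite K
  letI : Fintype L := Fintype.ofFinite L
  letI : Algebra F L := ((algebraMap K L).comp (algebraMap F K)).toAlgebra
  have hK : Fintype.card K = Fintype.card F ^ 2 := by
    rw [← Nat.card_eq_fintype_card, ← Nat.card_eq_fintype_card]
    exact FiniteField.natCard_extension F p 2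
  have hL : Fintype.card L = Fintype.card F ^ (2 * m) := by
    rw [pow_mul, ← hK, ← Nat.card_eq_fintype_card, ← Nat.card_eq_fintype_card]
    exact FiniteField.natCard_extension K p m
  obtain ⟨β, hβ⟩ : ∃ β : K, β ^ Fintype.card F ≠ β := by
    by_contra! h
    have hs : Function.Surjective (algebraMap F K) := fun x => mem_range_of_pow_card x (h x)
    have := Fintype.card_le_of_surjective _ hs
    rw [hK] at this
    nlinarith
  obtain ⟨g, hg⟩ := IsCyclic.exists_generator (α := Lˣ)
  have hgo : orderOf g = n := by
    rw [orderOf_eq_card_of_forall_mem_zpowers hg, Nat.card_eq_fintype_card, Fintype.card_units, hL, hn]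
  have hα : IsPrimitiveRoot (g : L) n := by
    rw [IsPrimitiveRoot.coe_units_iff, ← hgo]; exact IsPrimitiveRoot.orderOf g
  let χ : AddChar (ZMod n) L := AddChar.zmodChar n hα.pow_eq_one
  have hχp : χ.IsPrimitive := AddChar.zmodChar_primitive_of_primitive_root n hα
  have hχa : ∀ t, χ t = (g : L) ^ t.val := fun t => rfl
  have hχn : ∀ t : ℕ, χ (t : ZMod n) = (g : L) ^ t := fun t => AddChar.zmodChar_apply' hα.pow_eq_one t
  have hχi : Function.Injective χ := by
    intro a b h
    rw [hχa, hχa] at h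
    exact ZMod.val_injective n (hα.pow_inj (ZMod.val_lt a) (ZMod.val_lt b) h)
  have hnL : (n : L) ≠ 0 := by
    have h1 : ((n + 1 : ℕ) : L) = 0 := by
      have : n + 1 = Fintype.card L := by
        have : 1 ≤ Fintype.card F ^ (2 * m) := Nat.one_le_pow _ _ (by omega)
        omega
      rw [this]; exact Nat.cast_card_eq_zero L
    intro h0
    push_cast at h1
    rw [h0, zero_add] at h1
    exact one_ne_zero h1
  have hcard : ∀ Z : Finset (ZMod n), (∀ t ∈ Z, (Fintype.card F : ZMod n) ^ 2 * t ∈ Z) →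
      Nat.card (codeA (F := F) β χ Z) = Fintype.card F ^ (2 * (n - Z.card)) := by
    intro Z hZ
    refine card_codeA hβ hK hχi Z fun t ht => ⟨_, hZ t ht, ?_⟩
    rw [← AddChar.map_nsmul_eq_pow, nsmul_eq_mul]
    push_cast
    rfl
  have hfin : ∀ Z : Finset (ZMod n), (∀ t ∈ Z, (Fintype.card F : ZMod n) ^ 2 * t ∈ Z) →
      Module.finrank F (codeA (F := F) β χ Z) = 2 * (n - Z.card) := by
    intro Z hZ
    have h1 := hcard Z hZ
    rw [Module.natCard_eq_pow_finrank (K := F), Nat.card_eq_fintype_card] at h1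
    exact Nat.pow_right_injective hq h1
  refine ⟨fun Z => codeA β χ Z, hcard, ?_, ?_, ?_⟩
  · intro Z hZ
    rw [sympDual_eq_orthogonal p hp]
    congr 1
    symm
    have hZ' := closed_compl hq hm hn (closed_image_s5 hZ)
    apply Submodule.eq_of_le_of_finrank_eq
    · intro v hv
      rw [LinearMap.BilinForm.mem_orthogonal_iff]
      intro u hu
      refine symp_zero_of_herm hβ hK u v (herm_zero χ hχp hnL Z _ ?_ u v hu hv)
      intro s
      by_cases hs : s ∈ Z.image (fun s => -(Fintype.card F : ZMod n) * s)
      · obtain ⟨t, ht, rfl⟩ := Finset.mem_image.1 hs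
        exact Or.inr ⟨t, ht, rfl⟩
      · exact Or.inl (Finset.mem_compl.2 hs)
    · rw [LinearMap.BilinForm.finrank_orthogonal (sympB_nondeg F n), hfin _ hZ', hfin _ hZ,
        Finset.card_compl, Finset.card_image_of_injective _ (neg_q_inj hq hm hn), ZMod.card]
      have : Z.card ≤ n := by simpa [ZMod.card] using Finset.card_le_univ Z
      simp only [Module.finrank_prod, Module.finrank_fintype_fun_eq_card, Fintype.card_fin]
      omega
  · intro Z Z'
    ext v
    simp only [Set.mem_inter_iff, SetLike.mem_coe, mem_codeA, Finset.mem_union]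
    constructor
    · rintro ⟨h1, h2⟩ t (ht | ht)
      · exact h1 t ht
      · exact h2 t ht
    · intro h
      exact ⟨fun t ht => h t (Or.inl ht), fun t ht => h t (Or.inr ht)⟩
  · intro Z δ hδ v hv hv0
    have hinj : Function.Injective (fun i : Fin n => (g : L) ^ (i : ℕ)) := fun i j h =>
      Fin.ext (hα.pow_inj i.2 j.2 h)
    have hg0 : (g : L) ≠ 0 := g.ne_zero
    have := bch_bound_s5 (fun i => algebraMap K L (emb2 β v i)) (fun i : Fin n => (g : L) ^ (i : ℕ))
      hinj (fun i => pow_ne_zero _ hg0) δ (by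
        intro t ht1 ht2
        have := hv _ (hδ t ht1 ht2)
        rw [← this]
        refine Finset.sum_congr rfl fun i _ => ?_
        rw [hχn, pow_right_comm]) (by
        intro h0
        apply hv0
        apply (emb2_bij (n := n) hβ hK).1
        funext i
        have h1 : algebraMap K L (emb2 β v i) = 0 := congrFun h0 i
        rw [map_eq_zero] at h1
        rw [h1]; simp [emb2])
    refine this.trans (le_of_eq ?_)
    unfold swt
    congr 1
    ext i
    simp only [Set.mem_ofPred_eq, ne_eq, map_eq_zero, not_iff_not]
    constructor
    · exact fun h => pair_inj hβ _ _ h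
    · rintro ⟨h1, h2⟩; simp [emb2, h1, h2]

lemma image_compl_bij {X : Type} [Fintype X] [DecidableEq X] {f : X → X}
    (hf : Function.Bijective f) (s : Finset X) : sᶜ.image f = (s.image f)ᶜ := by
  ext y
  obtain ⟨x, rfl⟩ := hf.2 y
  rw [Finset.mem_compl, hf.1.mem_finset_image, hf.1.mem_finset_image, Finset.mem_compl]

lemma prop_aux {P Q R : Prop} (h1 : P → ¬ Q) (h2 : R → ¬ Q) :
    (¬ (Q ∨ P) ∨ (R ∨ P)) ↔ ¬ Q := by tauto

/-- Subsystem codes from primitive narrow-sense BCH codes, Hermitian.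
Let `m ≠ 2` be positive, `n = q^{2m} − 1`, `2 ≤ δ ≤ q^m − 1`, and
`k = m⌈(δ−1)(1−1/q^2)⌉`.  If `T ⊆ N \ (∪_{a=1}^{δ−1}(C_a ∪ C_{−qa}))` is a
union of cyclotomic cosets (multiplier `q^2`) and `r = |T ∪ T^{−q}|` satisfies
`0 ≤ r < n − 2k`, then there exists an `[[q^{2m} − 1, q^{2m} − 1 − 2k − r, r, d]]_q`
Clifford subsystem code with `d ≥ δ`. -/
theorem bch_subsystem_codes_hermitian
    (p : ℕ) (hp : p.Prime) (F : Type) [Field F] [Fintype F] [CharP F p]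
    (m n δ k r : ℕ) (hm0 : 0 < m) (hm2 : m ≠ 2)
    (hn : n = Fintype.card F ^ (2 * m) - 1)
    (hδ1 : 2 ≤ δ) (hδ2 : δ ≤ Fintype.card F ^ m - 1)
    (hk : k = m * ⌈((δ : ℚ) - 1) * (1 - 1 / ((Fintype.card F : ℚ) ^ 2))⌉₊)
    (T : Finset (ZMod n))
    -- `T` is a union of cyclotomic cosets (multiplier `q^2`)
    (hTcl : ∀ t ∈ T, (Fintype.card F : ZMod n) ^ 2 * t ∈ T)
    -- `T ⊆ N \ (∪_{a=1}^{δ−1} (C_a ∪ C_{−qa}))`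
    (hTsub : ∀ t ∈ T, ∀ a : ℕ, 1 ≤ a → a ≤ δ - 1 →
      t ∉ cycCoset (Fintype.card F ^ 2) n (a : ZMod n) ∧
      t ∉ cycCoset (Fintype.card F ^ 2) n (-(Fintype.card F : ZMod n) * (a : ZMod n)))
    (hr : r = (T ∪ T.image (fun s => -(Fintype.card F : ZMod n) * s)).card)
    (hrlt : r < n - 2 * k) :
    ∃ d : ℕ, δ ≤ d ∧
      ∃ Q : AddSubgroup ((Fin n → F) × (Fin n → F)),
        IsSubsysCode p Q (Fintype.card F ^ (n - 2 * k - r)) (Fintype.card F ^ r) d := by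
  classical
  have hq : 2 ≤ Fintype.card F := Fintype.one_lt_card
  haveI : NeZero n := ⟨by omega⟩
  obtain ⟨A, hcard, hdual, hinter, hdist⟩ := exists_codes p hp F m n hm0 hn
  set q := Fintype.card F with hqdef
  set Z := bchSet q m n δ with hZdef
  set ν : ZMod n → ZMod n := fun s => -(q : ZMod n) * s with hν
  have hνi : Function.Injective ν := neg_q_inj hq hm0 hn
  have hνν : ∀ t, ν (ν t) = (q : ZMod n) ^ 2 * t := fun t => by simp only [hν]; ring
  have hZcl : ∀ t ∈ Z, (q : ZMod n) ^ 2 * t ∈ Z := bchSet_closed hq hm0 hn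
  have hZk : Z.card = k := by rw [hk]; exact bchSet_card hq hm0 hn hδ1 hδ2
  have hZm : ∀ t, t ∈ Z ↔ _ := fun t => mem_bchSet hq hm0 hn t
  have hZdisj : ∀ t ∈ Z, ν t ∉ Z := fun t h1 h2 => bchSet_disj hq hm0 hn hδ2 t h1 h2
  set U := T ∪ T.image ν with hU
  have hUcl : ∀ t ∈ U, (q : ZMod n) ^ 2 * t ∈ U := by
    intro t ht
    rcases Finset.mem_union.1 ht with h | h
    · exact Finset.mem_union_left _ (hTcl t h)
    · exact Finset.mem_union_right _ (closed_image_s5 hTcl t h)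
  have hTZ : ∀ t ∈ T, t ∉ Z := by
    intro t ht h
    obtain ⟨a, h1, h2, i, h3⟩ := (hZm t).1 h
    exact (hTsub t ht a h1 h2).1 ⟨i, by rw [h3]; push_cast; rfl⟩
  have hTνZ : ∀ t ∈ T, t ∉ Z.image ν := by
    intro t ht h
    obtain ⟨z, hz, rfl⟩ := Finset.mem_image.1 h
    obtain ⟨a, h1, h2, i, h3⟩ := (hZm z).1 hz
    exact (hTsub _ ht a h1 h2).2 ⟨i, by rw [h3]; push_cast; simp only [hν]; ring⟩
  have hback : ∀ (W : Finset (ZMod n)), (∀ t ∈ W, (q : ZMod n) ^ 2 * t ∈ W) →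
      ∀ t, (q : ZMod n) ^ 2 * t ∈ W → t ∈ W := by
    intro W hW t ht
    by_contra h
    have := closed_compl hq hm0 hn hW t (Finset.mem_compl.2 h)
    exact Finset.mem_compl.1 this ht
  have hνUU : ∀ t, t ∈ U.image ν ↔ t ∈ U := by
    have hsub : U.image ν ⊆ U := by
      intro t ht
      obtain ⟨s, hs, rfl⟩ := Finset.mem_image.1 ht
      rcases Finset.mem_union.1 hs with h | h
      · exact Finset.mem_union_right _ (Finset.mem_image_of_mem _ h)
      · obtain ⟨s', hs', rfl⟩ := Finset.mem_image.1 h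
        rw [hνν]
        exact Finset.mem_union_left _ (hTcl _ hs')
    have := Finset.eq_of_subset_of_card_le hsub (by rw [Finset.card_image_of_injective _ hνi])
    intro t; rw [this]
  have hUZ : ∀ t ∈ U, t ∉ Z := by
    intro t ht hz
    rcases Finset.mem_union.1 ht with h | h
    · exact hTZ t h hz
    · obtain ⟨s, hs, rfl⟩ := Finset.mem_image.1 h
      refine hTνZ ((q : ZMod n) ^ 2 * s) (hTcl s hs) ?_
      rw [← hνν]
      exact Finset.mem_image_of_mem _ hz
  have hUνZ : ∀ t ∈ U, t ∉ Z.image ν := by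
    intro t ht hz
    obtain ⟨s, hs, rfl⟩ := Finset.mem_image.1 hz
    rw [← hνUU] at ht
    obtain ⟨s', hs', h⟩ := Finset.mem_image.1 ht
    exact hUZ s' hs' (hνi h ▸ hs)
  have hνZcl : ∀ t ∈ Z.image ν, (q : ZMod n) ^ 2 * t ∈ Z.image ν := closed_image_s5 hZcl
  have hVcl : ∀ t ∈ Z.image ν ∪ U, (q : ZMod n) ^ 2 * t ∈ Z.image ν ∪ U := by
    intro t ht
    rcases Finset.mem_union.1 ht with h | h
    · exact Finset.mem_union_left _ (hνZcl t h)
    · exact Finset.mem_union_right _ (hUcl t h)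
  have hV'cl := closed_compl hq hm0 hn hVcl
  have hνZcl' := closed_compl hq hm0 hn hνZcl
  have hνZcard : (Z.image ν).card = k := by rw [Finset.card_image_of_injective _ hνi, hZk]
  have hVcard : (Z.image ν ∪ U).card = k + r := by
    rw [Finset.card_union_of_disjoint, hνZcard, hr]
    rw [Finset.disjoint_right]
    exact hUνZ
  have hle : ∀ W : Finset (ZMod n), W.card ≤ n := fun W => by
    simpa [ZMod.card] using Finset.card_le_univ W
  have hνZ2 : ∀ t, t ∈ (Z.image ν).image ν ↔ t ∈ Z := by
    have hsub : (Z.image ν).image ν ⊆ Z := by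
      intro t ht
      obtain ⟨s, hs, rfl⟩ := Finset.mem_image.1 ht
      obtain ⟨s', hs', rfl⟩ := Finset.mem_image.1 hs
      rw [hνν]; exact hZcl _ hs'
    have := Finset.eq_of_subset_of_card_le hsub (by
      rw [Finset.card_image_of_injective _ hνi, Finset.card_image_of_injective _ hνi])
    intro t; rw [this]
  have hνb : Function.Bijective ν := Finite.injective_iff_bijective.1 hνi
  have hVd : (((Z.image ν ∪ U)ᶜ).image ν)ᶜ = Z ∪ U := by
    rw [image_compl_bij hνb, compl_compl, Finset.image_union]
    ext t
    rw [Finset.mem_union, Finset.mem_union, hνZ2, hνUU]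
  have hDd : (((Z.image ν)ᶜ).image ν)ᶜ = Z := by
    rw [image_compl_bij hνb, compl_compl]
    ext t; rw [hνZ2]
  have hDs : (A (Z.image ν ∪ U)ᶜ : Set ((Fin n → F) × (Fin n → F))) ∩
      sympDual p (A (Z.image ν ∪ U)ᶜ : Set ((Fin n → F) × (Fin n → F))) = (A (Z.image ν)ᶜ : Set _) := by
    rw [hdual _ hV'cl, hVd, hinter]
    congr 2
    ext t
    simp only [Finset.mem_union, Finset.mem_compl]
    have h1 := hUνZ t
    have h2 : t ∈ Z → t ∉ Z.image ν := by
      intro hz h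
      obtain ⟨s, hs, rfl⟩ := Finset.mem_image.1 h
      exact hZdisj s hs hz
    exact prop_aux h1 h2
  have hDperp : sympDual p (A (Z.image ν)ᶜ : Set ((Fin n → F) × (Fin n → F))) = (A Z : Set _) := by
    rw [hdual _ hνZcl', hDd]
  have hcC : Nat.card (A (Z.image ν ∪ U)ᶜ) = q ^ (2 * (k + r)) := by
    rw [hcard _ hV'cl, Finset.card_compl, hVcard, ZMod.card]
    congr 2; have := hle (Z.image ν ∪ U); omega
  have hcD : Nat.card (A (Z.image ν)ᶜ) = q ^ (2 * k) := by
    rw [hcard _ hνZcl', Finset.card_compl, hνZcard, ZMod.card]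
    congr 2; omega
  have hcE : Nat.card (A Z) = q ^ (2 * (n - k)) := by rw [hcard _ hZcl, hZk]
  have hmem : ∀ a : ℕ, 1 ≤ a → a ≤ δ - 1 → (a : ZMod n) ∈ Z := fun a h1 h2 =>
    (hZm _).2 ⟨a, h1, h2, 0, by simp⟩
  have hnot : ∃ v ∈ A Z, v ∉ A (Z.image ν ∪ U)ᶜ := by
    by_contra! h
    have hle : Nat.card (A Z) ≤ Nat.card (A (Z.image ν ∪ U)ᶜ) :=
      Nat.card_mono (Set.toFinite _) h
    rw [hcC, hcE, Nat.pow_le_pow_iff_right (by omega)] at hle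
    omega
  obtain ⟨v0, hv0, hv0'⟩ := hnot
  refine ⟨minSwt ((A Z : Set ((Fin n → F) × (Fin n → F))) \ (A (Z.image ν ∪ U)ᶜ : Set _)), ?_,
    (A (Z.image ν ∪ U)ᶜ).toAddSubgroup, ?_, ?_, ?_, ?_⟩
  · unfold minSwt
    have hne : (swt '' (((A Z : Set ((Fin n → F) × (Fin n → F))) \
        (A (Z.image ν ∪ U)ᶜ : Set _)) \ {0})).Nonempty :=
      ⟨_, v0, ⟨⟨hv0, hv0'⟩, fun h => hv0' (by rw [Set.mem_singleton_iff.1 h]; exact zero_mem _)⟩, rfl⟩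
    obtain ⟨v, ⟨⟨hv, -⟩, hv2⟩, hv3⟩ := Nat.sInf_mem hne
    rw [← hv3]
    exact hdist Z δ hmem v hv hv2
  · rw [Submodule.coe_toAddSubgroup, hDs]
    change Nat.card (A (Z.image ν)ᶜ) * _ = _
    rw [hcD, ← pow_add, ← pow_add]
    congr 1; omega
  · change Nat.card (A (Z.image ν ∪ U)ᶜ) * _ = _
    rw [hcC, ← pow_add, ← pow_add]
    congr 1; omega
  · intro h
    rw [Submodule.coe_toAddSubgroup, hDs, hDperp] at h
    exact absurd (h ▸ hv0 : v0 ∈ (A (Z.image ν ∪ U)ᶜ : Set _)) hv0'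
  · intro _
    rw [Submodule.coe_toAddSubgroup, hDs, hDperp]
end

section
/- Trading co-subsystem dimension for subsystem dimension: Let q be a power of a prime p. If there exists a pure ((n,K,R,d))_q Clifford subsystem code with R > 1, then there exists a pure ((n, pK, R/p, d))_q Clifford subsystem code with the same minimum distance d. -/
open Finset

section abstractForm

variable {p : ℕ} [Fact p.Prime] {V : Type} [AddCommGroup V]

/-- Vectors of `A` annihilated by the functional `f`. -/
def cutBy (A : AddSubgroup V) (f : V →+ ZMod p) : AddSubgroup V := A ⊓ f.ker

lemma mem_cutBy (A : AddSubgroup V) (f : V →+ ZMod p) (v : V) :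
    v ∈ cutBy A f ↔ v ∈ A ∧ f v = 0 := by
  simp [cutBy, AddSubgroup.mem_inf, AddMonoidHom.mem_ker]

lemma exists_cancel (f : V →+ ZMod p) {z : V} (hz : f z ≠ 0) (v : V) :
    ∃ k : ℕ, f (v - k • z) = 0 := by
  refine ⟨(f v / f z).val, ?_⟩
  rw [map_sub, map_nsmul, nsmul_eq_mul, ZMod.natCast_zmod_val, div_mul_cancel₀ _ hz, sub_self]

lemma card_cutBy (A : AddSubgroup V) (f : V →+ ZMod p) {z : V} (hzA : z ∈ A) (hz : f z ≠ 0) :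
    Nat.card A = p * Nat.card (cutBy A f) := by
  let g : A →+ ZMod p := f.comp A.subtype
  have hsurj : Function.Surjective g := by
    intro c
    refine ⟨(c / f z).val • ⟨z, hzA⟩, ?_⟩
    rw [map_nsmul, nsmul_eq_mul, ZMod.natCast_zmod_val]
    exact div_mul_cancel₀ _ hz
  have h1 := AddSubgroup.card_eq_card_quotient_mul_card_addSubgroup g.ker
  have h2 : Nat.card (A ⧸ g.ker) = p := by
    rw [Nat.card_congr (QuotientAddGroup.quotientKerEquivOfSurjective g hsurj).toEquiv,
      Nat.card_zmod]
  have h3 : Nat.card g.ker = Nat.card (cutBy A f) := by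
    refine Nat.card_congr
      ⟨fun v => ⟨v.1.1, (mem_cutBy _ _ _).2 ⟨v.1.2, v.2⟩⟩,
       fun v => ⟨⟨v.1, ((mem_cutBy _ _ _).1 v.2).1⟩, ((mem_cutBy _ _ _).1 v.2).2⟩, ?_, ?_⟩
    · intro v; rfl
    · intro v; rfl
  rw [h1, h2, h3]

end abstractForm

section form

variable (p : ℕ) [Fact p.Prime] {F : Type} [Field F] [Fintype F] [CharP F p] {n : ℕ}

/-- The functional `u ↦ ⟨u|v⟩`. -/
noncomputable def rightForm (v : (Fin n → F) × (Fin n → F)) :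
    ((Fin n → F) × (Fin n → F)) →+ ZMod p where
  toFun u := trSympForm p u v
  map_zero' := by simp [trSympForm]
  map_add' u u' := by
    unfold trSympForm
    rw [← map_add, ← Finset.sum_add_distrib]
    congr 1
    apply Finset.sum_congr rfl
    intro i _
    simp only [Prod.fst_add, Prod.snd_add, Pi.add_apply]
    ring

lemma rightForm_apply (u v : (Fin n → F) × (Fin n → F)) :
    rightForm p v u = trSympForm p u v := rfl

lemma form_swap (u v : (Fin n → F) × (Fin n → F)) :
    trSympForm p u v = - trSympForm p v u := by
  unfold trSympForm
  rw [← map_neg, ← Finset.sum_neg_distrib]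
  congr 1
  apply Finset.sum_congr rfl
  intro i _
  ring

lemma form_zero_comm {u v : (Fin n → F) × (Fin n → F)} :
    trSympForm p u v = 0 ↔ trSympForm p v u = 0 := by
  rw [form_swap p u v, neg_eq_zero]

lemma form_self (u : (Fin n → F) × (Fin n → F)) : trSympForm p u u = 0 := by
  unfold trSympForm
  have : ∑ i, (u.1 i * u.2 i - u.1 i * u.2 i) = (0 : F) := by simp
  rw [this, map_zero]

lemma form_sub (u u' v : (Fin n → F) × (Fin n → F)) :
    trSympForm p (u - u') v = trSympForm p u v - trSympForm p u' v :=
  map_sub (rightForm p v) u u'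

lemma form_nsmul (k : ℕ) (u v : (Fin n → F) × (Fin n → F)) :
    trSympForm p (k • u) v = (k : ZMod p) * trSympForm p u v := by
  rw [← nsmul_eq_mul]
  exact map_nsmul (rightForm p v) k u

lemma form_sub_r (u v v' : (Fin n → F) × (Fin n → F)) :
    trSympForm p u (v - v') = trSympForm p u v - trSympForm p u v' := by
  rw [form_swap, form_sub, form_swap p v, form_swap p v']; ring

lemma form_nsmul_r (k : ℕ) (u v : (Fin n → F) × (Fin n → F)) :
    trSympForm p u (k • v) = (k : ZMod p) * trSympForm p u v := by
  rw [form_swap, form_nsmul, form_swap p v]; ring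

lemma exists_cancel_l {z x : (Fin n → F) × (Fin n → F)} (hz : trSympForm p z x ≠ 0)
    (v : (Fin n → F) × (Fin n → F)) : ∃ k : ℕ, trSympForm p (v - k • z) x = 0 :=
  exists_cancel (rightForm p x) hz v

lemma exists_weight_one {x : (Fin n → F) × (Fin n → F)} (hx : x ≠ 0) :
    ∃ (z : (Fin n → F) × (Fin n → F)) (i : Fin n),
      (∀ j, j ≠ i → z.1 j = 0 ∧ z.2 j = 0) ∧ trSympForm p z x ≠ 0 := by
  letI := ZMod.algebra F p
  have key : ∀ a : F, a ≠ 0 → ∃ b : F, Algebra.trace (ZMod p) F (a * b) ≠ 0 := by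
    intro a ha
    have hp : p = ringChar F := (ringChar.eq F p).symm
    subst hp
    exact FiniteField.trace_to_zmod_nondegenerate F ha
  by_cases h1 : x.1 = 0
  · have h2 : x.2 ≠ 0 := fun h2 => hx (Prod.ext h1 h2)
    obtain ⟨i, hi⟩ := Function.ne_iff.1 h2
    obtain ⟨b, hb⟩ := key (x.2 i) hi
    refine ⟨(Pi.single i b, 0), i, fun j hj => by simp [hj], ?_⟩
    have : ∑ j, (x.1 j * (0 : Fin n → F) j - (Pi.single i b : Fin n → F) j * x.2 j)
        = - (x.2 i * b) := by
      rw [Finset.sum_eq_single i]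
      · simp; ring
      · intro j _ hj; simp [hj]
      · simp
    unfold trSympForm
    rw [this, map_neg]
    exact neg_ne_zero.2 hb
  · obtain ⟨i, hi⟩ := Function.ne_iff.1 h1
    obtain ⟨b, hb⟩ := key (x.1 i) hi
    refine ⟨(0, Pi.single i b), i, fun j hj => by simp [hj], ?_⟩
    have : ∑ j, (x.1 j * (Pi.single i b : Fin n → F) j - (0 : Fin n → F) j * x.2 j)
        = x.1 i * b := by
      rw [Finset.sum_eq_single i]
      · simp
      · intro j _ hj; simp [hj]
      · simp
    unfold trSympForm
    rw [this]
    exact hb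

lemma swt_sub_le (v z : (Fin n → F) × (Fin n → F)) (i : Fin n)
    (hz : ∀ j, j ≠ i → z.1 j = 0 ∧ z.2 j = 0) (k : ℕ) : swt (v - k • z) ≤ swt v + 1 := by
  unfold swt
  refine le_trans (Set.ncard_le_ncard (t := insert i {j | ¬(v.1 j = 0 ∧ v.2 j = 0)}) ?_
    (Set.toFinite _)) (Set.ncard_insert_le _ _)
  intro j hj
  by_cases hji : j = i
  · exact Or.inl hji
  · right
    simpa [hz j hji] using hj

lemma minSwt_eq {S : Set ((Fin n → F) × (Fin n → F))} {d : ℕ}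
    (h : ∀ v ∈ S, v ≠ 0 → d ≤ swt v) {v : (Fin n → F) × (Fin n → F)} (hv : v ∈ S)
    (hv0 : v ≠ 0) (hd : swt v = d) : d = minSwt S := by
  apply le_antisymm
  · unfold minSwt
    refine le_csInf (s := swt '' (S \ {0})) ⟨swt v, v, ⟨hv, hv0⟩, rfl⟩ ?_
    rintro _ ⟨u, hu, rfl⟩
    exact h u hu.1 hu.2
  · exact Nat.sInf_le ⟨v, ⟨hv, hv0⟩, hd⟩

lemma minSwt_le {S : Set ((Fin n → F) × (Fin n → F))} {v : (Fin n → F) × (Fin n → F)}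
    (hv : v ∈ S) (hv0 : v ≠ 0) : minSwt S ≤ swt v :=
  Nat.sInf_le ⟨v, ⟨hv, hv0⟩, rfl⟩

lemma exists_minSwt {S : Set ((Fin n → F) × (Fin n → F))} {v : (Fin n → F) × (Fin n → F)}
    (hv : v ∈ S) (hv0 : v ≠ 0) : ∃ u ∈ S, u ≠ 0 ∧ swt u = minSwt S := by
  obtain ⟨u, hu, h⟩ := Nat.sInf_mem (s := swt '' (S \ {0})) ⟨_, Set.mem_image_of_mem _ ⟨hv, hv0⟩⟩
  exact ⟨u, hu.1, hu.2, h⟩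

/-- The radical `C ∩ C^⊥`. -/
def radC (C : AddSubgroup ((Fin n → F) × (Fin n → F))) : Set ((Fin n → F) × (Fin n → F)) :=
  ↑C ∩ sympDual p ↑C

lemma mem_dual (S : Set ((Fin n → F) × (Fin n → F))) (v : (Fin n → F) × (Fin n → F)) :
    v ∈ sympDual p S ↔ ∀ w ∈ S, trSympForm p v w = 0 := Iff.rfl

lemma le_dual_rad (C : AddSubgroup ((Fin n → F) × (Fin n → F))) {v} (hv : v ∈ C) :
    v ∈ sympDual p (radC p C) :=
  fun w hw => (form_zero_comm p).2 (hw.2 v hv)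

/-- Splitting off a hyperbolic pair. -/
lemma split_pair (C : AddSubgroup ((Fin n → F) × (Fin n → F))) (K R d : ℕ) (hR : 1 < R)
    (h1 : Nat.card (radC p C) * (K * R) = Fintype.card F ^ n)
    (h2 : Nat.card C * K = Fintype.card F ^ n * R)
    {x w : (Fin n → F) × (Fin n → F)} (hx : x ∈ C) (hw : w ∈ C) (hxw : trSympForm p x w ≠ 0)
    (hd : ∀ v ∈ sympDual p (radC p C), v ≠ 0 → d ≤ swt v)
    {v₀ : (Fin n → F) × (Fin n → F)} (hv₀ : v₀ ∈ sympDual p (radC p C)) (hv₀0 : v₀ ≠ 0)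
    (hv₀d : swt v₀ = d) (hv₀C : v₀ ∉ C ∨ v₀ = x) :
    ∃ C : AddSubgroup ((Fin n → F) × (Fin n → F)),
      IsSubsysCode p C (p * K) (R / p) d ∧ PureTo C d := by
  have hwx : trSympForm p w x ≠ 0 := fun h => hxw ((form_zero_comm p).1 h)
  let C₁ := cutBy C (rightForm p x)
  let C₂ := cutBy C₁ (rightForm p w)
  have mem₁ : ∀ v, v ∈ C₁ ↔ v ∈ C ∧ trSympForm p v x = 0 := fun v => mem_cutBy _ _ _
  have mem₂ : ∀ v, v ∈ C₂ ↔ (v ∈ C ∧ trSympForm p v x = 0) ∧ trSympForm p v w = 0 := by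
    intro v
    rw [← mem₁]
    exact mem_cutBy _ _ _
  have c₁ : Nat.card C = p * Nat.card C₁ := card_cutBy C (rightForm p x) hw hwx
  have c₂ : Nat.card C₁ = p * Nat.card C₂ :=
    card_cutBy C₁ (rightForm p w) ((mem₁ x).2 ⟨hx, form_self p x⟩) hxw
  have hrad : radC p C₂ = radC p C := by
    ext v
    constructor
    · rintro ⟨hv, hv'⟩
      have hv1 := (mem₂ v).1 hv
      refine ⟨hv1.1.1, fun e he => ?_⟩
      obtain ⟨k, hk⟩ := exists_cancel_l p hwx e
      obtain ⟨l, hl⟩ := exists_cancel_l p hxw (e - k • w)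
      have hmem : e - k • w - l • x ∈ C₂ := by
        refine (mem₂ _).2 ⟨⟨C.sub_mem (C.sub_mem he (C.nsmul_mem hw k)) (C.nsmul_mem hx l), ?_⟩, hl⟩
        rw [form_sub, hk, form_nsmul, form_self]; simp
      have h := hv' _ hmem
      rwa [form_sub_r, form_sub_r, form_nsmul_r, form_nsmul_r, hv1.1.2, hv1.2, mul_zero, mul_zero,
        sub_zero, sub_zero] at h
    · rintro ⟨hv, hv'⟩
      exact ⟨(mem₂ v).2 ⟨⟨hv, hv' x hx⟩, hv' w hw⟩, fun e he => hv' e ((mem₂ e).1 he).1.1⟩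
  have hpp : p.Prime := Fact.out
  have hpR : p ∣ R := by
    letI := ZMod.algebra F p
    have hq : Fintype.card F ^ n ∣ p ^ (Module.finrank (ZMod p) F * n) := by
      rw [Module.card_eq_pow_finrank (K := ZMod p) (V := F), ZMod.card, pow_mul]
    have hRd : R ∣ p ^ (Module.finrank (ZMod p) F * n) :=
      dvd_trans ⟨Nat.card (radC p C) * K, by rw [← h1]; ring⟩ hq
    obtain ⟨m, _, hm⟩ := (Nat.dvd_prime_pow hpp).1 hRd
    rw [hm]
    apply dvd_pow_self
    rintro rfl
    simp at hm
    omega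
  obtain ⟨R', rfl⟩ := hpR
  have hdiv : p * R' / p = R' := Nat.mul_div_cancel_left _ hpp.pos
  have hxC₂ : x ∉ C₂ := fun h => hxw ((mem₂ x).1 h).2
  have hne : sympDual p (radC p C₂) ≠ ↑C₂ := by
    intro h
    apply hxC₂
    have : x ∈ sympDual p (radC p C₂) := by rw [hrad]; exact le_dual_rad p C hx
    rwa [h] at this
  refine ⟨C₂, ⟨?_, ?_, fun h => absurd h hne, fun _ => ?_⟩, ?_⟩
  · change Nat.card (radC p C₂) * _ = _
    rw [hrad, hdiv, ← h1]; ring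
  · rw [hdiv]
    apply Nat.eq_of_mul_eq_mul_left hpp.pos
    rw [c₁, c₂] at h2
    calc _ = p * (p * Nat.card C₂) * K := by ring
      _ = _ := by rw [h2]; ring
  · change d = minSwt (sympDual p (radC p C₂) \ ↑C₂)
    rw [hrad]
    refine minSwt_eq (fun v hv => hd v hv.1) ⟨hv₀, ?_⟩ hv₀0 hv₀d
    rcases hv₀C with h | rfl
    · exact fun h' => h ((mem₂ _).1 h').1.1
    · exact hxC₂
  · intro v hv
    exact hd v (le_dual_rad p C ((mem₂ v).1 hv).1.1)

/-- If all minimum weight vectors of `C = D^⊥` lie in `D`, exchange `D` for another code. -/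
lemma exchange (C : AddSubgroup ((Fin n → F) × (Fin n → F))) (d : ℕ)
    (hC : sympDual p (radC p C) = ↑C)
    (hd : ∀ v ∈ C, v ≠ 0 → d ≤ swt v)
    {x u : (Fin n → F) × (Fin n → F)} (hx : x ∈ radC p C) (hx0 : x ≠ 0)
    (hu : u ∈ C) (huD : u ∉ radC p C)
    (hmin : ∀ v ∈ C, v ∉ radC p C → d + 1 ≤ swt v) :
    ∃ C₁ : AddSubgroup ((Fin n → F) × (Fin n → F)), sympDual p (radC p C₁) = ↑C₁ ∧
      Nat.card C₁ = Nat.card C ∧ Nat.card (radC p C₁) = Nat.card (radC p C) ∧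
      (∀ v ∈ C₁, v ≠ 0 → d ≤ swt v) ∧ x ∈ C₁ ∧ ∃ w ∈ C₁, trSympForm p x w ≠ 0 := by
  obtain ⟨z, i, hzi, hzx⟩ := exists_weight_one p hx0
  have hxz : trSympForm p x z ≠ 0 := fun h => hzx ((form_zero_comm p).1 h)
  -- the element y
  obtain ⟨y, hyC, hyD, hyz⟩ : ∃ y ∈ C, y ∉ radC p C ∧ trSympForm p y z ≠ 0 := by
    by_cases h : trSympForm p u z = 0
    · refine ⟨u - x, C.sub_mem hu hx.1, fun h' => huD ⟨hu, fun e he => ?_⟩, ?_⟩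
      · have := h'.2 e he
        rwa [form_sub, hx.2 e he, sub_zero] at this
      · rw [form_sub, h, zero_sub]; exact neg_ne_zero.2 hxz
    · exact ⟨u, hu, huD, h⟩
  have hzy : trSympForm p z y ≠ 0 := fun h => hyz ((form_zero_comm p).1 h)
  obtain ⟨t, htC, hyt⟩ : ∃ t ∈ C, trSympForm p y t ≠ 0 := by
    by_contra! h
    exact hyD ⟨hyC, h⟩
  have hty : trSympForm p t y ≠ 0 := fun h => hyt ((form_zero_comm p).1 h)
  -- D as a subgroup
  let D : AddSubgroup ((Fin n → F) × (Fin n → F)) :=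
    { carrier := radC p C
      zero_mem' := ⟨C.zero_mem, fun e _ => map_zero (rightForm p e)⟩
      add_mem' := fun {a b} ha hb => ⟨C.add_mem ha.1 hb.1, fun e he => by
        have := map_add (rightForm p e) a b
        simp only [rightForm_apply] at this
        rw [this, ha.2 e he, hb.2 e he, add_zero]⟩
      neg_mem' := fun {a} ha => ⟨C.neg_mem ha.1, fun e he => by
        have := map_neg (rightForm p e) a
        simp only [rightForm_apply] at this
        rw [this, ha.2 e he, neg_zero]⟩ }
  have memD : ∀ v, v ∈ D ↔ v ∈ radC p C := fun v => Iff.rfl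
  let D₀ := cutBy D (rightForm p z)
  have memD₀ : ∀ v, v ∈ D₀ ↔ v ∈ radC p C ∧ trSympForm p v z = 0 := fun v => mem_cutBy _ _ _
  -- E = D₀^⊥
  let E : AddSubgroup ((Fin n → F) × (Fin n → F)) :=
    { carrier := {v | ∀ e ∈ D₀, trSympForm p v e = 0}
      zero_mem' := fun e _ => map_zero (rightForm p e)
      add_mem' := fun {a b} ha hb e he => by
        have := map_add (rightForm p e) a b
        simp only [rightForm_apply] at this
        rw [this, ha e he, hb e he, add_zero]
      neg_mem' := fun {a} ha e he => by
        have := map_neg (rightForm p e) a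
        simp only [rightForm_apply] at this
        rw [this, ha e he, neg_zero] }
  have memE : ∀ v, v ∈ E ↔ ∀ e ∈ D₀, trSympForm p v e = 0 := fun v => Iff.rfl
  have hCE : ∀ v ∈ C, v ∈ E := fun v hv e he =>
    (form_zero_comm p).1 (((memD₀ e).1 he).1.2 v hv)
  have hzE : z ∈ E := fun e he => (form_zero_comm p).1 ((memD₀ e).1 he).2
  have hEx : ∀ v ∈ E, trSympForm p v x = 0 → v ∈ C := by
    intro v hv hvx
    have : v ∈ sympDual p (radC p C) := by
      intro a ha
      obtain ⟨k, hk⟩ := exists_cancel_l p hxz a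
      have h := hv (a - k • x) ((memD₀ _).2 ⟨D.sub_mem ha (D.nsmul_mem hx k), hk⟩)
      rwa [form_sub_r, form_nsmul_r, hvx, mul_zero, sub_zero] at h
    rw [hC] at this
    exact this
  have cutE : cutBy E (rightForm p x) = C := by
    ext v
    rw [mem_cutBy]
    exact ⟨fun h => hEx v h.1 h.2, fun h => ⟨hCE v h, (form_zero_comm p).1 (hx.2 v h)⟩⟩
  let C₁ := cutBy E (rightForm p y)
  have memC₁ : ∀ v, v ∈ C₁ ↔ v ∈ E ∧ trSympForm p v y = 0 := fun v => mem_cutBy _ _ _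
  have hpp : p.Prime := Fact.out
  have cardC : Nat.card C₁ = Nat.card C := by
    have a1 := card_cutBy E (rightForm p x) hzE hzx
    have a2 := card_cutBy E (rightForm p y) hzE hzy
    rw [cutE] at a1
    exact Nat.eq_of_mul_eq_mul_left hpp.pos (a2.symm.trans a1)
  have hD₀E : ∀ v ∈ D₀, v ∈ C₁ := fun v hv =>
    (memC₁ v).2 ⟨hCE v ((memD₀ v).1 hv).1.1, ((memD₀ v).1 hv).1.2 y hyC⟩
  have hyC₁ : y ∈ C₁ := (memC₁ y).2 ⟨hCE y hyC, form_self p y⟩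
  have hxC₁ : x ∈ C₁ := (memC₁ x).2 ⟨hCE x hx.1, hx.2 y hyC⟩
  have hyrad : y ∈ radC p C₁ := ⟨hyC₁, fun e he => (form_zero_comm p).1 ((memC₁ e).1 he).2⟩
  have hD₀rad : ∀ v ∈ D₀, v ∈ radC p C₁ := fun v hv =>
    ⟨hD₀E v hv, fun e he => (form_zero_comm p).1 (((memC₁ e).1 he).1 v hv)⟩
  have hradD₀ : ∀ v ∈ radC p C₁, trSympForm p v z = 0 → v ∈ D₀ := by
    intro v hv hvz
    have hvC : v ∈ C := hEx v ((memC₁ v).1 hv.1).1 (hv.2 x hxC₁)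
    refine (memD₀ v).2 ⟨⟨hvC, fun e he => ?_⟩, hvz⟩
    obtain ⟨k, hk⟩ := exists_cancel_l p hzy e
    have h := hv.2 (e - k • z) ((memC₁ _).2 ⟨E.sub_mem (hCE e he) (E.nsmul_mem hzE k), hk⟩)
    rwa [form_sub_r, form_nsmul_r, hvz, mul_zero, sub_zero] at h
  let D₁ : AddSubgroup ((Fin n → F) × (Fin n → F)) :=
    { carrier := radC p C₁
      zero_mem' := ⟨C₁.zero_mem, fun e _ => map_zero (rightForm p e)⟩
      add_mem' := fun {a b} ha hb => ⟨C₁.add_mem ha.1 hb.1, fun e he => by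
        have := map_add (rightForm p e) a b
        simp only [rightForm_apply] at this
        rw [this, ha.2 e he, hb.2 e he, add_zero]⟩
      neg_mem' := fun {a} ha => ⟨C₁.neg_mem ha.1, fun e he => by
        have := map_neg (rightForm p e) a
        simp only [rightForm_apply] at this
        rw [this, ha.2 e he, neg_zero]⟩ }
  have cutD : cutBy D₁ (rightForm p z) = D₀ := by
    ext v
    rw [mem_cutBy]
    exact ⟨fun h => hradD₀ v h.1 h.2, fun h => ⟨hD₀rad v h, ((memD₀ v).1 h).2⟩⟩
  have cardD : Nat.card D₁ = Nat.card D := by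
    rw [card_cutBy D₁ (rightForm p z) hyrad hyz, cutD,
      card_cutBy D (rightForm p z) (z := x) hx hxz]
  refine ⟨C₁, ?_, cardC, cardD, ?_, hxC₁, ?_⟩
  · ext v
    constructor
    · intro hv
      exact (memC₁ v).2 ⟨fun e he => hv e (hD₀rad e he), hv y hyrad⟩
    · intro hv
      exact le_dual_rad p C₁ hv
  · intro v hv hv0
    obtain ⟨hvE, hvy⟩ := (memC₁ v).1 hv
    by_cases hvx : trSympForm p v x = 0
    · exact hd v (hEx v hvE hvx) hv0
    · obtain ⟨k, hk⟩ := exists_cancel_l p hzx v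
      have haC : v - k • z ∈ C := hEx _ (E.sub_mem hvE (E.nsmul_mem hzE k)) hk
      have hkz : (k : ZMod p) ≠ 0 := by
        intro h0
        rw [form_sub, form_nsmul, h0, zero_mul, sub_zero] at hk
        exact hvx hk
      have haD : v - k • z ∉ radC p C := by
        intro h
        have := h.2 y hyC
        rw [form_sub, form_nsmul, hvy, zero_sub, neg_eq_zero] at this
        exact mul_ne_zero hkz hzy this
      have := hmin _ haC haD
      have := swt_sub_le v z i hzi k
      omega
  · obtain ⟨k, hk⟩ := exists_cancel_l p hty z
    refine ⟨z - k • t, (memC₁ _).2 ⟨E.sub_mem hzE (E.nsmul_mem (hCE t htC) k), hk⟩, ?_⟩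
    rw [form_sub_r, form_nsmul_r, hx.2 t htC, mul_zero, sub_zero]
    exact hxz

end form

/-- Trading co-subsystem dimension for subsystem dimension.
If there exists a pure `((n,K,R,d))_q` Clifford subsystem code with `R > 1`,
then there exists a pure `((n, pK, R/p, d))_q` Clifford subsystem code with the
same minimum distance `d`. -/
theorem trade_cosubsystem_for_subsystem
    (p : ℕ) (hp : p.Prime) (F : Type) [Field F] [Fintype F] [CharP F p]
    (n K R d : ℕ) (hR : 1 < R)
    (h : ∃ C : AddSubgroup ((Fin n → F) × (Fin n → F)),
      IsSubsysCode p C K R d ∧ PureTo C d) :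
    ∃ C : AddSubgroup ((Fin n → F) × (Fin n → F)),
      IsSubsysCode p C (p * K) (R / p) d ∧ PureTo C d := by
  haveI : Fact p.Prime := ⟨hp⟩
  obtain ⟨C, ⟨h1, h2, h3, h4⟩, hpure⟩ := h
  change Nat.card (radC p C) * (K * R) = Fintype.card F ^ n at h1
  change sympDual p (radC p C) = ↑C → d = minSwt (sympDual p (radC p C)) at h3
  change sympDual p (radC p C) ≠ ↑C → d = minSwt (sympDual p (radC p C) \ ↑C) at h4
  -- `C` is not isotropic
  obtain ⟨u, huC, w, hwC, huw⟩ : ∃ u ∈ C, ∃ w ∈ C, trSympForm p u w ≠ 0 := by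
    by_contra! hiso
    have hrad : radC p C = ↑C := by
      ext v
      exact ⟨fun hv => hv.1, fun hv => ⟨hv, hiso v hv⟩⟩
    rw [hrad] at h1
    have hq : 0 < Fintype.card F ^ n := pow_pos Fintype.card_pos n
    have h1' : Nat.card C * (K * R) = Fintype.card F ^ n := h1
    have : Fintype.card F ^ n * (R * R) = Fintype.card F ^ n * 1 := by
      rw [← mul_assoc, ← h2, mul_one, ← h1']; ring
    have := Nat.eq_of_mul_eq_mul_left hq this
    nlinarith
  have hu0 : u ≠ 0 := by
    rintro rfl
    exact huw (map_zero (rightForm p w))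
  by_cases hC : sympDual p (radC p C) = ↑C
  · have hd := h3 hC
    have hlow : ∀ v ∈ sympDual p (radC p C), v ≠ 0 → d ≤ swt v := by
      intro v hv hv0
      rw [hd]
      exact minSwt_le hv hv0
    by_cases hcase : ∃ x ∈ C, x ∉ radC p C ∧ swt x = d
    · obtain ⟨x, hx, hxD, hxd⟩ := hcase
      obtain ⟨w', hw', hxw'⟩ : ∃ w' ∈ C, trSympForm p x w' ≠ 0 := by
        by_contra! h
        exact hxD ⟨hx, h⟩
      have hx0 : x ≠ 0 := by
        rintro rfl
        exact hxw' (map_zero (rightForm p w'))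
      exact split_pair p C K R d hR h1 h2 hx hw' hxw' hlow (le_dual_rad p C hx) hx0 hxd
        (Or.inr rfl)
    · push Not at hcase
      obtain ⟨x, hx, hx0, hxd⟩ := exists_minSwt (le_dual_rad p C huC) hu0
      rw [← hd] at hxd
      rw [hC] at hx hlow
      have hxD : x ∈ radC p C := by
        by_contra h
        exact hcase x hx h hxd
      obtain ⟨C₁, e1, e2, e3, e4, hx1, w', hw', hxw'⟩ := exchange p C d hC hlow hxD hx0 huC
        (fun h => huw (h.2 w hwC)) (by
          intro v hv hvD
          have hv0 : v ≠ 0 := by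
            rintro rfl
            exact hvD ⟨hv, fun e _ => map_zero (rightForm p e)⟩
          have h5 := hlow v hv hv0
          have h6 := hcase v hv hvD
          omega)
      exact split_pair p C₁ K R d hR (by rw [e3, h1]) (by rw [e2, h2]) hx1 hw' hxw'
        (by rw [e1]; exact e4) (le_dual_rad p C₁ hx1) hx0 hxd (Or.inr rfl)
  · have hd := h4 hC
    obtain ⟨v, hv, hvC⟩ : ∃ v ∈ sympDual p (radC p C), v ∉ C := by
      by_contra! h
      exact hC (Set.Subset.antisymm h (fun v hv => le_dual_rad p C hv))
    have hv0 : v ≠ 0 := by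
      rintro rfl
      exact hvC C.zero_mem
    obtain ⟨v₀, hv₀, hv₀0, hv₀d⟩ :=
      exists_minSwt (S := sympDual p (radC p C) \ ↑C) ⟨hv, hvC⟩ hv0
    rw [← hd] at hv₀d
    refine split_pair p C K R d hR h1 h2 huC hwC huw ?_ hv₀.1 hv₀0 hv₀d (Or.inl hv₀.2)
    intro a ha ha0
    by_cases haC : a ∈ C
    · exact hpure a haC ha0
    · rw [hd]
      exact minSwt_le ⟨ha, haC⟩ ha0
end

section
/- F_q-linear trading of co-subsystem dimension for subsystem dimension: Let q be a power of a prime p. If there exists a pure F_q-linear [[n,k,r,d]]_q Clifford subsystem code with r > 0, then there exists a pure F_q-linear [[n, k+1, r−1, d]]_q Clifford subsystem code with the same minimum distance d. -/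
open Finset

section Aux

open LinearMap (BilinForm)

/-- The (untraced) symplectic form as a bilinear form. -/
noncomputable def sForm (F : Type) [Field F] (n : ℕ) :
    BilinForm F ((Fin n → F) × (Fin n → F)) :=
  LinearMap.mk₂ F (fun u v => ∑ i, (v.1 i * u.2 i - u.1 i * v.2 i))
    (by intro a b c; rw [← Finset.sum_add_distrib]
        refine Finset.sum_congr rfl fun i _ => ?_
        simp; ring)
    (by intro a b c; rw [smul_eq_mul, Finset.mul_sum]
        refine Finset.sum_congr rfl fun i _ => ?_
        simp; ring)
    (by intro a b c; rw [← Finset.sum_add_distrib]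
        refine Finset.sum_congr rfl fun i _ => ?_
        simp; ring)
    (by intro a b c; rw [smul_eq_mul, Finset.mul_sum]
        refine Finset.sum_congr rfl fun i _ => ?_
        simp; ring)

theorem sForm_apply (F : Type) [Field F] (n : ℕ) (u v : (Fin n → F) × (Fin n → F)) :
    sForm F n u v = ∑ i, (v.1 i * u.2 i - u.1 i * v.2 i) := rfl

theorem sForm_alt (F : Type) [Field F] (n : ℕ) (u : (Fin n → F) × (Fin n → F)) :
    sForm F n u u = 0 := by
  rw [sForm_apply]; simp

theorem sForm_neg (F : Type) [Field F] (n : ℕ) (u v : (Fin n → F) × (Fin n → F)) :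
    sForm F n u v = - sForm F n v u := by
  rw [sForm_apply, sForm_apply, ← Finset.sum_neg_distrib]
  refine Finset.sum_congr rfl fun i _ => ?_
  ring

theorem sForm_refl (F : Type) [Field F] (n : ℕ) : (sForm F n).IsRefl := by
  intro u v h
  rw [sForm_neg, h, neg_zero]

/-- A weight one vector not orthogonal to a given nonzero vector. -/
theorem exists_single (F : Type) [Field F] (n : ℕ) (v : (Fin n → F) × (Fin n → F)) (hv : v ≠ 0) :
    ∃ (e : (Fin n → F) × (Fin n → F)) (i : Fin n),
      (∀ j, j ≠ i → e.1 j = 0 ∧ e.2 j = 0) ∧ sForm F n e v ≠ 0 := by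
  by_cases h1 : ∃ i, v.1 i ≠ 0
  · obtain ⟨i, hi⟩ := h1
    refine ⟨(0, Pi.single i 1), i, fun j hj => ⟨rfl, by simp [hj]⟩, ?_⟩
    rw [sForm_apply]
    simpa [Pi.single_apply] using hi
  · by_cases h2 : ∃ i, v.2 i ≠ 0
    · obtain ⟨i, hi⟩ := h2
      refine ⟨(Pi.single i 1, 0), i, fun j hj => ⟨by simp [hj], rfl⟩, ?_⟩
      rw [sForm_apply]
      simpa [Pi.single_apply] using hi
    · push Not at h1 h2
      exact absurd (Prod.ext (funext h1) (funext h2)) hv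

theorem sForm_nondeg (F : Type) [Field F] (n : ℕ) : (sForm F n).Nondegenerate := by
  constructor
  · intro v hv
    by_contra h
    obtain ⟨e, i, -, he⟩ := exists_single F n v h
    exact he (by rw [sForm_neg, hv, neg_zero])
  · intro v hv
    by_contra h
    obtain ⟨e, i, -, he⟩ := exists_single F n v h
    exact he (hv e)

theorem swt_add_single {F : Type} [Field F] {n : ℕ} (y e : (Fin n → F) × (Fin n → F)) (i : Fin n)
    (he : ∀ j, j ≠ i → e.1 j = 0 ∧ e.2 j = 0) : swt y ≤ swt (y + e) + 1 := by
  unfold swt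
  refine (Set.ncard_le_ncard (t := insert i {j | ¬((y + e).1 j = 0 ∧ (y + e).2 j = 0)}) ?_
    (Set.toFinite _)).trans (Set.ncard_insert_le _ _)
  intro j hj
  by_cases hji : j = i
  · exact Or.inl hji
  · right
    obtain ⟨h1, h2⟩ := he j hji
    simpa [h1, h2] using hj

theorem finrank_inf_ker {F V : Type} [Field F] [AddCommGroup V] [Module F V] [Module.Finite F V]
    (W : Submodule F V) (f : V →ₗ[F] F) (z : V) (hz : z ∈ W) (hf : f z ≠ 0) :
    Module.finrank F (W ⊓ LinearMap.ker f : Submodule F V) + 1 = Module.finrank F W := by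
  have hnot : z ∉ W ⊓ LinearMap.ker f := fun h => hf h.2
  rw [← Submodule.finrank_sup_span_singleton hnot]
  suffices h : (W ⊓ LinearMap.ker f) ⊔ Submodule.span F {z} = W by rw [h]
  apply le_antisymm
  · refine sup_le inf_le_left ?_
    rw [Submodule.span_singleton_le_iff_mem]; exact hz
  · intro y hy
    rw [Submodule.mem_sup]
    refine ⟨y - (f y / f z) • z, ⟨W.sub_mem hy (W.smul_mem _ hz), ?_⟩, (f y / f z) • z,
      Submodule.mem_span_singleton.2 ⟨_, rfl⟩, by simp⟩
    rw [SetLike.mem_coe, LinearMap.mem_ker]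
    simp [hf]

/-- Trace-symplectic dual of a linear code is its symplectic dual. -/
theorem sympDual_submodule (p : ℕ) (hp : p.Prime) (F : Type) [Field F] [Fintype F] [CharP F p]
    (n : ℕ) (W : Submodule F ((Fin n → F) × (Fin n → F))) :
    sympDual p (W : Set ((Fin n → F) × (Fin n → F))) = ((sForm F n).orthogonal W : Set _) := by
  have : Fact p.Prime := ⟨hp⟩
  letI := ZMod.algebra F p
  have key : ∀ u v, trSympForm p u v = Algebra.trace (ZMod p) F (sForm F n u v) := fun _ _ => rfl
  ext v
  constructor
  · intro h
    change v ∈ (sForm F n).orthogonal W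
    rw [LinearMap.BilinForm.mem_orthogonal_iff]
    intro w hw
    rw [sForm_neg, neg_eq_zero]
    refine (traceForm_nondegenerate (ZMod p) F).1 _ fun a => ?_
    rw [Algebra.traceForm_apply]
    have := h (a • w) (W.smul_mem a hw)
    rw [key, map_smul, smul_eq_mul, mul_comm] at this
    exact this
  · intro h w hw
    have h' : sForm F n w v = 0 := h w hw
    rw [key, sForm_neg, h', neg_zero, map_zero]

/-- The final step: drop a hyperbolic pair. -/
theorem drop_pair (p : ℕ) (hp : p.Prime) (F : Type) [Field F] [Fintype F] [CharP F p]
    (n k r d : ℕ) (hr : 0 < r) (W : Submodule F ((Fin n → F) × (Fin n → F)))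
    (h1 : Module.finrank F W + k = n + r)
    (h2 : Module.finrank F (W ⊓ (sForm F n).orthogonal W : Submodule F _) + (k + r) = n)
    (x y : (Fin n → F) × (Fin n → F)) (hx : x ∈ W) (hx' : x ∉ (sForm F n).orthogonal W)
    (hmin : ∀ z ∈ (sForm F n).orthogonal (W ⊓ (sForm F n).orthogonal W), z ≠ 0 → d ≤ swt z)
    (hy : y ∈ (sForm F n).orthogonal (W ⊓ (sForm F n).orthogonal W)) (hyd : swt y = d)
    (hyW : y ∉ W ∨ y = x) :
    ∃ C : AddSubgroup ((Fin n → F) × (Fin n → F)),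
      IsSubsysCode p C (Fintype.card F ^ (k + 1)) (Fintype.card F ^ (r - 1)) d ∧
      FqLinear C ∧ PureTo C d := by
  set B := sForm F n with hB
  obtain ⟨w, hw, hwx⟩ : ∃ w ∈ W, B w x ≠ 0 := by
    by_contra! hcon
    exact hx' hcon
  have hxw : B x w ≠ 0 := by rw [hB, sForm_neg, neg_ne_zero]; exact hwx
  set W1 : Submodule F _ := W ⊓ LinearMap.ker (B x) with hW1
  set G : Submodule F _ := W1 ⊓ LinearMap.ker (B w) with hG
  have hxW1 : x ∈ W1 := ⟨hx, by rw [SetLike.mem_coe, LinearMap.mem_ker]; exact sForm_alt F n x⟩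
  have e1 : Module.finrank F W1 + 1 = Module.finrank F W := finrank_inf_ker W (B x) w hw hxw
  have e2 : Module.finrank F G + 1 = Module.finrank F W1 := finrank_inf_ker W1 (B w) x hxW1 hwx
  have hGW : G ≤ W := fun z hz => hz.1.1
  have hrad : G ⊓ B.orthogonal G = W ⊓ B.orthogonal W := by
    ext z
    constructor
    · rintro ⟨hz, hz'⟩
      refine ⟨hGW hz, fun t ht => ?_⟩
      have hxz : B x z = 0 := hz.1.2
      have hwz : B w z = 0 := hz.2
      have hxx : B x x = 0 := sForm_alt F n x
      have hww : B w w = 0 := sForm_alt F n w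
      have hm : t - (B x t / B x w) • w - (B w t / B w x) • x ∈ G := by
        refine ⟨⟨W.sub_mem (W.sub_mem ht (W.smul_mem _ hw)) (W.smul_mem _ hx), ?_⟩, ?_⟩
        · rw [SetLike.mem_coe, LinearMap.mem_ker]; simp [hxx, hxw]
        · rw [SetLike.mem_coe, LinearMap.mem_ker]; simp [hww, hwx]
      have := hz' _ hm
      have h3 : B (t - (B x t / B x w) • w - (B w t / B w x) • x) z = 0 := this
      simpa [hxz, hwz] using h3
    · rintro ⟨hz, hz'⟩
      refine ⟨⟨⟨hz, ?_⟩, ?_⟩, fun t ht => hz' t (hGW ht)⟩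
      · exact hz' x hx
      · exact hz' w hw
  have hyG : y ∉ G := by
    rcases hyW with h | h
    · exact fun h' => h (hGW h')
    · rw [h]; exact fun h' => hwx h'.2
  have hy0 : y ≠ 0 := fun h => hyG (h ▸ G.zero_mem)
  have hDs : (G : Set ((Fin n → F) × (Fin n → F))) ∩ sympDual p (G : Set ((Fin n → F) × (Fin n → F))) =
      ((W ⊓ B.orthogonal W : Submodule F _) : Set ((Fin n → F) × (Fin n → F))) := by
    rw [sympDual_submodule p hp, ← hrad]; rfl
  have hGC : ((G.toAddSubgroup : AddSubgroup _) : Set ((Fin n → F) × (Fin n → F))) = G := rfl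
  refine ⟨G.toAddSubgroup, ?_, fun a v hv => G.smul_mem a hv, ?_⟩
  · unfold IsSubsysCode
    simp only [hGC, hDs]
    rw [sympDual_submodule p hp, ← hB]
    refine ⟨?_, ?_, ?_, ?_⟩
    · have : Nat.card ((W ⊓ B.orthogonal W : Submodule F _) : Set ((Fin n → F) × (Fin n → F)))
          = Fintype.card F ^ Module.finrank F (W ⊓ B.orthogonal W : Submodule F _) := by
        rw [← Nat.card_eq_fintype_card]
        exact Module.natCard_eq_pow_finrank (K := F) (V := (W ⊓ B.orthogonal W : Submodule F _))
      rw [this, ← pow_add, ← pow_add]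
      congr 1
      omega
    · have : Nat.card G.toAddSubgroup = Fintype.card F ^ Module.finrank F G := by
        rw [← Nat.card_eq_fintype_card]
        exact Module.natCard_eq_pow_finrank (K := F) (V := G)
      rw [this, ← pow_add, ← pow_add]
      congr 1
      omega
    · intro h
      exact absurd (h ▸ hy : y ∈ (G : Set _)) hyG
    · intro _
      unfold minSwt
      apply le_antisymm
      · refine le_csInf ⟨_, ⟨y, ⟨⟨hy, hyG⟩, hy0⟩, rfl⟩⟩ ?_
        rintro _ ⟨z, ⟨⟨hz, _⟩, hz0⟩, rfl⟩
        exact hmin z hz hz0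
      · exact Nat.sInf_le ⟨y, ⟨⟨hy, hyG⟩, hy0⟩, hyd⟩
  · intro v hv hv0
    refine hmin v ?_ hv0
    have hvW : v ∈ W := hGW hv
    intro t ht
    have : B v t = 0 := ht.2 v hvW
    exact sForm_refl F n _ _ this

/-- The twisting step: if all minimum weight vectors of `D^⊥` lie in `D`, change `D`. -/
theorem twist (F : Type) [Field F] [Fintype F]
    (n d : ℕ) (D : Submodule F ((Fin n → F) × (Fin n → F)))
    (hiso : D ≤ (sForm F n).orthogonal D) (hne : ∃ x ∈ (sForm F n).orthogonal D, x ∉ D)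
    (hmin : ∀ z ∈ (sForm F n).orthogonal D, z ≠ 0 → d ≤ swt z)
    (v : (Fin n → F) × (Fin n → F)) (hv : v ∈ D) (hv0 : v ≠ 0)
    (hall : ∀ z ∈ (sForm F n).orthogonal D, z ∉ D → d + 1 ≤ swt z) :
    ∃ D' : Submodule F ((Fin n → F) × (Fin n → F)), D' ≤ (sForm F n).orthogonal D' ∧
      Module.finrank F D' = Module.finrank F D ∧
      (∀ z ∈ (sForm F n).orthogonal D', z ≠ 0 → d ≤ swt z) ∧
      v ∈ (sForm F n).orthogonal D' ∧ v ∉ D' := by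
  set B := sForm F n with hB
  obtain ⟨x, hx, hxD⟩ := hne
  have hDD : B.orthogonal (B.orthogonal D) = D :=
    LinearMap.BilinForm.orthogonal_orthogonal (sForm_nondeg F n) (sForm_refl F n) D
  obtain ⟨w, hw, hwx⟩ : ∃ w ∈ B.orthogonal D, B w x ≠ 0 := by
    by_contra! hcon
    apply hxD
    rw [← hDD]
    exact hcon
  have hxw : B x w ≠ 0 := by rw [hB, sForm_neg, neg_ne_zero]; exact hwx
  obtain ⟨e, i, he, hev⟩ := exists_single F n v hv0
  set u := w + e with hu
  have hvw : B v w = 0 := hw v hv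
  have hwv : B w v = 0 := sForm_refl F n _ _ hvw
  have huv : B u v ≠ 0 := by rw [hu, map_add, LinearMap.add_apply, hwv, zero_add]; exact hev
  have hvu : B v u ≠ 0 := by rw [hB, sForm_neg, neg_ne_zero]; exact huv
  have hDx : ∀ z ∈ D, B z x = 0 := fun z hz => hx z hz
  have hxx : B x x = 0 := sForm_alt F n x
  set E : Submodule F _ := D ⊔ Submodule.span F {x} with hE
  have hDE : D ≤ E := le_sup_left
  have hxE : x ∈ E := le_sup_right (a := D) (Submodule.mem_span_singleton_self x)
  -- E is isotropic
  have hEiso : ∀ a ∈ E, ∀ b ∈ E, B a b = 0 := by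
    intro a ha b hb
    obtain ⟨a1, ha1, a2, ha2, rfl⟩ := Submodule.mem_sup.1 ha
    obtain ⟨b1, hb1, b2, hb2, rfl⟩ := Submodule.mem_sup.1 hb
    obtain ⟨s, rfl⟩ := Submodule.mem_span_singleton.1 ha2
    obtain ⟨t, rfl⟩ := Submodule.mem_span_singleton.1 hb2
    have q1 : B a1 b1 = 0 := hiso hb1 a1 ha1
    have q2 : B x b1 = 0 := sForm_refl F n _ _ (hDx b1 hb1)
    have q3 : B a1 x = 0 := hDx a1 ha1
    simp [q1, q2, q3, hxx]
  refine ⟨E ⊓ LinearMap.ker (B u), ?_, ?_, ?_, ?_, fun h => huv h.2⟩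
  · exact fun b hb a ha => hEiso a ha.1 b hb.1
  · have a1 := finrank_inf_ker E (B u) v (hDE hv) huv
    have a2 := Submodule.finrank_sup_span_singleton (K := F) hxD
    rw [← hE] at a2
    omega
  · intro y hy hy0
    set c := B v y / B v u with hc
    have hE2 : ∀ z ∈ E, B z (y - c • u) = 0 := by
      intro z hz
      have hm : z - (B u z / B u v) • v ∈ E ⊓ LinearMap.ker (B u) := by
        refine ⟨E.sub_mem hz (E.smul_mem _ (hDE hv)), ?_⟩
        rw [SetLike.mem_coe, LinearMap.mem_ker]; simp [huv]
      have h1 : B (z - (B u z / B u v) • v) y = 0 := hy _ hm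
      have h2 : B (z - (B u z / B u v) • v) u = 0 := sForm_refl F n _ _ hm.2
      have h3 : B v (y - c • u) = 0 := by simp [hc, hvu]
      have h4 : B (z - (B u z / B u v) • v) (y - c • u) = 0 := by
        rw [map_sub (B _), map_smul, h1, h2]; simp
      rw [map_sub B, LinearMap.sub_apply, map_smul B, LinearMap.smul_apply, h3] at h4
      simpa using h4
    by_cases hc0 : c = 0
    · refine hmin y (fun z hz => ?_) hy0
      have := hE2 z (hDE hz)
      rw [hc0, zero_smul, sub_zero] at this
      exact this
    · have hz1 : y - c • e ∈ B.orthogonal D := by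
        have : y - c • e = (y - c • u) + c • w := by rw [hu, smul_add]; abel
        rw [this]
        refine Submodule.add_mem _ (fun z hz => hE2 z (hDE hz)) (Submodule.smul_mem _ _ hw)
      have hz2 : y - c • e ∉ D := by
        intro hmem
        have h5 : B x (y - c • e) = 0 := sForm_refl F n _ _ (hDx _ hmem)
        have : y - c • e = (y - c • u) + c • w := by rw [hu, smul_add]; abel
        rw [this, map_add, hE2 x hxE, map_smul, zero_add, smul_eq_mul] at h5
        exact mul_ne_zero hc0 hxw h5
      have h6 := hall _ hz1 hz2
      have h7 := swt_add_single (y - c • e) (c • e) i (fun j hj => by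
        obtain ⟨p1, p2⟩ := he j hj
        simp [p1, p2])
      rw [sub_add_cancel] at h7
      omega
  · exact fun a ha => hEiso a ha.1 v (hDE hv)

end Aux

/-- `F_q`-linear trading of co-subsystem dimension for subsystem
dimension.  If there exists a pure `F_q`-linear `[[n,k,r,d]]_q` Clifford
subsystem code with `r > 0`, then there exists a pure `F_q`-linear
`[[n, k+1, r−1, d]]_q` Clifford subsystem code with the same minimum distance. -/
theorem trade_cosubsystem_for_subsystem_linear
    (p : ℕ) (hp : p.Prime) (F : Type) [Field F] [Fintype F] [CharP F p]
    (n k r d : ℕ) (hr : 0 < r)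
    (h : ∃ C : AddSubgroup ((Fin n → F) × (Fin n → F)),
      IsSubsysCode p C (Fintype.card F ^ k) (Fintype.card F ^ r) d ∧
      FqLinear C ∧ PureTo C d) :
    ∃ C : AddSubgroup ((Fin n → F) × (Fin n → F)),
      IsSubsysCode p C (Fintype.card F ^ (k + 1)) (Fintype.card F ^ (r - 1)) d ∧
      FqLinear C ∧ PureTo C d := by
  obtain ⟨C, hC, hlin, hpure⟩ := h
  set B := sForm F n with hB
  let W : Submodule F ((Fin n → F) × (Fin n → F)) :=
    { C with smul_mem' := fun a v hv => hlin a v hv }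
  have hCW : (C : Set ((Fin n → F) × (Fin n → F))) = (W : Set _) := rfl
  set D : Submodule F _ := W ⊓ B.orthogonal W with hD
  have hDs : (W : Set ((Fin n → F) × (Fin n → F))) ∩ sympDual p (W : Set ((Fin n → F) × (Fin n → F))) =
      (D : Set ((Fin n → F) × (Fin n → F))) := by
    rw [sympDual_submodule p hp]; rfl
  unfold IsSubsysCode at hC
  simp only [hCW, hDs] at hC
  rw [sympDual_submodule p hp, ← hB] at hC
  obtain ⟨hc1, hc2, hc3, hc4⟩ := hC
  have hq : 1 < Fintype.card F := Fintype.one_lt_card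
  have hinj := Nat.pow_right_injective hq
  have h2 : Module.finrank F D + (k + r) = n := by
    have : Nat.card (D : Set ((Fin n → F) × (Fin n → F)))
        = Fintype.card F ^ Module.finrank F D := by
      rw [← Nat.card_eq_fintype_card]
      exact Module.natCard_eq_pow_finrank (K := F) (V := D)
    rw [this, ← pow_add, ← pow_add] at hc1
    exact hinj hc1
  have h1 : Module.finrank F W + k = n + r := by
    have : Nat.card C = Fintype.card F ^ Module.finrank F W := by
      rw [← Nat.card_eq_fintype_card]
      exact Module.natCard_eq_pow_finrank (K := F) (V := W)
    rw [this, ← pow_add, ← pow_add] at hc2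
    exact hinj hc2
  have hpureW : ∀ z ∈ W, z ≠ 0 → d ≤ swt z := hpure
  have hWD : W ≤ B.orthogonal D := by
    intro v hv t ht
    exact sForm_refl F n _ _ (ht.2 v hv)
  have hxex : ∃ x ∈ W, x ∉ B.orthogonal W := by
    by_contra! hcon
    have : D = W := inf_eq_left.2 hcon
    rw [this] at h2
    omega
  by_cases hEq : (B.orthogonal D : Set ((Fin n → F) × (Fin n → F))) = (W : Set _)
  · have hEq' : B.orthogonal D = W := SetLike.coe_injective hEq
    have hd := hc3 hEq
    rw [hEq] at hd
    -- the orthogonal of W is D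
    have hWo : B.orthogonal W = D := by
      rw [← hEq']
      exact LinearMap.BilinForm.orthogonal_orthogonal (sForm_nondeg F n) (sForm_refl F n) D
    obtain ⟨x, hx, hx'⟩ := hxex
    have hx0 : x ≠ 0 := fun h => hx' (h ▸ Submodule.zero_mem _)
    have hmem := Nat.sInf_mem (s := swt '' ((W : Set ((Fin n → F) × (Fin n → F))) \ {0}))
      ⟨_, ⟨x, ⟨hx, hx0⟩, rfl⟩⟩
    obtain ⟨v, ⟨hvW, hv0⟩, hvd⟩ := hmem
    have hvd' : swt v = d := by rw [hd]; exact hvd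
    by_cases hex : ∃ y ∈ W, y ∉ D ∧ swt y = d
    · obtain ⟨y, hy, hyD, hyd⟩ := hex
      refine drop_pair p hp F n k r d hr W h1 h2 y y hy (by rw [← hB, hWo]; exact hyD) ?_ (hWD hy)
        hyd (Or.inr rfl)
      intro z hz hz0
      exact hpureW z (hEq' ▸ hz) hz0
    · push Not at hex
      have hvD : v ∈ D := by
        by_contra h
        exact hex v hvW h hvd'
      obtain ⟨D', q1, q2, q3, q4, q5⟩ := twist F n d D (fun z hz => hWD hz.1)
        ⟨x, hWD hx, hWo ▸ hx'⟩ (fun z hz hz0 => hpureW z (hEq' ▸ hz) hz0) v hvD hv0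
        (by
          intro z hz hzD
          have hzW : z ∈ W := hEq' ▸ hz
          have a1 := hpureW z hzW (fun h => hzD (h ▸ D.zero_mem))
          have a2 := hex z hzW hzD
          omega)
      rw [← hB] at q1 q3 q4
      have hoo : B.orthogonal (B.orthogonal D') = D' :=
        LinearMap.BilinForm.orthogonal_orthogonal (sForm_nondeg F n) (sForm_refl F n) D'
      have hr' : B.orthogonal D' ⊓ B.orthogonal (B.orthogonal D') = D' := by
        rw [hoo]; exact inf_eq_right.2 q1
      have f1 : Module.finrank F (B.orthogonal D') = Module.finrank F W := by
        rw [← hEq', LinearMap.BilinForm.finrank_orthogonal (sForm_nondeg F n),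
          LinearMap.BilinForm.finrank_orthogonal (sForm_nondeg F n), q2]
      refine drop_pair p hp F n k r d hr (B.orthogonal D') (by rw [f1]; exact h1) ?_ v v q4 ?_ ?_ ?_
        hvd' (Or.inr rfl)
      · rw [← hB, hr', q2]; exact h2
      · rw [← hB, hoo]; exact q5
      · rw [← hB, hr']; exact q3
      · rw [← hB, hr']; exact q4
  · have hd := hc4 hEq
    have hex : ∃ y ∈ B.orthogonal D, y ∉ W := by
      by_contra! hcon
      exact hEq (Set.Subset.antisymm hcon hWD)
    obtain ⟨y0, hy0, hy0W⟩ := hex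
    have hmem := Nat.sInf_mem
      (s := swt '' (((B.orthogonal D : Set ((Fin n → F) × (Fin n → F))) \ (W : Set _)) \ {0}))
      ⟨_, ⟨y0, ⟨⟨hy0, hy0W⟩, fun h => hy0W (by rw [Set.mem_singleton_iff.1 h]; exact W.zero_mem)⟩,
        rfl⟩⟩
    obtain ⟨y, ⟨⟨hy, hyW⟩, hyn⟩, hyd⟩ := hmem
    obtain ⟨x, hx, hx'⟩ := hxex
    refine drop_pair p hp F n k r d hr W h1 h2 x y hx hx' ?_ hy (by rw [hd]; exact hyd)
      (Or.inl hyW)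
    intro z hz hz0
    by_cases hzW : z ∈ W
    · exact hpureW z hzW hz0
    · rw [hd]
      exact Nat.sInf_le ⟨z, ⟨⟨hz, hzW⟩, hz0⟩, rfl⟩
end
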